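/- For integers m ≥ 1 and k ≥ 0, real 1 < p < ∞ and δ ∈ (−2m/p, −2m/p + 1), the operator (−Δ)^m is an isomorphism (a continuous linear bijection with continuous inverse) from M^p_{2m,δ}(ℝ^{2m}) onto Γ^p_δ(ℝ^{2m}). -/

import Mathlib

noncomputable section

open MeasureTheory Real Filter Topology Metric Set Bornology

/-- Euclidean space `ℝ^{2m}`. -/
abbrev Euc (m : ℕ) : Type := EuclideanSpace ℝ (Fin (2*m))

/-- Pointwise Laplacian `Δ f (x) = ∑ ∂²f/∂xᵢ²`. -/
def lap {m : ℕ} (f : Euc m → ℝ) (x : Euc m) : ℝ :=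
  ∑ i : Fin (2*m),
    fderiv ℝ (fun y => fderiv ℝ f y (EuclideanSpace.single i (1:ℝ))) x
      (EuclideanSpace.single i (1:ℝ))

/-- `(−Δ)^j f`, pointwise. -/
def negLapPow {m : ℕ} (j : ℕ) (f : Euc m → ℝ) : Euc m → ℝ :=
  (fun g x => -(lap g x))^[j] f

/-- Smooth test functions compactly supported inside `Ω`. -/
def IsTestOn {m : ℕ} (Ω : Set (Euc m)) (ψ : Euc m → ℝ) : Prop :=
  ContDiff ℝ (⊤ : ℕ∞) ψ ∧ HasCompactSupport ψ ∧ tsupport ψ ⊆ Ω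

/-- `u` solves `(−Δ)^m u = V e^{2mu}` on `Ω` in the distributional sense. -/
def SolvesQ {m : ℕ} (Ω : Set (Euc m)) (V u : Euc m → ℝ) : Prop :=
  ∀ ψ : Euc m → ℝ, IsTestOn Ω ψ →
    ∫ x in Ω, u x * negLapPow m ψ x = ∫ x in Ω, V x * Real.exp ((2*m : ℝ) * u x) * ψ x

/-- Volume of the standard unit `n`-sphere: `2 π^{(n+1)/2} / Γ((n+1)/2)`. -/
def sphereVol (n : ℕ) : ℝ :=
  2 * Real.pi ^ (((n : ℝ) + 1)/2) / Real.Gamma (((n : ℝ) + 1)/2)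

/-- `Λ₁ = (2m−1)! vol(S^{2m})`. -/
def Lambda1 (m : ℕ) : ℝ := (Nat.factorial (2*m - 1) : ℝ) * sphereVol (2*m)

/-- `γ_{2m} = Λ₁/2`. -/
def gamma2m (m : ℕ) : ℝ := Lambda1 m / 2

/-- The class `K(Ω,∅)`: smooth, nonpositive, not identically zero, `Δ^m φ ≡ 0` on `Ω`. -/
def memK {m : ℕ} (Ω : Set (Euc m)) (φ : Euc m → ℝ) : Prop :=
  ContDiffOn ℝ (⊤ : ℕ∞) φ Ω ∧ (∀ x ∈ Ω, φ x ≤ 0) ∧ (∃ x ∈ Ω, φ x ≠ 0) ∧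
    ∀ x ∈ Ω, negLapPow m φ x = 0

/-- `S_φ = {x ∈ Ω : φ(x) = 0}`. -/
def Sphi {m : ℕ} (Ω : Set (Euc m)) (φ : Euc m → ℝ) : Set (Euc m) :=
  {x | x ∈ Ω ∧ φ x = 0}

/-- `S_φ^* = S_φ ∪ {x ∈ ∂Ω : lim_{Ω ∋ y → x} φ(y) = 0}`. -/
def SphiStar {m : ℕ} (Ω : Set (Euc m)) (φ : Euc m → ℝ) : Set (Euc m) :=
  Sphi Ω φ ∪ {x | x ∈ frontier Ω ∧ Tendsto φ (𝓝[Ω] x) (𝓝 0)}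

/-- `u_k → +∞` locally uniformly on `S`. -/
def LocUnifTop {m : ℕ} (u : ℕ → Euc m → ℝ) (S : Set (Euc m)) : Prop :=
  ∀ K : Set (Euc m), K ⊆ S → IsCompact K → ∀ C : ℝ,
    ∀ᶠ k in atTop, ∀ x ∈ K, C ≤ u k x

/-- `u_k → −∞` locally uniformly on `S`. -/
def LocUnifBot {m : ℕ} (u : ℕ → Euc m → ℝ) (S : Set (Euc m)) : Prop :=
  ∀ K : Set (Euc m), K ⊆ S → IsCompact K → ∀ C : ℝ,
    ∀ᶠ k in atTop, ∀ x ∈ K, u k x ≤ C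

/-- The weighted `L^p` norm `‖(1+|x|²)^{δ/2} f‖_{L^p}` (for the space `L^p_δ(ℝ^{2m})`). -/
def wLp (m : ℕ) (p δ : ℝ) (f : Euc m → ℝ) : ℝ :=
  (∫ x : Euc m, ((1 + ‖x‖^2) ^ (δ/2) * |f x|) ^ p) ^ (1/p)

/-- The weighted Sobolev norm of `M^p_{k,δ}(ℝ^{2m})`:
`∑_{j ≤ k} ‖(1+|x|²)^{(δ+j)/2} D^j f‖_{L^p}`. -/
def Mnorm (m k : ℕ) (p δ : ℝ) (f : Euc m → ℝ) : ℝ :=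
  ∑ j ∈ Finset.range (k+1),
    (∫ x : Euc m, ((1 + ‖x‖^2) ^ ((δ + j)/2) * ‖iteratedFDeriv ℝ j f x‖) ^ p) ^ (1/p)


/-! ## Basics: partial derivatives, test functions, weights -/

abbrev EE (n : ℕ) : Type := EuclideanSpace ℝ (Fin n)

/-- basis vector -/
def bv {n : ℕ} (i : Fin n) : EE n := EuclideanSpace.single i (1:ℝ)

/-- partial derivative -/
def pd {n : ℕ} (i : Fin n) (f : EE n → ℝ) (x : EE n) : ℝ := fderiv ℝ f x (bv i)

/-- Laplacian in terms of `pd` -/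
def lpl {n : ℕ} (f : EE n → ℝ) (x : EE n) : ℝ := ∑ i, pd i (pd i f) x

/-- test functions -/
def TF {n : ℕ} (f : EE n → ℝ) : Prop := ContDiff ℝ (⊤ : ℕ∞) f ∧ HasCompactSupport f

/-- continuous compactly supported functions -/
def CC {n : ℕ} (f : EE n → ℝ) : Prop := Continuous f ∧ HasCompactSupport f

lemma norm_bv {n : ℕ} (i : Fin n) : ‖bv i‖ = 1 := by simp [bv]

lemma inner_bv {n : ℕ} (i : Fin n) (x : EE n) : inner ℝ x (bv i) = x i := by
  simp [bv, EuclideanSpace.inner_single_right]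

lemma contDiff_pd {n : ℕ} (i : Fin n) {f : EE n → ℝ} (hf : ContDiff ℝ (⊤ : ℕ∞) f) :
    ContDiff ℝ (⊤ : ℕ∞) (pd i f) := by
  have h : ContDiff ℝ (⊤ : ℕ∞) (fderiv ℝ f) := hf.fderiv_right (m := (⊤ : ℕ∞)) (by simp)
  exact h.clm_apply contDiff_const

lemma TF.pd {n : ℕ} {f : EE n → ℝ} (hf : TF f) (i : Fin n) : TF (pd i f) :=
  ⟨contDiff_pd i hf.1, by
    have := hf.2.fderiv (𝕜 := ℝ)
    exact this.comp_left (g := fun L : EE n →L[ℝ] ℝ => L (bv i)) (by simp)⟩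

lemma TF.cc {n : ℕ} {f : EE n → ℝ} (hf : TF f) : CC f := ⟨hf.1.continuous, hf.2⟩

lemma CC.integrable {n : ℕ} {f : EE n → ℝ} (hf : CC f) : Integrable f :=
  hf.1.integrable_of_hasCompactSupport hf.2

lemma CC.mul_left {n : ℕ} {f g : EE n → ℝ} (hf : CC f) (hg : Continuous g) :
    CC (fun x => g x * f x) := ⟨hg.mul hf.1, hf.2.mul_left⟩

lemma CC.mul_right {n : ℕ} {f g : EE n → ℝ} (hf : CC f) (hg : Continuous g) :
    CC (fun x => f x * g x) := ⟨hf.1.mul hg, hf.2.mul_right⟩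

lemma CC.add {n : ℕ} {f g : EE n → ℝ} (hf : CC f) (hg : CC g) :
    CC (fun x => f x + g x) := ⟨hf.1.add hg.1, hf.2.add hg.2⟩

lemma TF.add {n : ℕ} {f g : EE n → ℝ} (hf : TF f) (hg : TF g) :
    TF (fun x => f x + g x) := ⟨hf.1.add hg.1, hf.2.add hg.2⟩

lemma TF.mul_left {n : ℕ} {f g : EE n → ℝ} (hf : TF f) (hg : ContDiff ℝ (⊤ : ℕ∞) g) :
    TF (fun x => g x * f x) := ⟨hg.mul hf.1, hf.2.mul_left⟩

lemma TF.neg {n : ℕ} {f : EE n → ℝ} (hf : TF f) : TF (fun x => - f x) := by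
  have := hf.mul_left (g := fun _ => (-1 : ℝ)) contDiff_const
  simpa using this

lemma TF.sub {n : ℕ} {f g : EE n → ℝ} (hf : TF f) (hg : TF g) :
    TF (fun x => f x - g x) := by
  simpa [sub_eq_add_neg] using hf.add hg.neg

lemma TF.sum {n : ℕ} {ι : Type*} (s : Finset ι) {f : ι → EE n → ℝ} (hf : ∀ i ∈ s, TF (f i)) :
    TF (fun x => ∑ i ∈ s, f i x) := by
  classical
  induction s using Finset.induction_on with
  | empty => exact ⟨by simpa using contDiff_const, by simp only [Finset.sum_empty]; exact HasCompactSupport.zero⟩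
  | insert a s ha ih =>
    simp only [Finset.sum_insert ha]
    exact (hf a (by simp)).add (ih fun i hi => hf i (by simp [hi]))

lemma TF.lpl {n : ℕ} {f : EE n → ℝ} (hf : TF f) : TF (lpl f) :=
  TF.sum Finset.univ fun i _ => (hf.pd i).pd i

lemma TF.differentiable {n : ℕ} {f : EE n → ℝ} (hf : TF f) : Differentiable ℝ f :=
  hf.1.differentiable (by simp)

lemma pd_comm {n : ℕ} {f : EE n → ℝ} (hf : ContDiff ℝ (⊤ : ℕ∞) f) (i j : Fin n) :
    pd i (pd j f) = pd j (pd i f) := by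
  funext x
  have h1 : DifferentiableAt ℝ (fderiv ℝ f) x :=
    (hf.fderiv_right (m := (⊤ : ℕ∞)) (by simp)).differentiable (by simp) x
  have key : ∀ a b : Fin n, pd a (pd b f) x = fderiv ℝ (fderiv ℝ f) x (bv a) (bv b) := by
    intro a b
    have : HasFDerivAt (pd b f) ((fderiv ℝ (fderiv ℝ f) x).flip (bv b)) x := by
      have := h1.hasFDerivAt.clm_apply (hasFDerivAt_const (bv b) x)
      rw [ContinuousLinearMap.comp_zero, zero_add] at this
      exact this
    rw [pd, this.fderiv]; rfl
  rw [key, key]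
  have hs : IsSymmSndFDerivAt ℝ f x :=
    hf.contDiffAt.isSymmSndFDerivAt (by
      simp only [minSmoothness_of_isRCLikeNormedField]
      exact WithTop.coe_le_coe.2 (le_top : (2 : ℕ∞) ≤ ⊤))
  exact hs.eq _ _

lemma pd_add {n : ℕ} {f g : EE n → ℝ} (hf : Differentiable ℝ f) (hg : Differentiable ℝ g)
    (i : Fin n) (x : EE n) : pd i (fun x => f x + g x) x = pd i f x + pd i g x := by
  have := fderiv_fun_add (hf x) (hg x)
  simp [pd, this]

lemma pd_mul {n : ℕ} {f g : EE n → ℝ} (hf : Differentiable ℝ f) (hg : Differentiable ℝ g)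
    (i : Fin n) (x : EE n) :
    pd i (fun x => f x * g x) x = f x * pd i g x + pd i f x * g x := by
  have := fderiv_fun_mul (hf x) (hg x)
  simp [pd, this]; ring

lemma pd_sum {n : ℕ} {ι : Type*} (s : Finset ι) {f : ι → EE n → ℝ}
    (hf : ∀ i ∈ s, Differentiable ℝ (f i)) (i : Fin n) (x : EE n) :
    pd i (fun x => ∑ k ∈ s, f k x) x = ∑ k ∈ s, pd i (f k) x := by
  have := fderiv_fun_sum (u := s) (A := f) (x := x) (fun k hk => hf k hk x)
  simp [pd, this]

lemma lpl_pd {n : ℕ} {f : EE n → ℝ} (hf : TF f) (i : Fin n) :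
    lpl (pd i f) = pd i (lpl f) := by
  funext x
  have : lpl f = fun x => ∑ k ∈ Finset.univ, pd k (pd k f) x := rfl
  rw [this, pd_sum _ (fun k _ => ((hf.pd k).pd k).differentiable)]
  simp only [lpl]
  refine Finset.sum_congr rfl fun k _ => ?_
  rw [pd_comm hf.1 k i, pd_comm (hf.pd k).1 k i]

lemma hasLineDerivAt_pd {n : ℕ} {f : EE n → ℝ} (hf : Differentiable ℝ f) (i : Fin n) (x : EE n) :
    HasLineDerivAt ℝ f (pd i f x) x (bv i) :=
  (hf x).hasFDerivAt.hasLineDerivAt (bv i)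

/-- integration by parts along a line -/
lemma ibp_line {n : ℕ} {f f' g g' : EE n → ℝ} {e : EE n} (hfc : HasCompactSupport f)
    (cf : Continuous f) (cf' : Continuous f') (cg : Continuous g) (cg' : Continuous g')
    (hf : ∀ x, HasLineDerivAt ℝ f (f' x) x e) (hg : ∀ x, HasLineDerivAt ℝ g (g' x) x e) :
    ∫ x, f x * g' x = - ∫ x, f' x * g x := by
  have hsub : Function.support f' ⊆ tsupport f := by
    intro x hx
    by_contra h
    have h0 : f =ᶠ[𝓝 x] 0 := notMem_tsupport_iff_eventuallyEq.mp h
    have := h0.lineDeriv_eq (𝕜 := ℝ) (v := e)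
    rw [(hf x).lineDeriv] at this
    apply hx
    rw [this]
    simp [lineDeriv]
  have hfc' : HasCompactSupport f' := hfc.mono' hsub
  have := integral_bilinear_hasLineDerivAt_right_eq_neg_left_of_integrable (μ := volume)
    (B := ContinuousLinearMap.mul ℝ ℝ) (f := f) (f' := f') (g := g) (g' := g') (v := e)
    ((cf'.mul cg).integrable_of_hasCompactSupport hfc'.mul_right)
    ((cf.mul cg').integrable_of_hasCompactSupport hfc.mul_right)
    ((cf.mul cg).integrable_of_hasCompactSupport hfc.mul_right)
    (fun x _ => hf x) (fun x _ => hg x)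
  simpa using this

lemma ibp_pd {n : ℕ} {f g : EE n → ℝ} (hf : TF f) (hg : ContDiff ℝ (⊤ : ℕ∞) g) (i : Fin n) :
    ∫ x, f x * pd i g x = - ∫ x, pd i f x * g x :=
  ibp_line (e := bv i) hf.2 hf.1.continuous (hf.pd i).1.continuous hg.continuous
    (contDiff_pd i hg).continuous (hasLineDerivAt_pd hf.differentiable i)
    (hasLineDerivAt_pd (hg.differentiable (by simp)) i)

lemma integral_pd {n : ℕ} {f : EE n → ℝ} (hf : TF f) (i : Fin n) : ∫ x, pd i f x = 0 := by
  have := ibp_pd hf (g := fun _ => (1:ℝ)) contDiff_const i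
  have h2 : ∀ x : EE n, pd i (fun _ => (1:ℝ)) x = 0 := by intro x; simp [pd]
  simp only [h2] at this
  simp at this
  linarith

lemma integral_lpl {n : ℕ} {f : EE n → ℝ} (hf : TF f) : ∫ x, lpl f x = 0 := by
  have : lpl f = fun x => ∑ k ∈ Finset.univ, pd k (pd k f) x := rfl
  rw [this, integral_finsetSum _ (fun k _ => ((hf.pd k).pd k).cc.integrable)]
  exact Finset.sum_eq_zero fun k _ => integral_pd (hf.pd k) k

/-- weights -/
def wt {n : ℕ} (s : ℝ) (x : EE n) : ℝ := (1 + ‖x‖^2) ^ (s/2)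

lemma base_pos {n : ℕ} (x : EE n) : 0 < 1 + ‖x‖^2 := by positivity

lemma wt_pos {n : ℕ} (s : ℝ) (x : EE n) : 0 < wt s x := Real.rpow_pos_of_pos (base_pos x) _

lemma wt_add {n : ℕ} (s t : ℝ) (x : EE n) : wt (s + t) x = wt s x * wt t x := by
  rw [wt, add_div, Real.rpow_add (base_pos x)]; rfl

lemma wt_zero {n : ℕ} (x : EE n) : wt 0 x = 1 := by simp [wt]

lemma wt_rpow {n : ℕ} (s t : ℝ) (x : EE n) : wt s x ^ t = wt (s * t) x := by
  rw [wt, wt, ← Real.rpow_mul (base_pos x).le]; congr 1; ring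

lemma wt_mono {n : ℕ} {s t : ℝ} (h : s ≤ t) (x : EE n) : wt s x ≤ wt t x :=
  Real.rpow_le_rpow_of_exponent_le (by nlinarith [sq_nonneg ‖x‖]) (by linarith)

lemma one_le_wt {n : ℕ} {s : ℝ} (h : 0 ≤ s) (x : EE n) : 1 ≤ wt s x := by
  simpa [wt_zero] using wt_mono h x

lemma wt_two {n : ℕ} (x : EE n) : wt 2 x = 1 + ‖x‖^2 := by simp [wt]

lemma wt_one_sq {n : ℕ} (x : EE n) : wt 1 x ^ 2 = 1 + ‖x‖^2 := by
  rw [← wt_two, show (2:ℝ) = 1 + 1 by norm_num, wt_add, sq]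

lemma norm_le_wt {n : ℕ} (x : EE n) : ‖x‖ ≤ wt 1 x := by
  apply le_of_sq_le_sq _ (wt_pos 1 x).le
  rw [wt_one_sq]; linarith

lemma abs_apply_le_wt {n : ℕ} (x : EE n) (i : Fin n) : |x i| ≤ wt 1 x :=
  (by simpa using PiLp.norm_apply_le x i : |x i| ≤ ‖x‖).trans (norm_le_wt x)

lemma contDiff_wt {n : ℕ} (s : ℝ) : ContDiff ℝ (⊤ : ℕ∞) (wt s : EE n → ℝ) := by
  unfold wt
  exact (contDiff_const.add (contDiff_norm_sq ℝ)).rpow_const_of_ne fun x => (base_pos x).ne'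

lemma continuous_wt {n : ℕ} (s : ℝ) : Continuous (wt s : EE n → ℝ) := (contDiff_wt s).continuous

lemma pd_wt {n : ℕ} (s : ℝ) (i : Fin n) (x : EE n) : pd i (wt s) x = s * (x i * wt (s - 2) x) := by
  have h1 : HasFDerivAt (fun x : EE n => 1 + ‖x‖^2) (2 • (innerSL ℝ x)) x := by
    simpa using (hasStrictFDerivAt_norm_sq x).hasFDerivAt.const_add 1
  have h2 := h1.rpow_const (p := s/2) (Or.inl (base_pos x).ne')
  have : HasFDerivAt (wt s : EE n → ℝ) _ x := h2
  rw [pd, this.fderiv]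
  simp only [_root_.smul_apply, innerSL_apply_apply, inner_bv, smul_eq_mul,
    nsmul_eq_mul]
  rw [wt, show (s - 2)/2 = s/2 - 1 by ring]
  push_cast; ring

/-- weighted norm -/
def NN {n : ℕ} (p s : ℝ) (f : EE n → ℝ) : ℝ := (∫ x, (wt s x * |f x|) ^ p) ^ (1/p)

lemma NN_nonneg {n : ℕ} (p s : ℝ) (f : EE n → ℝ) : 0 ≤ NN p s f :=
  Real.rpow_nonneg (integral_nonneg fun x =>
    Real.rpow_nonneg (mul_nonneg (wt_pos s x).le (abs_nonneg _)) _) _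

lemma NN_eq {n : ℕ} {p : ℝ} (hp : 1 < p) (s : ℝ) {f : EE n → ℝ}
    (hf : MemLp (fun x => wt s x * f x) (ENNReal.ofReal p)) :
    NN p s f = (eLpNorm (fun x => wt s x * f x) (ENNReal.ofReal p) volume).toReal := by
  have hp0 : 0 < p := by linarith
  rw [hf.eLpNorm_eq_integral_rpow_norm (by simpa using hp0) (by simp)]
  rw [ENNReal.toReal_ofReal hp0.le, ENNReal.toReal_ofReal, NN, one_div]
  · simp only [norm_mul, Real.norm_eq_abs, abs_of_pos (wt_pos s _)]
  · positivity

lemma CC.memLp {n : ℕ} {p : ℝ} (s : ℝ) {f : EE n → ℝ} (hf : CC f) :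
    MemLp (fun x => wt s x * f x) (ENNReal.ofReal p) :=
  (hf.mul_left (continuous_wt s)).1.memLp_of_hasCompactSupport (hf.mul_left (continuous_wt s)).2

lemma NN_congr {n : ℕ} {p s : ℝ} {f g : EE n → ℝ} (h : ∀ x, |f x| = |g x|) :
    NN p s f = NN p s g := by
  simp only [NN, h]

lemma NN_le_sum {n : ℕ} {p : ℝ} (hp : 1 < p) {s : ℝ} {f : EE n → ℝ} {ι : Type*} (S : Finset ι)
    {t : ι → ℝ} {g : ι → EE n → ℝ} {c : ι → ℝ} (hc : ∀ i ∈ S, 0 ≤ c i) (hf : CC f)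
    (hg : ∀ i ∈ S, CC (g i))
    (h : ∀ x, wt s x * |f x| ≤ ∑ i ∈ S, c i * (wt (t i) x * |g i x|)) :
    NN p s f ≤ ∑ i ∈ S, c i * NN p (t i) (g i) := by
  have hp1 : (1 : ENNReal) ≤ ENNReal.ofReal p := by
    rw [ENNReal.one_le_ofReal]; exact hp.le
  have hm : ∀ i ∈ S, MemLp (fun x => c i * (wt (t i) x * |g i x|)) (ENNReal.ofReal p) := by
    intro i hi
    have : CC (fun x => |g i x|) := ⟨(hg i hi).1.abs, (hg i hi).2.comp_left abs_zero⟩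
    exact (this.memLp (t i)).const_mul _
  have h1 : eLpNorm (fun x => wt s x * f x) (ENNReal.ofReal p) volume ≤
      eLpNorm (∑ i ∈ S, fun x => c i * (wt (t i) x * |g i x|)) (ENNReal.ofReal p) volume := by
    apply eLpNorm_mono
    intro x
    rw [Finset.sum_apply]
    simp only [norm_mul, Real.norm_eq_abs, abs_of_pos (wt_pos s _)]
    exact (h x).trans (le_abs_self _)
  have h2 : eLpNorm (∑ i ∈ S, fun x => c i * (wt (t i) x * |g i x|)) (ENNReal.ofReal p) volume ≤
      ∑ i ∈ S, eLpNorm (fun x => c i * (wt (t i) x * |g i x|)) (ENNReal.ofReal p) volume :=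
    eLpNorm_sum_le (fun i hi => (hm i hi).1) hp1
  rw [NN_eq hp s (hf.memLp s)]
  have h3 := ENNReal.toReal_mono (ENNReal.sum_ne_top.mpr fun i hi => (hm i hi).2.ne) (h1.trans h2)
  refine h3.trans (le_of_eq ?_)
  rw [ENNReal.toReal_sum fun i hi => (hm i hi).2.ne]
  refine Finset.sum_congr rfl fun i hi => ?_
  have : CC (fun x => |g i x|) := ⟨(hg i hi).1.abs, (hg i hi).2.comp_left abs_zero⟩
  rw [NN_congr (g := fun x => |g i x|) (by simp), NN_eq hp (t i) (this.memLp (t i))]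
  have : (fun x => c i * (wt (t i) x * |g i x|)) = c i • (fun x => wt (t i) x * |g i x|) := rfl
  rw [this, eLpNorm_const_smul]
  simp [abs_of_nonneg (hc i hi)]

lemma NN_le_of_le {n : ℕ} {p : ℝ} (hp : 1 < p) {s t C : ℝ} (hC : 0 ≤ C) {f g : EE n → ℝ}
    (hf : CC f) (hg : CC g) (h : ∀ x, wt s x * |f x| ≤ C * (wt t x * |g x|)) :
    NN p s f ≤ C * NN p t g := by
  have := NN_le_sum hp (s := s) (f := f) (S := {()}) (t := fun _ : Unit => t) (g := fun _ => g)
    (c := fun _ => C) (by simpa using hC) hf (by simpa using hg) (by simpa using h)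
  simpa using this


/-! ## Hardy inequality -/

lemma NN_pow {n : ℕ} {p : ℝ} (hp : 1 < p) (s : ℝ) (f : EE n → ℝ) :
    NN p s f ^ p = ∫ x, (wt s x * |f x|) ^ p := by
  rw [NN, ← Real.rpow_mul, one_div, inv_mul_cancel₀ (by linarith), Real.rpow_one]
  exact integral_nonneg fun x =>
    Real.rpow_nonneg (mul_nonneg (wt_pos s x).le (abs_nonneg _)) _

lemma holder_cc {n : ℕ} {p : ℝ} (hp : 1 < p) {a b : EE n → ℝ} (ha : CC a) (hb : CC b)
    (ha0 : ∀ x, 0 ≤ a x) (hb0 : ∀ x, 0 ≤ b x) :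
    ∫ x, a x ^ (p - 1) * b x ≤ ((∫ x, a x ^ p) ^ (1/p)) ^ (p-1) * (∫ x, b x ^ p) ^ (1/p) := by
  have hpq : (p / (p-1)).HolderConjugate p := (Real.HolderConjugate.conjExponent hp).symm
  have hp1 : 0 < p - 1 := by linarith
  have ha' : CC (fun x => a x ^ (p-1)) :=
    ⟨ha.1.rpow_const fun x => Or.inr hp1.le, ha.2.comp_left (g := fun y : ℝ => y ^ (p-1))
      (Real.zero_rpow hp1.ne')⟩
  have := integral_mul_le_Lp_mul_Lq_of_nonneg (μ := (volume : Measure (EE n))) hpq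
    (f := fun x => a x ^ (p-1)) (g := b)
    (Eventually.of_forall fun x => Real.rpow_nonneg (ha0 x) _)
    (Eventually.of_forall fun x => hb0 x)
    (ha'.1.memLp_of_hasCompactSupport ha'.2) (hb.1.memLp_of_hasCompactSupport hb.2)
  refine this.trans (le_of_eq ?_)
  congr 1
  have h1 : ∀ x, (a x ^ (p-1)) ^ (p/(p-1)) = a x ^ p := by
    intro x
    rw [← Real.rpow_mul (ha0 x)]; congr 1; field_simp
  simp only [h1]
  rw [← Real.rpow_mul (integral_nonneg fun x => Real.rpow_nonneg (ha0 x) _)]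
  congr 1
  field_simp

lemma sum_sq_eq {n : ℕ} (x : EE n) : ∑ i, x i * x i = ‖x‖^2 := by
  rw [EuclideanSpace.norm_sq_eq]; simp [sq]

lemma pd_coord {n : ℕ} (i : Fin n) (x : EE n) : pd i (fun y : EE n => y i) x = 1 := by
  have : HasFDerivAt (fun y : EE n => y i) (EuclideanSpace.proj i : EE n →L[ℝ] ℝ) x :=
    (EuclideanSpace.proj i : EE n →L[ℝ] ℝ).hasFDerivAt
  rw [pd, this.fderiv]; simp [bv]

lemma contDiff_coord {n : ℕ} (i : Fin n) : ContDiff ℝ (⊤ : ℕ∞) (fun y : EE n => y i) :=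
  (EuclideanSpace.proj i : EE n →L[ℝ] ℝ).contDiff

lemma continuous_absrpow_deriv {p : ℝ} (hp : 1 < p) :
    Continuous (fun y : ℝ => p * |y| ^ (p-2) * y) := by
  have h : ContDiff ℝ 1 (fun y : ℝ => |y| ^ p) := by
    simpa using contDiff_norm_rpow (E := ℝ) hp
  have h2 := h.continuous_deriv le_rfl
  have : deriv (fun y : ℝ => |y| ^ p) = fun y => p * |y| ^ (p-2) * y := by
    funext y; exact (hasDerivAt_abs_rpow y hp).deriv
  rwa [this] at h2

lemma hardy {n : ℕ} (hn : 0 < n) {p a : ℝ} (hp : 1 < p) (ha : 0 < a * p + n) :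
    ∃ C : ℝ, 0 < C ∧ ∀ u : EE n → ℝ, TF u → NN p a u ≤ C * ∑ i, NN p (a+1) (pd i u) := by
  have hn' : (0:ℝ) < n := by exact_mod_cast hn
  have hp0 : 0 < p := by linarith
  obtain ⟨c, hc, hc1, hc2⟩ : ∃ c : ℝ, 0 < c ∧ c ≤ n ∧ c ≤ a * p + n :=
    ⟨min n (a*p+n), lt_min hn' ha, min_le_left _ _, min_le_right _ _⟩
  refine ⟨p / c, by positivity, fun u hu => ?_⟩
  set X := NN p a u with hX
  have hX0 : 0 ≤ X := NN_nonneg _ _ _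
  -- the vector field
  have hv : ∀ i, ContDiff ℝ (⊤ : ℕ∞) (fun x : EE n => x i * wt (a*p) x) :=
    fun i => (contDiff_coord i).mul (contDiff_wt _)
  have hpd : ∀ i (x : EE n), pd i (fun x : EE n => x i * wt (a*p) x) x
      = wt (a*p) x + a * p * (x i * x i) * wt (a*p-2) x := by
    intro i x
    rw [pd_mul ((contDiff_coord i).differentiable (by simp))
      ((contDiff_wt _).differentiable (by simp)), pd_coord, pd_wt]; ring
  have hUc : CC (fun x => |u x| ^ p) := ⟨hu.1.continuous.abs.rpow_const fun x => Or.inr hp0.le,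
    hu.2.comp_left (g := fun y : ℝ => |y| ^ p) (by simp [hp0.ne'])⟩
  have key : ∀ i, ∫ x, |u x| ^ p * pd i (fun x : EE n => x i * wt (a*p) x) x
      ≤ p * (X ^ (p-1) * NN p (a+1) (pd i u)) := by
    intro i
    rw [ibp_line (e := bv i) (f := fun x => |u x|^p)
      (f' := fun x => p * |u x| ^ (p-2) * u x * pd i u x)
      (g := fun x : EE n => x i * wt (a*p) x) hUc.2 hUc.1
      (((continuous_absrpow_deriv hp).comp hu.1.continuous).mul (hu.pd i).1.continuous)
      (hv i).continuous (contDiff_pd i (hv i)).continuous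
      (fun x => by
        have := hasLineDerivAt_pd hu.differentiable i x
        have h2 := hasDerivAt_abs_rpow (u (x + (0:ℝ) • bv i)) hp
        have := HasDerivAt.comp (0:ℝ) h2 this
        simp only [zero_smul, add_zero] at this
        exact this)
      (hasLineDerivAt_pd ((hv i).differentiable (by simp)) i), ← integral_neg]
    have hA : CC (fun x => wt a x * |u x|) :=
      (show CC (fun x => |u x|) from ⟨hu.1.continuous.abs, hu.2.comp_left abs_zero⟩).mul_left
        (continuous_wt a)
    have hB : CC (fun x => wt (a+1) x * |pd i u x|) :=
      (show CC (fun x => |pd i u x|) from ⟨(hu.pd i).1.continuous.abs,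
        (hu.pd i).2.comp_left abs_zero⟩).mul_left (continuous_wt (a+1))
    have hH := holder_cc hp hA hB (fun x => mul_nonneg (wt_pos _ x).le (abs_nonneg _))
      (fun x => mul_nonneg (wt_pos _ x).le (abs_nonneg _))
    refine le_trans ?_ (mul_le_mul_of_nonneg_left hH hp0.le)
    rw [← integral_const_mul]
    have hp1 : 0 < p - 1 := by linarith
    have hA' : CC (fun x => (wt a x * |u x|) ^ (p-1)) :=
      ⟨hA.1.rpow_const fun x => Or.inr hp1.le, hA.2.comp_left (g := fun y : ℝ => y ^ (p-1))
        (Real.zero_rpow hp1.ne')⟩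
    apply integral_mono
    · refine (((((continuous_absrpow_deriv hp).comp hu.1.continuous).mul
        (hu.pd i).1.continuous).mul (hv i).continuous).neg).integrable_of_hasCompactSupport ?_
      exact ((hu.pd i).2.mul_left.mul_right).neg
    · exact (hA'.mul_right hB.1).integrable.const_mul p
    · intro x
      refine (neg_le_abs _).trans ?_
      have e1 : |u x| ^ (p-2) * |u x| = |u x| ^ (p-1) := by
        rcases eq_or_ne (u x) 0 with h | h
        · simp [h, hp1.ne']
        · rw [← Real.rpow_add_one (abs_ne_zero.mpr h)]; congr 1; ring
      have e2 : (wt a x * |u x|) ^ (p-1) = wt (a*(p-1)) x * |u x|^(p-1) := by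
        rw [Real.mul_rpow (wt_pos _ x).le (abs_nonneg _), wt_rpow]
      have e3 : wt (a*(p-1)) x * wt (a+1) x = wt (a*p) x * wt 1 x := by
        rw [← wt_add, ← wt_add]; congr 1; ring
      simp only [abs_mul, abs_of_pos hp0, abs_of_pos (wt_pos _ x),
        abs_of_nonneg (Real.rpow_nonneg (abs_nonneg (u x)) _)]
      calc p * |u x| ^ (p-2) * |u x| * |pd i u x| * (|x i| * wt (a*p) x)
          = p * (|u x| ^ (p-2) * |u x|) * |pd i u x| * wt (a*p) x * |x i| := by ring
        _ ≤ p * (|u x| ^ (p-2) * |u x|) * |pd i u x| * wt (a*p) x * wt 1 x := by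
            apply mul_le_mul_of_nonneg_left (abs_apply_le_wt x i)
            have := (wt_pos (a*p) x).le
            positivity
        _ = p * (|u x| ^ (p-1) * |pd i u x| * (wt (a*p) x * wt 1 x)) := by rw [e1]; ring
        _ = p * ((wt a x * |u x|) ^ (p-1) * (wt (a+1) x * |pd i u x|)) := by
            rw [← e3, e2]; ring
  have hintg : ∀ i, Integrable (fun x => |u x| ^ p * pd i (fun x : EE n => x i * wt (a*p) x) x) :=
    fun i => (hUc.mul_right (contDiff_pd i (hv i)).continuous).integrable
  have hlow : c * X ^ p ≤ ∑ i, ∫ x, |u x| ^ p * pd i (fun x : EE n => x i * wt (a*p) x) x := by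
    rw [← integral_finsetSum _ (fun i _ => hintg i), NN_pow hp, ← integral_const_mul]
    have e2 : ∀ x, (wt a x * |u x|) ^ p = wt (a*p) x * |u x|^p := by
      intro x; rw [Real.mul_rpow (wt_pos _ x).le (abs_nonneg _), wt_rpow]
    simp only [e2]
    apply integral_mono
    · exact (hUc.mul_left (continuous_wt (a*p))).integrable.const_mul c
    · exact integrable_finsetSum _ (fun i _ => hintg i)
    · intro x
      simp only [hpd, ← Finset.mul_sum, Finset.sum_add_distrib, Finset.sum_const, Finset.card_univ,
        Fintype.card_fin, nsmul_eq_mul, ← Finset.sum_mul, sum_sq_eq]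
      have h3 : wt (a*p) x = wt (a*p-2) x * (1 + ‖x‖^2) := by
        rw [← wt_two, ← wt_add]; congr 1; ring
      have h4 : 0 ≤ |u x|^p := by positivity
      have h5 := wt_pos (a*p-2) x
      have h6 : c * wt (a*p) x ≤ n * wt (a*p) x + a*p*‖x‖^2 * wt (a*p-2) x := by
        rw [h3]
        have : c * (1 + ‖x‖^2) ≤ n * (1+‖x‖^2) + a*p*‖x‖^2 := by nlinarith [sq_nonneg ‖x‖]
        nlinarith
      nlinarith
  have hup := hlow.trans (Finset.sum_le_sum fun i _ => key i)
  rw [← Finset.mul_sum, ← Finset.mul_sum] at hup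
  rcases hX0.eq_or_lt with h | h
  · rw [← h]
    exact mul_nonneg (by positivity) (Finset.sum_nonneg fun i _ => NN_nonneg _ _ _)
  · have e : X ^ p = X ^ (p-1) * X := by rw [← Real.rpow_add_one h.ne']; congr 1; ring
    rw [e] at hup
    have hXp : 0 < X ^ (p-1) := Real.rpow_pos_of_pos h _
    rw [div_mul_eq_mul_div, le_div_iff₀ hc]
    nlinarith


/-! ## Integral bounds -/

lemma wt_eq {n : ℕ} (s : ℝ) (x : EE n) : wt s x = (wt 1 x) ^ s := by
  rw [wt_rpow]; congr 1; ring

lemma rho_lip {n : ℕ} (x y : EE n) : wt 1 x ≤ wt 1 y + ‖x - y‖ := by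
  apply le_of_sq_le_sq _ (by have := wt_pos 1 y; positivity)
  have h1 := wt_one_sq x
  have h2 := wt_one_sq y
  have h3 := norm_le_wt y
  have h4 : ‖x‖ ≤ ‖y‖ + ‖x - y‖ := by
    have := norm_add_le y (x - y); simpa using this
  have h5 := norm_nonneg (x - y)
  have h6 := norm_nonneg x
  have h7 : ‖x‖^2 ≤ (‖y‖ + ‖x-y‖)^2 := by gcongr
  nlinarith

lemma lintegral_scale {n : ℕ} (F : EE n → ENNReal) {R : ℝ} (hR : 0 < R) :
    ∫⁻ y, F (R⁻¹ • y) = ENNReal.ofReal (R ^ n) * ∫⁻ z, F z := by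
  have h := Measure.map_addHaar_smul (volume : Measure (EE n)) (r := R⁻¹) (by positivity)
  have h2 : MeasurableEmbedding (fun y : EE n => R⁻¹ • y) :=
    (Homeomorph.smulOfNeZero R⁻¹ (by positivity : R⁻¹ ≠ 0)).measurableEmbedding
  rw [← h2.lintegral_map, h, lintegral_smul_measure]
  simp only [finrank_euclideanSpace, Fintype.card_fin, smul_eq_mul]
  congr 2
  rw [inv_pow, inv_inv, abs_of_pos (by positivity)]

lemma lint_ball {n : ℕ} (hn : 0 < n) {η : ℝ} (hη : 0 < η) :
    ∃ C : ℝ, 0 < C ∧ ∀ R : ℝ, 0 < R →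
      ∫⁻ y in ball (0 : EE n) R, ENNReal.ofReal (‖y‖ ^ (η - n)) ≤ ENNReal.ofReal (C * R ^ η) := by
  have hintg : IntegrableOn (fun y : EE n => ‖y‖ ^ (η - n)) (ball 0 1) := by
    refine integrableOn_ball_of_norm_le_rpow (C := 1) (α := n - η) ?_ ?_ ?_ ?_
    · rw [finrank_euclideanSpace, Fintype.card_fin]; exact hn
    · rw [finrank_euclideanSpace, Fintype.card_fin]; linarith
    · refine Eventually.of_forall fun y => ?_
      rw [one_mul, Real.norm_of_nonneg (by positivity)]
      simp
    · exact (measurable_norm.pow_const _).aestronglyMeasurable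
  have hfin := hintg.setLIntegral_lt_top
  set I := ∫⁻ y in ball (0 : EE n) 1, ENNReal.ofReal (‖y‖ ^ (η - n)) with hI
  refine ⟨I.toReal + 1, by positivity, fun R hR => ?_⟩
  have h1 : ∫⁻ y in ball (0 : EE n) R, ENNReal.ofReal (‖y‖ ^ (η - n)) =
      ENNReal.ofReal (R ^ η) * I := by
    rw [hI, ← lintegral_indicator measurableSet_ball, ← lintegral_indicator measurableSet_ball]
    have : ∀ y : EE n, (ball (0 : EE n) R).indicator
        (fun y => ENNReal.ofReal (‖y‖ ^ (η - n))) y = ENNReal.ofReal (R ^ (η - n)) *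
        (ball (0 : EE n) 1).indicator (fun y => ENNReal.ofReal (‖y‖ ^ (η - n))) (R⁻¹ • y) := by
      intro y
      have e : R⁻¹ • y ∈ ball (0 : EE n) 1 ↔ y ∈ ball (0 : EE n) R := by
        simp only [mem_ball_zero_iff, norm_smul, norm_inv, Real.norm_of_nonneg hR.le]
        rw [inv_mul_lt_iff₀ hR, mul_one]
      by_cases hy : y ∈ ball (0 : EE n) R
      · rw [indicator_of_mem hy, indicator_of_mem (e.mpr hy), ← ENNReal.ofReal_mul (by positivity)]
        rw [norm_smul, norm_inv, Real.norm_of_nonneg hR.le, Real.mul_rpow (by positivity)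
          (norm_nonneg _), Real.inv_rpow hR.le, ← mul_assoc, mul_inv_cancel₀ (by positivity),
          one_mul]
      · rw [indicator_of_notMem hy, indicator_of_notMem (fun h => hy (e.mp h)), mul_zero]
    simp_rw [this]
    rw [lintegral_const_mul' _ _ ENNReal.ofReal_ne_top, lintegral_scale _ hR, ← mul_assoc,
      ← ENNReal.ofReal_mul (by positivity)]
    congr 2
    rw [← Real.rpow_natCast, ← Real.rpow_add hR]; congr 1; ring
  rw [h1, mul_comm, ENNReal.ofReal_mul (by positivity)]
  gcongr
  exact ENNReal.le_ofReal_iff_toReal_le hfin.ne (by positivity) |>.mpr (by linarith)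

lemma lint_ball_wt {n : ℕ} (hn : 0 < n) {e : ℝ} (he0 : 0 ≤ e) (he : e < n) :
    ∃ C : ℝ, 0 < C ∧ ∀ R : ℝ, 0 < R →
      ∫⁻ y in ball (0 : EE n) R, ENNReal.ofReal (wt (-e) y) ≤ ENNReal.ofReal (C * R ^ (n - e)) := by
  obtain ⟨C, hC, h⟩ := lint_ball hn (η := n - e) (by linarith)
  refine ⟨C, hC, fun R hR => (lintegral_mono_ae ?_).trans (h R hR)⟩
  have : Nontrivial (EE n) := by
    have : Nonempty (Fin n) := ⟨⟨0, hn⟩⟩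
    infer_instance
  have h0 : ∀ᵐ y : EE n ∂(volume.restrict (ball 0 R)), y ≠ 0 :=
    ae_restrict_of_ae (Measure.ae_ne volume 0)
  filter_upwards [h0] with y hy
  apply ENNReal.ofReal_le_ofReal
  rw [wt_eq, show (n:ℝ) - e - n = -e by ring]
  exact Real.rpow_le_rpow_of_nonpos (norm_pos_iff.mpr hy) (norm_le_wt y) (by linarith)

lemma lint_outer {n : ℕ} {η : ℝ} (hη : 0 < η) :
    ∃ C : ℝ, 0 < C ∧ ∀ R : ℝ, 0 < R →
      ∫⁻ y in {y : EE n | R ≤ wt 1 y}, ENNReal.ofReal (wt (-(n + η)) y)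
        ≤ ENNReal.ofReal (C * R ^ (-η)) := by
  have hfin := finite_integral_one_add_norm (E := EE n) (μ := volume) (r := n + η) (by simpa)
  set I := ∫⁻ z : EE n, ENNReal.ofReal ((1 + ‖z‖) ^ (-((n:ℝ) + η))) with hI
  refine ⟨2 ^ (n + η) * (I.toReal + 1), by positivity, fun R hR => ?_⟩
  have hms : MeasurableSet {y : EE n | R ≤ wt 1 y} :=
    measurableSet_le measurable_const (continuous_wt 1).measurable
  calc ∫⁻ y in {y : EE n | R ≤ wt 1 y}, ENNReal.ofReal (wt (-(n + η)) y)
      ≤ ∫⁻ y in {y : EE n | R ≤ wt 1 y}, ENNReal.ofReal (2 ^ (n+η) * R ^ (-(n + η))) *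
          ENNReal.ofReal ((1 + ‖R⁻¹ • y‖) ^ (-((n:ℝ) + η))) := by
        apply setLIntegral_mono' hms
        intro y (hy : R ≤ wt 1 y)
        rw [← ENNReal.ofReal_mul (by positivity)]
        apply ENNReal.ofReal_le_ofReal
        have h1 : (R + ‖y‖) / 2 ≤ wt 1 y := by linarith [norm_le_wt y]
        have h2 : R * (1 + ‖R⁻¹ • y‖) = R + ‖y‖ := by
          rw [norm_smul, norm_inv, Real.norm_of_nonneg hR.le]; field_simp
        rw [mul_assoc, ← Real.mul_rpow hR.le (by positivity), h2, wt_eq]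
        have h3 : (2:ℝ) ^ ((n:ℝ) + η) = (2⁻¹) ^ (-((n:ℝ)+η)) := by
          rw [Real.inv_rpow (by norm_num), Real.rpow_neg (by norm_num), inv_inv]
        rw [h3, ← Real.mul_rpow (by norm_num) (by positivity)]
        apply Real.rpow_le_rpow_of_nonpos (by positivity)
        · linarith
        · have : (0:ℝ) ≤ n := by positivity
          linarith
    _ ≤ ∫⁻ y : EE n, ENNReal.ofReal (2 ^ (n+η) * R ^ (-(n + η))) *
          ENNReal.ofReal ((1 + ‖R⁻¹ • y‖) ^ (-((n:ℝ) + η))) := setLIntegral_le_lintegral _ _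
    _ = ENNReal.ofReal (2 ^ (n+η) * R ^ (-(n + η))) * (ENNReal.ofReal (R ^ n) * I) := by
        rw [lintegral_const_mul' _ _ ENNReal.ofReal_ne_top,
          lintegral_scale (fun z : EE n => ENNReal.ofReal ((1 + ‖z‖) ^ (-((n:ℝ) + η)))) hR]
    _ ≤ ENNReal.ofReal (2 ^ (n+η) * R ^ (-(n + η))) *
          (ENNReal.ofReal (R ^ n) * ENNReal.ofReal (I.toReal + 1)) := by
        gcongr
        exact ENNReal.le_ofReal_iff_toReal_le hfin.ne (by positivity) |>.mpr (by linarith)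
    _ = _ := by
        rw [← ENNReal.ofReal_mul (by positivity), ← ENNReal.ofReal_mul (by positivity)]
        congr 1
        have : R ^ (-η) = R ^ (-((n:ℝ) + η)) * R ^ n := by
          rw [← Real.rpow_natCast, ← Real.rpow_add hR]; congr 1; ring
        rw [this]; ring

lemma lint_riesz {n : ℕ} (hn : 2 ≤ n) {e : ℝ} (he1 : 1 < e) (he : e < n) :
    ∃ C : ℝ, 0 < C ∧ ∀ x : EE n,
      ∫⁻ y, ENNReal.ofReal (‖x - y‖ ^ (1 - (n:ℝ)) * wt (-e) y) ≤ ENNReal.ofReal (C * wt (1-e) x) := by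
  have hn0 : 0 < n := by omega
  have hn' : (2:ℝ) ≤ n := by exact_mod_cast hn
  obtain ⟨C1, hC1, h1⟩ := lint_ball hn0 (η := 1) one_pos
  obtain ⟨C2, hC2, h2⟩ := lint_ball_wt hn0 (e := e) (by linarith) he
  obtain ⟨C3, hC3, h3⟩ := lint_outer (n := n) (η := e - 1) (by linarith)
  refine ⟨2 ^ e * C1 * 2⁻¹ + 2 ^ ((n:ℝ)-1) * C2 + 3 ^ ((n:ℝ)-1) * C3, by positivity, fun x => ?_⟩
  have hρ := wt_pos 1 x
  set ρ := wt 1 x with hρd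
  have mA : MeasurableSet (ball x (ρ/2)) := measurableSet_ball
  have mB : MeasurableSet (ball (0 : EE n) ρ) := measurableSet_ball
  have mC : MeasurableSet {y : EE n | ρ ≤ wt 1 y} :=
    measurableSet_le measurable_const (continuous_wt 1).measurable
  have hpt : ∀ y : EE n, ENNReal.ofReal (‖x - y‖ ^ (1 - (n:ℝ)) * wt (-e) y) ≤
      (ball x (ρ/2)).indicator (fun y => ENNReal.ofReal (2 ^ e * wt (-e) x) *
          ENNReal.ofReal (‖y - x‖ ^ (1 - (n:ℝ)))) y
      + (ball (0 : EE n) ρ).indicator (fun y => ENNReal.ofReal (2 ^ ((n:ℝ)-1) * wt (1 - n) x) *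
          ENNReal.ofReal (wt (-e) y)) y
      + {y : EE n | ρ ≤ wt 1 y}.indicator (fun y => ENNReal.ofReal (3 ^ ((n:ℝ)-1)) *
          ENNReal.ofReal (wt (-(n + (e-1))) y)) y := by
    intro y
    have hy := wt_pos 1 y
    have hwe := wt_pos (-e) y
    by_cases hA : y ∈ ball x (ρ/2)
    · rw [indicator_of_mem hA]
      refine le_add_right (le_add_right ?_)
      rw [← ENNReal.ofReal_mul (by have := wt_pos (-e) x; positivity)]
      apply ENNReal.ofReal_le_ofReal
      rw [mem_ball, dist_eq_norm] at hA
      rw [norm_sub_rev x y, mul_comm]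
      gcongr
      rw [wt_eq (-e) y, wt_eq (-e) x, ← hρd]
      have h5 : (2:ℝ) ^ e = (2⁻¹) ^ (-e) := by
        rw [Real.inv_rpow (by norm_num), Real.rpow_neg (by norm_num), inv_inv]
      rw [h5, ← Real.mul_rpow (by norm_num) hρ.le]
      apply Real.rpow_le_rpow_of_nonpos (by positivity) _ (by linarith)
      have := rho_lip x y
      rw [norm_sub_rev] at this
      linarith
    · have hxy : ρ / 2 ≤ ‖x - y‖ := by
        rw [mem_ball, dist_eq_norm, not_lt] at hA; rwa [norm_sub_rev]
      by_cases hB : ρ ≤ wt 1 y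
      · rw [indicator_of_mem (show y ∈ {y : EE n | ρ ≤ wt 1 y} from hB)]
        refine le_add_left ?_
        rw [← ENNReal.ofReal_mul (by positivity)]
        apply ENNReal.ofReal_le_ofReal
        have e1 : wt (-(n + (e-1))) y = wt (1 - n) y * wt (-e) y := by
          rw [← wt_add]; congr 1; ring
        rw [e1, ← mul_assoc]
        gcongr
        have h5 : (3:ℝ) ^ ((n:ℝ)-1) = (3⁻¹) ^ (1-(n:ℝ)) := by
          rw [Real.inv_rpow (by norm_num), ← Real.rpow_neg (by norm_num)]; congr 1; ring
        rw [h5, wt_eq (1-n) y, ← Real.mul_rpow (by norm_num) hy.le]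
        apply Real.rpow_le_rpow_of_nonpos (by positivity) _ (by linarith)
        have := rho_lip y x
        rw [norm_sub_rev] at this
        linarith
      · have hB2 : y ∈ ball (0 : EE n) ρ := by
          rw [mem_ball_zero_iff]; linarith [norm_le_wt y]
        rw [indicator_of_mem hB2]
        refine le_add_right (le_add_left ?_)
        rw [← ENNReal.ofReal_mul (by have := wt_pos (1-n) x; positivity)]
        apply ENNReal.ofReal_le_ofReal
        gcongr
        have h5 : (2:ℝ) ^ ((n:ℝ)-1) = (2⁻¹) ^ (1-(n:ℝ)) := by
          rw [Real.inv_rpow (by norm_num), ← Real.rpow_neg (by norm_num)]; congr 1; ring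
        rw [h5, wt_eq (1-n) x, ← hρd, ← Real.mul_rpow (by norm_num) hρ.le]
        apply Real.rpow_le_rpow_of_nonpos (by positivity) _ (by linarith)
        linarith
  refine (lintegral_mono hpt).trans ?_
  have mm : Measurable (fun y : EE n => ENNReal.ofReal (2 ^ e * wt (-e) x) *
          ENNReal.ofReal (‖y - x‖ ^ (1 - (n:ℝ)))) := by fun_prop
  have mm2 : Measurable (fun y : EE n => ENNReal.ofReal (2 ^ ((n:ℝ)-1) * wt (1 - n) x) *
          ENNReal.ofReal (wt (-e) y)) := by
    have := (continuous_wt (n := n) (-e)).measurable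
    fun_prop
  have hm12 : Measurable (fun y : EE n => (ball x (ρ/2)).indicator (fun y => ENNReal.ofReal (2 ^ e * wt (-e) x) *
          ENNReal.ofReal (‖y - x‖ ^ (1 - (n:ℝ)))) y
      + (ball (0 : EE n) ρ).indicator (fun y => ENNReal.ofReal (2 ^ ((n:ℝ)-1) * wt (1 - n) x) *
          ENNReal.ofReal (wt (-e) y)) y) := (mm.indicator mA).add (mm2.indicator mB)
  rw [lintegral_add_left hm12,
    lintegral_add_left (mm.indicator mA), lintegral_indicator mA, lintegral_indicator mB,
    lintegral_indicator mC, lintegral_const_mul' _ _ ENNReal.ofReal_ne_top,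
    lintegral_const_mul' _ _ ENNReal.ofReal_ne_top, lintegral_const_mul' _ _ ENNReal.ofReal_ne_top]
  have hshift : ∫⁻ y in ball x (ρ/2), ENNReal.ofReal (‖y - x‖ ^ (1 - (n:ℝ))) =
      ∫⁻ y in ball (0 : EE n) (ρ/2), ENNReal.ofReal (‖y‖ ^ (1 - (n:ℝ))) := by
    rw [← lintegral_indicator mA, ← lintegral_indicator measurableSet_ball,
      ← lintegral_sub_right_eq_self ((ball (0 : EE n) (ρ/2)).indicator _) x]
    congr 1
    funext y
    simp only [indicator, mem_ball, dist_eq_norm, sub_zero]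
  rw [hshift]
  have hw1 := wt_pos (-e) x
  have hw2 := wt_pos (1-n) x
  refine (add_le_add (add_le_add (mul_le_mul_right (h1 (ρ/2) (by positivity)) _)
    (mul_le_mul_right (h2 ρ hρ) _)) (mul_le_mul_right (h3 ρ hρ) _)).trans (le_of_eq ?_)
  rw [← ENNReal.ofReal_mul (by positivity), ← ENNReal.ofReal_mul (by positivity),
    ← ENNReal.ofReal_mul (by positivity), ← ENNReal.ofReal_add (by positivity) (by positivity),
    ← ENNReal.ofReal_add (by positivity) (by positivity)]
  congr 1
  have e1 : wt (1-e) x = wt (-e) x * ρ := by rw [hρd, ← wt_add]; congr 1; ring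
  have e2 : wt (1-e) x = wt (1-n) x * ρ ^ ((n:ℝ)-e) := by
    rw [hρd, ← wt_eq, ← wt_add]; congr 1; ring
  have e3 : wt (1-e) x = ρ ^ (-(e-1)) := by rw [hρd, ← wt_eq]; congr 1; ring
  rw [add_mul, add_mul]
  nth_rewrite 1 [e1]
  nth_rewrite 1 [e2]
  rw [e3, Real.rpow_one]
  ring


/-! ## Schur test -/

lemma mfst (n : ℕ) : Measurable (Prod.fst : EE n × EE n → EE n) := measurable_fst

lemma msnd (n : ℕ) : Measurable (Prod.snd : EE n × EE n → EE n) := measurable_snd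

def WE {n : ℕ} (s : ℝ) (x : EE n) : ENNReal := ENNReal.ofReal (wt s x)

lemma WE_add {n : ℕ} (s t : ℝ) (x : EE n) : WE (s+t) x = WE s x * WE t x := by
  unfold WE; rw [wt_add, ENNReal.ofReal_mul (wt_pos s x).le]

lemma WE_zero {n : ℕ} (x : EE n) : WE 0 x = 1 := by
  unfold WE; rw [wt_zero, ENNReal.ofReal_one]

lemma WE_rpow {n : ℕ} (s t : ℝ) (x : EE n) : WE s x ^ t = WE (s*t) x := by
  unfold WE; rw [ENNReal.ofReal_rpow_of_pos (wt_pos s x), wt_rpow]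

lemma measurable_WE {n : ℕ} (s : ℝ) : Measurable (WE (n := n) s) :=
  (continuous_wt s).measurable.ennreal_ofReal

lemma schur {n : ℕ} {p : ℝ} (hp : 1 < p) (G : EE n → EE n → ENNReal)
    (hG : Measurable (Function.uncurry G)) (b c : ℝ) (hc : c = b * (p-1)) (C1 C2 : ENNReal)
    (h1 : ∀ x, ∫⁻ y, G x y * WE (-b) y ≤ C1 * WE (-b) x)
    (h2 : ∀ y, ∫⁻ x, G x y * WE (-c) x ≤ C2 * WE (-c) y)
    (g : EE n → ENNReal) (hg : Measurable g) :
    ∫⁻ x, (∫⁻ y, G x y * g y) ^ p ≤ C1 ^ (p-1) * C2 * ∫⁻ y, g y ^ p := by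
  have hp0 : 0 < p := by linarith
  have hpq : p.HolderConjugate (p.conjExponent) := Real.HolderConjugate.conjExponent hp
  set q := p.conjExponent with hq
  have hq0 : 0 < q := hpq.symm.pos
  have hpq1 : p / q = p - 1 := by
    have := hpq.sub_one_mul_conj
    field_simp; linarith
  have hGx : ∀ x, Measurable (G x) := fun x => hG.of_uncurry_left
  have hGy : ∀ y, Measurable (fun x => G x y) := fun y => hG.of_uncurry_right
  have key : ∀ x, (∫⁻ y, G x y * g y) ^ p ≤
      C1 ^ (p-1) * ∫⁻ y, (G x y * WE (-c) x) * (WE c y * g y ^ p) := by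
    intro x
    have e1 : ∀ y, G x y * g y = (G x y ^ (1/q) * WE (-b/q) y) *
        (G x y ^ (1/p) * (WE (b/q) y * g y)) := by
      intro y
      have : G x y = G x y ^ (1/q) * G x y ^ (1/p) := by
        rw [← ENNReal.rpow_add_of_nonneg _ _ (by positivity) (by positivity)]
        have := hpq.inv_add_inv_eq_one
        rw [one_div, one_div, add_comm, this, ENNReal.rpow_one]
      have h3 : WE (-b/q) y * WE (b/q) y = 1 := by
        rw [← WE_add, ← WE_zero y]; congr 1; ring
      calc G x y * g y = (G x y ^ (1/q) * G x y ^ (1/p)) * g y * (WE (-b/q) y * WE (b/q) y) := by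
            rw [← this, h3, mul_one]
        _ = _ := by ring
    have hH := ENNReal.lintegral_mul_le_Lp_mul_Lq volume hpq.symm
      (f := fun y => G x y ^ (1/q) * WE (-b/q) y)
      (g := fun y => G x y ^ (1/p) * (WE (b/q) y * g y))
      (((hGx x).pow_const _).mul (measurable_WE _)).aemeasurable
      (((hGx x).pow_const _).mul ((measurable_WE _).mul hg)).aemeasurable
    simp only [Pi.mul_apply, ← e1] at hH
    have e2 : ∀ y, (G x y ^ (1/q) * WE (-b/q) y) ^ q = G x y * WE (-b) y := by
      intro y
      rw [ENNReal.mul_rpow_of_nonneg _ _ hq0.le, ← ENNReal.rpow_mul, WE_rpow,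
        one_div, inv_mul_cancel₀ hq0.ne', ENNReal.rpow_one]
      congr 2; field_simp
    have e3 : ∀ y, (G x y ^ (1/p) * (WE (b/q) y * g y)) ^ p = G x y * (WE c y * g y ^ p) := by
      intro y
      rw [ENNReal.mul_rpow_of_nonneg _ _ hp0.le, ENNReal.mul_rpow_of_nonneg _ _ hp0.le,
        ← ENNReal.rpow_mul, WE_rpow, one_div, inv_mul_cancel₀ hp0.ne', ENNReal.rpow_one]
      congr 3; rw [hc, ← hpq1]; field_simp
    simp_rw [e2, e3] at hH
    calc (∫⁻ y, G x y * g y) ^ p ≤ ((C1 * WE (-b) x) ^ (1/q) *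
          (∫⁻ y, G x y * (WE c y * g y ^ p)) ^ (1/p)) ^ p := by
          refine ENNReal.rpow_le_rpow (hH.trans ?_) hp0.le
          gcongr
          exact h1 x
      _ = C1 ^ (p-1) * (WE (-c) x * ∫⁻ y, G x y * (WE c y * g y ^ p)) := by
          rw [ENNReal.mul_rpow_of_nonneg _ _ hp0.le, ← ENNReal.rpow_mul, ← ENNReal.rpow_mul,
            one_div_mul_cancel hp0.ne', ENNReal.rpow_one, one_div_mul_eq_div, hpq1,
            ENNReal.mul_rpow_of_nonneg _ _ (by linarith), WE_rpow, mul_assoc]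
          congr 3; rw [hc]; ring
      _ = _ := by
          rw [← lintegral_const_mul' (WE (-c) x) _ ENNReal.ofReal_ne_top]
          congr 2; funext y; ring
  refine (lintegral_mono key).trans ?_
  have hm : Measurable (Function.uncurry fun x y => (G x y * WE (-c) x) * (WE c y * g y ^ p)) := by
    have m1 := (measurable_WE (n := n) (-c)).comp (mfst n)
    have m2 := (measurable_WE (n := n) c).comp (msnd n)
    have m3 := (hg.pow_const p).comp (msnd n)
    exact (hG.mul m1).mul (m2.mul m3)
  rw [lintegral_const_mul _ hm.lintegral_prod_right, lintegral_lintegral_swap hm.aemeasurable,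
    mul_assoc]
  gcongr
  rw [← lintegral_const_mul _ (hg.pow_const p)]
  apply lintegral_mono
  intro y
  dsimp only
  have hmy : Measurable (fun x => G x y * WE (-c) x) := (hGy y).mul (measurable_WE _)
  rw [lintegral_mul_const _ hmy]
  refine (mul_le_mul_left (h2 y) _).trans (le_of_eq ?_)
  have : WE (-c) y * WE c y = 1 := by rw [← WE_add, ← WE_zero y]; congr 1; ring
  calc C2 * WE (-c) y * (WE c y * g y ^ p) = C2 * (WE (-c) y * WE c y) * g y ^ p := by ring
    _ = _ := by rw [this, mul_one]

/-! ## The gradient bound -/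

def Hk {n : ℕ} (θ : ℝ) (x y : EE n) : ℝ :=
  ‖x - y‖ ^ (1 - (n:ℝ)) * (wt θ y * wt (-θ) x) + if wt 1 x ≤ 4 * wt 1 y then wt (1 - n) x else 0

lemma Hk_nonneg {n : ℕ} (θ : ℝ) (x y : EE n) : 0 ≤ Hk θ x y := by
  unfold Hk
  have := wt_pos θ y
  have := wt_pos (-θ) x
  have := wt_pos (1-n) x
  split_ifs <;> positivity

lemma measurable_Hk {n : ℕ} (θ : ℝ) :
    Measurable (fun z : EE n × EE n => Hk θ z.1 z.2) := by
  unfold Hk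
  have m1 := (continuous_wt (n := n) (-θ)).measurable.comp (mfst n)
  have m2 := (continuous_wt (n := n) (θ)).measurable.comp (msnd n)
  have m3 := (continuous_wt (n := n) (1 - n)).measurable.comp
    (mfst n)
  have m4 := (continuous_wt (n := n) 1).measurable.comp (mfst n)
  have m5 := (continuous_wt (n := n) 1).measurable.comp (msnd n)
  refine Measurable.add (((measurable_fst.sub measurable_snd).norm.pow_const _).mul (m2.mul m1)) ?_
  exact Measurable.ite (measurableSet_le m4 (measurable_const.mul m5)) m3 measurable_const

lemma grad_schur {n : ℕ} (hn : 2 ≤ n) {p σ s : ℝ} (hp : 1 < p) (hσ0 : 0 < σ) (hσ1 : σ < 1)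
    (hs : s = n - n / p + σ) :
    ∃ C : ℝ, 0 < C ∧ ∀ g : EE n → ENNReal, Measurable g →
      ∫⁻ x, (∫⁻ y, ENNReal.ofReal (wt (s-1) x * Hk ((1+σ)/2) x y * wt (-s) y) * g y) ^ p ≤
        ENNReal.ofReal C * ∫⁻ y, g y ^ p := by
  have hn' : (2:ℝ) ≤ n := by exact_mod_cast hn
  have hp0 : 0 < p := by linarith
  set θ := (1+σ)/2 with hθ
  set b := (n:ℝ)/p with hb
  set c := (n:ℝ) - n/p with hc
  have hcb : c = b * (p-1) := by rw [hc, hb]; field_simp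
  obtain ⟨C1, hC1, h1⟩ := lint_riesz hn (e := n + σ - θ) (by linarith) (by linarith)
  obtain ⟨C2, hC2, h2⟩ := lint_outer (n := n) hσ0
  obtain ⟨C3, hC3, h3⟩ := lint_riesz hn (e := 1 + θ - σ) (by linarith) (by linarith)
  obtain ⟨C4, hC4, h4⟩ := lint_ball_wt (n := n) (by omega) (e := n - σ) (by linarith) (by linarith)
  have hGm : Measurable (Function.uncurry fun x y : EE n =>
      ENNReal.ofReal (wt (s-1) x * Hk θ x y * wt (-s) y)) := by
    have m1 := (continuous_wt (n := n) (s-1)).measurable.comp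
      (mfst n)
    have m2 := (continuous_wt (n := n) (-s)).measurable.comp
      (msnd n)
    exact ((m1.mul (measurable_Hk θ)).mul m2).ennreal_ofReal
  have hmain := schur hp (fun x y : EE n => ENNReal.ofReal (wt (s-1) x * Hk θ x y * wt (-s) y))
    hGm b c hcb (ENNReal.ofReal (C1 + C2 * 4 ^ σ)) (ENNReal.ofReal (C3 + C4 * 5 ^ σ)) ?_ ?_
  · refine ⟨(C1 + C2 * 4 ^ σ) ^ (p-1) * (C3 + C4 * 5 ^ σ), by positivity, fun g hg => ?_⟩
    refine (hmain g hg).trans (le_of_eq ?_)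
    rw [ENNReal.ofReal_rpow_of_pos (by positivity), ← ENNReal.ofReal_mul (by positivity)]
  · intro x
    have mS : MeasurableSet {y : EE n | wt 1 x / 4 ≤ wt 1 y} :=
      measurableSet_le measurable_const (continuous_wt 1).measurable
    have e : ∀ y, ENNReal.ofReal (wt (s-1) x * Hk θ x y * wt (-s) y) * WE (-b) y =
        ENNReal.ofReal (wt (s-1-θ) x) *
          ENNReal.ofReal (‖x - y‖ ^ (1 - (n:ℝ)) * wt (-(n + σ - θ)) y) +
        ENNReal.ofReal (wt (s - n) x) * {y : EE n | wt 1 x / 4 ≤ wt 1 y}.indicator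
          (fun y => ENNReal.ofReal (wt (-(n + σ)) y)) y := by
      intro y
      have p1 := wt_pos (s-1) x
      have p2 := wt_pos (-s) y
      have p3 := Hk_nonneg θ x y
      have p4 := wt_pos (s-1-θ) x
      have p5 := wt_pos (-(n + σ - θ)) y
      have p6 := wt_pos (s-n) x
      have p7 := wt_pos (-(n+σ)) y
      have p8 := wt_pos 1 y
      have q1 : wt (s-1-θ) x = wt (s-1) x * wt (-θ) x := by rw [← wt_add]; congr 1
      have q2 : wt (-(n + σ - θ)) y = wt θ y * wt (-s) y * wt (-b) y := by
        rw [← wt_add, ← wt_add]; congr 1; rw [hs]; ring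
      have q3 : wt (s-n) x = wt (s-1) x * wt (1-n) x := by rw [← wt_add]; congr 1; ring
      have q4 : wt (-(n+σ)) y = wt (-s) y * wt (-b) y := by
        rw [← wt_add]; congr 1; rw [hs]; ring
      have hi : (wt 1 x ≤ 4 * wt 1 y) ↔ y ∈ {y : EE n | wt 1 x / 4 ≤ wt 1 y} := by
        simp only [mem_ofPred_eq]; constructor <;> intro h <;> linarith
      unfold WE
      rw [← ENNReal.ofReal_mul (by positivity), ← ENNReal.ofReal_mul (by positivity)]
      by_cases hy : y ∈ {y : EE n | wt 1 x / 4 ≤ wt 1 y}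
      · rw [indicator_of_mem hy, ← ENNReal.ofReal_mul (by positivity),
          ← ENNReal.ofReal_add (by positivity) (by positivity)]
        congr 1
        unfold Hk
        rw [if_pos (hi.mpr hy), q1, q2, q3, q4]; ring
      · rw [indicator_of_notMem hy, mul_zero, add_zero]
        congr 1
        unfold Hk
        rw [if_neg (fun h => hy (hi.mp h)), q1, q2]; ring
    simp_rw [e]
    have mm : Measurable fun y : EE n => ENNReal.ofReal (wt (s-1-θ) x) *
          ENNReal.ofReal (‖x - y‖ ^ (1 - (n:ℝ)) * wt (-(n + σ - θ)) y) := by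
      have := (continuous_wt (n := n) (-(n + σ - θ))).measurable
      fun_prop
    rw [lintegral_add_left mm, lintegral_const_mul' _ _ ENNReal.ofReal_ne_top,
      lintegral_const_mul' _ _ ENNReal.ofReal_ne_top, lintegral_indicator mS]
    have p0 := wt_pos 1 x
    have p1 := wt_pos (s-1-θ) x
    have p2 := wt_pos (s-n) x
    have p3 := wt_pos (1 - (n + σ - θ)) x
    refine (add_le_add (mul_le_mul_right (h1 x) _)
      (mul_le_mul_right (h2 (wt 1 x / 4) (by positivity)) _)).trans (le_of_eq ?_)
    unfold WE
    rw [← ENNReal.ofReal_mul (by positivity), ← ENNReal.ofReal_mul (by positivity),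
      ← ENNReal.ofReal_mul (by positivity), ← ENNReal.ofReal_add (by positivity) (by positivity)]
    congr 1
    have q1 : wt (-b) x = wt (s-1-θ) x * wt (1 - (n + σ - θ)) x := by
      rw [← wt_add]; congr 1; rw [hs]; ring
    have q2 : wt (-b) x = wt (s-n) x * wt (-σ) x := by
      rw [← wt_add]; congr 1; rw [hs]; ring
    have q3 : (wt 1 x / 4) ^ (-σ) = wt (-σ) x * 4 ^ σ := by
      rw [wt_eq (-σ) x, Real.div_rpow p0.le (by norm_num), Real.rpow_neg (x := 4) (by norm_num)]
      field_simp
    rw [q3, add_mul]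
    nth_rewrite 1 [q1]
    rw [q2]; ring
  · intro y
    have e : ∀ x, ENNReal.ofReal (wt (s-1) x * Hk θ x y * wt (-s) y) * WE (-c) x ≤
        ENNReal.ofReal (wt (θ - s) y) *
          ENNReal.ofReal (‖y - x‖ ^ (1 - (n:ℝ)) * wt (-(1 + θ - σ)) x) +
        ENNReal.ofReal (wt (-s) y) * (ball (0 : EE n) (5 * wt 1 y)).indicator
          (fun x => ENNReal.ofReal (wt (-(n - σ)) x)) x := by
      intro x
      have p1 := wt_pos (s-1) x
      have p2 := wt_pos (-s) y
      have p3 := Hk_nonneg θ x y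
      have p4 := wt_pos (θ-s) y
      have p5 := wt_pos (-(1 + θ - σ)) x
      have p7 := wt_pos (-(n-σ)) x
      have p8 := wt_pos 1 y
      have q1 : wt (-(1 + θ - σ)) x = wt (s-1) x * wt (-θ) x * wt (-c) x := by
        rw [← wt_add, ← wt_add]; congr 1; rw [hs]; ring
      have q2 : wt (θ - s) y = wt θ y * wt (-s) y := by
        rw [← wt_add]; congr 1
      have q3 : wt (-(n-σ)) x = wt (s-1) x * wt (1-n) x * wt (-c) x := by
        rw [← wt_add, ← wt_add]; congr 1; rw [hs]; ring
      unfold WE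
      rw [← ENNReal.ofReal_mul (by positivity), ← ENNReal.ofReal_mul (by positivity),
        norm_sub_rev]
      by_cases hy : wt 1 x ≤ 4 * wt 1 y
      · have : x ∈ ball (0 : EE n) (5 * wt 1 y) := by
          rw [mem_ball_zero_iff]; linarith [norm_le_wt x]
        rw [indicator_of_mem this, ← ENNReal.ofReal_mul (by positivity),
          ← ENNReal.ofReal_add (by positivity) (by positivity)]
        apply le_of_eq
        congr 1
        unfold Hk
        rw [if_pos hy, q1, q2, q3]; ring
      · refine le_add_right (le_of_eq ?_)
        congr 1
        unfold Hk
        rw [if_neg hy, q1, q2]; ring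
    refine (lintegral_mono e).trans ?_
    have mm : Measurable fun x : EE n => ENNReal.ofReal (wt (θ - s) y) *
          ENNReal.ofReal (‖y - x‖ ^ (1 - (n:ℝ)) * wt (-(1 + θ - σ)) x) := by
      have := (continuous_wt (n := n) (-(1 + θ - σ))).measurable
      fun_prop
    rw [lintegral_add_left mm, lintegral_const_mul' _ _ ENNReal.ofReal_ne_top,
      lintegral_const_mul' _ _ ENNReal.ofReal_ne_top, lintegral_indicator measurableSet_ball]
    have p0 := wt_pos 1 y
    have p1 := wt_pos (θ-s) y
    have p2 := wt_pos (-s) y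
    have p3 := wt_pos (1 - (1 + θ - σ)) y
    refine (add_le_add (mul_le_mul_right (h3 y) _)
      (mul_le_mul_right (h4 (5 * wt 1 y) (by positivity)) _)).trans (le_of_eq ?_)
    unfold WE
    rw [← ENNReal.ofReal_mul (by positivity), ← ENNReal.ofReal_mul (by positivity),
      ← ENNReal.ofReal_mul (by positivity), ← ENNReal.ofReal_add (by positivity) (by positivity)]
    congr 1
    have q1 : wt (-c) y = wt (θ-s) y * wt (1 - (1 + θ - σ)) y := by
      rw [← wt_add]; congr 1; rw [hs]; ring
    have q2 : wt (-c) y = wt (-s) y * wt σ y := by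
      rw [← wt_add]; congr 1; rw [hs]; ring
    have q3 : (5 * wt 1 y) ^ ((n:ℝ) - (n - σ)) = wt σ y * 5 ^ σ := by
      rw [wt_eq σ y, Real.mul_rpow (by norm_num) p0.le, sub_sub_cancel]
      ring
    rw [q3, add_mul]
    nth_rewrite 1 [q1]
    rw [q2]; ring

lemma kernel_diff {n : ℕ} (hn : 2 ≤ n) {θ : ℝ} (hθ0 : 0 < θ) (hθ1 : θ < 1) :
    ∃ C : ℝ, 0 < C ∧ ∀ (x y : EE n) (i : Fin n) (ε : ℝ), 0 < ε → ε ≤ 1 →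
      ∀ A : ℝ, 0 < A → A ^ 2 = ε ^ 2 + ‖x - y‖ ^ 2 →
      |(x i - y i) * A ^ (-(n:ℝ)) - x i * wt (-n) x| ≤ C * Hk θ x y := by
  have hn' : (2:ℝ) ≤ n := by exact_mod_cast hn
  refine ⟨4 + 2 ^ (n-1) * (2^n + n * 2^n * 2^n), by positivity, ?_⟩
  intro x y i ε hε hε1 A hA hA2
  have hB := wt_pos 1 x
  have hR := wt_pos 1 y
  have hxy0 := norm_nonneg (x - y)
  have hdA : ‖x - y‖ ≤ A := by
    apply le_of_sq_le_sq _ hA.le; nlinarith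
  have hAd : A ≤ ε + ‖x - y‖ := by
    apply le_of_sq_le_sq _ (by positivity); nlinarith
  have hR1 : 1 ≤ wt 1 y := one_le_wt (by norm_num) y
  have hxi := abs_apply_le_wt x i
  have hyi := abs_apply_le_wt y i
  have hxyi : |x i - y i| ≤ ‖x - y‖ := by
    have := PiLp.norm_apply_le (x - y) i
    simpa using this
  have hw : wt (-n) x = (wt 1 x) ^ (-(n:ℝ)) := wt_eq _ _
  have hw1 : wt (1-n) x = (wt 1 x) ^ (1-(n:ℝ)) := wt_eq _ _
  have hH1 : 0 ≤ ‖x - y‖ ^ (1 - (n:ℝ)) := by positivity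
  have hθr : wt θ y * wt (-θ) x = (wt 1 y / wt 1 x) ^ θ := by
    rw [wt_eq θ y, wt_eq (-θ) x, Real.div_rpow hR.le hB.le, Real.rpow_neg hB.le]; field_simp
  set B := wt 1 x with hBd
  set R := wt 1 y with hRd
  unfold Hk
  rw [hθr, hw, hw1, ← hBd, ← hRd]
  by_cases hc : B ≤ 4 * R
  · rw [if_pos hc]
    have h1 : |(x i - y i) * A ^ (-(n:ℝ))| ≤ ‖x - y‖ ^ (1 - (n:ℝ)) := by
      rcases hxy0.eq_or_lt with h0 | h0
      · have : x i - y i = 0 := by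
          rw [← h0] at hxyi; exact abs_nonpos_iff.mp hxyi
        rw [this, zero_mul, abs_zero]; positivity
      · rw [abs_mul, abs_of_pos (Real.rpow_pos_of_pos hA _), sub_eq_add_neg (1:ℝ), Real.rpow_add h0,
          Real.rpow_one]
        exact mul_le_mul hxyi (Real.rpow_le_rpow_of_nonpos h0 hdA (by linarith))
          (by positivity) (by positivity)
    have h2 : |x i * B ^ (-(n:ℝ))| ≤ B ^ (1 - (n:ℝ)) := by
      rw [abs_mul, abs_of_pos (Real.rpow_pos_of_pos hB _), sub_eq_add_neg (1:ℝ), Real.rpow_add hB,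
          Real.rpow_one]
      gcongr
    have h3 : (1:ℝ)/4 ≤ (R/B) ^ θ := by
      have : (1/4:ℝ) ≤ R / B := by rw [le_div_iff₀ hB]; linarith
      calc (1/4:ℝ) = (1/4) ^ (1:ℝ) := by rw [Real.rpow_one]
        _ ≤ (1/4) ^ θ := Real.rpow_le_rpow_of_exponent_ge (by norm_num) (by norm_num) hθ1.le
        _ ≤ _ := Real.rpow_le_rpow (by norm_num) this hθ0.le
    have h4 : ‖x - y‖ ^ (1 - (n:ℝ)) * (1/4) ≤ ‖x - y‖ ^ (1 - (n:ℝ)) * (R/B) ^ θ := by gcongr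
    have hBn : 0 < B ^ (1 - (n:ℝ)) := by positivity
    have h5 : (0:ℝ) ≤ 2 ^ (n-1) * (2^n + n * 2^n * 2^n) := by positivity
    calc |(x i - y i) * A ^ (-(n:ℝ)) - x i * B ^ (-(n:ℝ))|
        ≤ |(x i - y i) * A ^ (-(n:ℝ))| + |x i * B ^ (-(n:ℝ))| := abs_sub _ _
      _ ≤ 4 * (‖x - y‖ ^ (1 - (n:ℝ)) * (R/B) ^ θ + B ^ (1 - (n:ℝ))) := by linarith
      _ ≤ _ := by
        have : 0 ≤ (‖x - y‖ ^ (1 - (n:ℝ)) * (R/B) ^ θ + B ^ (1 - (n:ℝ))) := by positivity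
        nlinarith
  · rw [if_neg hc, add_zero]
    push Not at hc
    have hxy1 : B ≤ R + ‖x - y‖ := rho_lip x y
    have hyB : ‖x - y‖ ≤ B + R := by
      have := norm_sub_le x y
      have := norm_le_wt x
      have := norm_le_wt y
      linarith
    have hAB : |A - B| ≤ 2 * R := by rw [abs_le]; constructor <;> linarith
    have hA1 : B / 2 ≤ A := by linarith [(abs_le.mp hAB).1]
    have hA3 : A ≤ 2 * B := by linarith [(abs_le.mp hAB).2]
    rw [Real.rpow_neg hA.le, Real.rpow_neg hB.le, Real.rpow_natCast, Real.rpow_natCast]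
    have hpow : |B ^ n - A ^ n| ≤ 2 * R * n * (2 * B) ^ (n-1) := by
      refine (abs_pow_sub_pow_le B A n).trans ?_
      rw [abs_of_pos hA, abs_of_pos hB, abs_sub_comm]
      gcongr
      exact max_le (by linarith) hA3
    have hAn : (A ^ n)⁻¹ ≤ 2 ^ n * (B ^ n)⁻¹ := by
      rw [← div_eq_mul_inv, ← div_pow, ← inv_pow]
      gcongr
      rw [inv_le_comm₀ hA (by positivity), inv_div]; exact hA1
    have hBn : 0 < (B ^ n)⁻¹ := by positivity
    have e1 : (x i - y i) * (A ^ n)⁻¹ - x i * (B ^ n)⁻¹ =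
        - (y i) * (A ^ n)⁻¹ + x i * (B ^ n - A ^ n) * ((A ^ n)⁻¹ * (B ^ n)⁻¹) := by
      field_simp; ring
    have hmain : |(x i - y i) * (A ^ n)⁻¹ - x i * (B ^ n)⁻¹| ≤
        (2^n + n * 2^n * 2^n) * (R * (B ^ n)⁻¹) := by
      rw [e1]
      refine (abs_add_le _ _).trans ?_
      rw [abs_mul, abs_mul, abs_mul, abs_neg, abs_of_pos (by positivity : 0 < (A ^ n)⁻¹),
        abs_of_pos (by positivity : 0 < (A ^ n)⁻¹ * (B ^ n)⁻¹), add_mul]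
      refine add_le_add ?_ ?_
      · calc |y i| * (A ^ n)⁻¹ ≤ R * (2 ^ n * (B ^ n)⁻¹) := by gcongr
          _ = _ := by ring
      · calc |x i| * |B ^ n - A ^ n| * ((A ^ n)⁻¹ * (B ^ n)⁻¹)
            ≤ B * (2 * R * n * (2 * B) ^ (n-1)) * (2 ^ n * (B ^ n)⁻¹ * (B ^ n)⁻¹) := by gcongr
          _ = R * n * ((2 * B) * (2 * B) ^ (n-1)) * (2 ^ n * (B ^ n)⁻¹ * (B ^ n)⁻¹) := by ring
          _ = R * n * ((2 * B) ^ n) * (2 ^ n * (B ^ n)⁻¹ * (B ^ n)⁻¹) := by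
              rw [mul_pow_sub_one (by omega)]
          _ = _ := by rw [mul_pow]; field_simp
    have hd0 : 0 < ‖x - y‖ := by linarith
    have h6 : R * (B ^ n)⁻¹ ≤ 2 ^ (n-1) * (‖x - y‖ ^ (1 - (n:ℝ)) * (R/B) ^ θ) := by
      have h7 : R / B ≤ (R/B) ^ θ := by
        calc R / B = (R/B) ^ (1:ℝ) := by rw [Real.rpow_one]
          _ ≤ _ := Real.rpow_le_rpow_of_exponent_ge (by positivity)
            (by rw [div_le_one hB]; linarith) hθ1.le
      have h8 : (2 * B) ^ (1 - (n:ℝ)) ≤ ‖x - y‖ ^ (1 - (n:ℝ)) :=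
        Real.rpow_le_rpow_of_nonpos hd0 (by linarith) (by linarith)
      have e9 : ((2 * B) ^ (n-1))⁻¹ = (2 * B) ^ (1 - (n:ℝ)) := by
        rw [← Real.rpow_natCast, ← Real.rpow_neg (by positivity), Nat.cast_sub (by omega)]
        congr 1; push_cast; ring
      calc R * (B ^ n)⁻¹ = 2 ^ (n-1) * (((2 * B) ^ (n-1))⁻¹ * (R / B)) := by
            rw [mul_pow, ← mul_pow_sub_one (by omega : n ≠ 0) B]; field_simp
        _ ≤ _ := by rw [e9]; gcongr
    refine hmain.trans ?_
    have h10 : 0 ≤ ‖x - y‖ ^ (1 - (n:ℝ)) * (R/B) ^ θ := by positivity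
    calc (2^n + n * 2^n * 2^n) * (R * (B ^ n)⁻¹)
        ≤ (2^n + n * 2^n * 2^n) * (2 ^ (n-1) * (‖x - y‖ ^ (1 - (n:ℝ)) * (R/B) ^ θ)) := by gcongr
      _ ≤ _ := by nlinarith


/-! ## Gradient bound, continued -/

lemma pd_coord2 {n : ℕ} (i j : Fin n) (x : EE n) :
    pd i (fun y : EE n => y j) x = if i = j then 1 else 0 := by
  have h : HasFDerivAt (fun y : EE n => y j) (EuclideanSpace.proj j : EE n →L[ℝ] ℝ) x :=
    (EuclideanSpace.proj j : EE n →L[ℝ] ℝ).hasFDerivAt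
  rw [pd, h.fderiv]
  simp [bv, eq_comm]

def kc {n : ℕ} (j : Fin n) (z : EE n) : ℝ := z j * wt (-n) z

lemma contDiff_kc {n : ℕ} (j : Fin n) : ContDiff ℝ (⊤ : ℕ∞) (kc j) :=
  (contDiff_coord j).mul (contDiff_wt _)

lemma pd_kc {n : ℕ} (i j : Fin n) (z : EE n) : pd i (kc j) z =
    z j * (-n * (z i * wt (-n-2) z)) + (if i = j then 1 else 0) * wt (-n) z := by
  have h1 := (contDiff_coord (n := n) j).differentiable (by simp)
  have h2 := (contDiff_wt (n := n) (-n)).differentiable (by simp)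
  have := pd_mul h1 h2 i z
  rw [pd_wt, pd_coord2] at this
  exact this

lemma div_kc {n : ℕ} (z : EE n) : ∑ j, pd j (kc j) z = n * wt (-n-2) z := by
  simp only [pd_kc, if_true, one_mul, Finset.sum_add_distrib, Finset.sum_const, Finset.card_univ,
    Fintype.card_fin, nsmul_eq_mul]
  have e : ∀ j, z j * (-n * (z j * wt (-n-2) z)) = (z j * z j) * (-n * wt (-n-2) z) := by
    intro j; ring
  have e2 : wt (-n) z = wt (-n-2) z * (1 + ‖z‖^2) := by
    rw [← wt_two, ← wt_add]; congr 1; ring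
  rw [Finset.sum_congr rfl (fun j _ => e j), ← Finset.sum_mul, sum_sq_eq, e2]
  ring

lemma grad_id {n : ℕ} {v : EE n → ℝ} (hv : TF v) (i : Fin n) :
    ∫ z, kc i z * lpl v z = - ∫ z, (n * wt (-n-2) z) * pd i v z := by
  have i1 : ∀ a b c : Fin n, Integrable fun z => pd a v z * pd b (kc c) z := fun a b c =>
    ((hv.pd a).cc.mul_right (contDiff_pd b (contDiff_kc c)).continuous).integrable
  have i2 : ∀ a b c : Fin n, Integrable fun z => pd a (pd b v) z * kc c z := fun a b c =>
    (((hv.pd b).pd a).cc.mul_right (contDiff_kc c).continuous).integrable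
  calc ∫ z, kc i z * lpl v z = ∫ z, ∑ j, pd j (pd j v) z * kc i z := by
        congr 1; funext z; rw [lpl, mul_comm, Finset.sum_mul]
    _ = ∑ j, ∫ z, pd j (pd j v) z * kc i z := integral_finsetSum _ fun j _ => i2 j j i
    _ = ∑ j, ∫ z, pd i (pd j v) z * kc j z := by
        refine Finset.sum_congr rfl fun j _ => ?_
        have h1 := ibp_pd (hv.pd j) (contDiff_kc i) j
        have h2 := ibp_pd (hv.pd j) (contDiff_kc j) i
        have h3 : ∀ z, pd j (kc i) z = pd i (kc j) z := by
          intro z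
          have hji : (if j = i then (1:ℝ) else 0) = if i = j then 1 else 0 := by simp [eq_comm]
          rw [pd_kc, pd_kc, hji]; ring
        simp_rw [h3] at h1
        linarith
    _ = ∑ j, - ∫ z, pd i v z * pd j (kc j) z := by
        refine Finset.sum_congr rfl fun j _ => ?_
        rw [pd_comm hv.1 i j, ibp_pd (hv.pd i) (contDiff_kc j) j, neg_neg]
    _ = - ∫ z, ∑ j, pd i v z * pd j (kc j) z := by
        rw [integral_finsetSum _ fun j _ => i1 i j j, Finset.sum_neg_distrib]
    _ = _ := by
        congr 2; funext z; rw [← Finset.mul_sum, div_kc, mul_comm]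

lemma hasFDerivAt_affine {n : ℕ} (x : EE n) (c : ℝ) (z : EE n) :
    HasFDerivAt (fun z : EE n => x + c • z) (c • ContinuousLinearMap.id ℝ (EE n)) z :=
  ((hasFDerivAt_id z).const_smul c).const_add x

lemma contDiff_affine {n : ℕ} (x : EE n) (c : ℝ) :
    ContDiff ℝ (⊤ : ℕ∞) (fun z : EE n => x + c • z) :=
  contDiff_const.add (contDiff_id.const_smul c)

lemma pd_affine {n : ℕ} {u : EE n → ℝ} (hu : Differentiable ℝ u) (x : EE n) (c : ℝ) (i : Fin n) :
    pd i (fun z => u (x + c • z)) = fun z => c * pd i u (x + c • z) := by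
  funext z
  have h := (hu (x + c • z)).hasFDerivAt.comp z (hasFDerivAt_affine x c z)
  have h2 : fderiv ℝ (fun z => u (x + c • z)) z = _ := h.fderiv
  rw [pd, h2]
  simp [pd]

lemma pd_const_mul {n : ℕ} {u : EE n → ℝ} (hu : Differentiable ℝ u) (c : ℝ) (i : Fin n) :
    pd i (fun z => c * u z) = fun z => c * pd i u z := by
  funext z
  rw [pd, fderiv_const_mul (hu z) c]; simp [pd]

lemma lpl_const_mul {n : ℕ} {u : EE n → ℝ} (hu : ContDiff ℝ (⊤ : ℕ∞) u) (c : ℝ) :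
    lpl (fun z => c * u z) = fun z => c * lpl u z := by
  funext z
  simp only [lpl]
  rw [Finset.mul_sum]
  refine Finset.sum_congr rfl fun i _ => ?_
  rw [pd_const_mul (hu.differentiable (by simp)), pd_const_mul ((contDiff_pd i hu).differentiable (by simp))]

lemma lpl_affine {n : ℕ} {u : EE n → ℝ} (hu : ContDiff ℝ (⊤ : ℕ∞) u) (x : EE n) (c : ℝ) (z : EE n) :
    lpl (fun z => u (x + c • z)) z = c ^ 2 * lpl u (x + c • z) := by
  simp only [lpl]
  rw [Finset.mul_sum]
  refine Finset.sum_congr rfl fun i _ => ?_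
  have hd := (contDiff_pd i hu).differentiable (by simp)
  rw [pd_affine (hu.differentiable (by simp)), pd_const_mul (u := fun z => pd i u (x + c • z))
    (((contDiff_pd i hu).comp (contDiff_affine x c)).differentiable (by simp)), pd_affine hd]
  ring

lemma HasCompactSupport.affine {n : ℕ} {u : EE n → ℝ} (hu : HasCompactSupport u) (x : EE n) {c : ℝ}
    (hc : c ≠ 0) : HasCompactSupport (fun z => u (x + c • z)) :=
  hu.comp_homeomorph ((Homeomorph.smulOfNeZero c hc).trans (Homeomorph.addLeft x))

lemma TF.affine {n : ℕ} {u : EE n → ℝ} (hu : TF u) (x : EE n) {c : ℝ} (hc : c ≠ 0) :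
    TF (fun z => u (x + c • z)) :=
  ⟨hu.1.comp (contDiff_affine x c), hu.2.affine x hc⟩

lemma integral_affine {n : ℕ} (F : EE n → ℝ) (x : EE n) {c : ℝ} :
    ∫ z, F (x + c • z) = |(c ^ n)⁻¹| * ∫ y, F y := by
  have h1 := Measure.integral_comp_smul (volume : Measure (EE n)) (fun w => F (x + w)) c
  rw [h1, integral_add_left_eq_self (fun w => F w) x]
  simp

lemma integrable_wt {n : ℕ} {e : ℝ} (he : n < e) : Integrable (fun z : EE n => wt (-e) z) := by
  have h : Integrable (fun z : EE n => ((1 + ‖z‖^2) ^ (-e/2))) :=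
    integrable_rpow_neg_one_add_norm_sq (by simpa)
  refine h.congr (Eventually.of_forall fun z => ?_)
  simp [wt]

lemma CC.bounded {n : ℕ} {f : EE n → ℝ} (hf : CC f) : ∃ M, 0 < M ∧ ∀ x, |f x| ≤ M := by
  obtain ⟨M, hM⟩ := hf.1.bounded_above_of_compact_support hf.2
  exact ⟨|M| + 1, by positivity, fun x => (hM x).trans (by linarith [le_abs_self M])⟩

lemma grad_lim {n : ℕ} {u : EE n → ℝ} (hu : TF u) (i : Fin n) (x : EE n) :
    Tendsto (fun ε : ℝ => ∫ z, (n * wt (-n-2) z) * pd i u (x + (-ε) • z)) (𝓝[>] 0)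
      (𝓝 ((∫ z : EE n, (n * wt (-n-2) z)) * pd i u x)) := by
  obtain ⟨M, hM, hb⟩ := (hu.pd i).cc.bounded
  have hi : Integrable (fun z : EE n => n * wt (-n-2) z) := by
    have := (integrable_wt (n := n) (e := n + 2) (by linarith)).const_mul n
    simpa [neg_add, sub_eq_add_neg, add_comm] using this
  rw [← integral_mul_const]
  refine tendsto_integral_filter_of_dominated_convergence (fun z => (n * wt (-n-2) z) * M) ?_ ?_
    (hi.mul_const M) ?_
  · refine Eventually.of_forall fun ε => Continuous.aestronglyMeasurable ?_
    exact (continuous_const.mul (continuous_wt _)).mul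
      ((hu.pd i).1.continuous.comp (contDiff_affine x (-ε)).continuous)
  · refine Eventually.of_forall fun ε => Eventually.of_forall fun z => ?_
    have := wt_pos (-n-2) z
    rw [Real.norm_eq_abs, abs_mul, abs_of_nonneg (by positivity)]
    gcongr
    exact hb _
  · refine Eventually.of_forall fun z => ?_
    refine Tendsto.const_mul _ (((hu.pd i).1.continuous.tendsto x).comp ?_)
    have : Continuous fun ε : ℝ => x + (-ε) • z := by fun_prop
    have h0 := this.tendsto 0
    simp only [neg_zero, zero_smul, add_zero] at h0
    exact h0.mono_left nhdsWithin_le_nhds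

lemma grad_ptwise {n : ℕ} (hn : 2 ≤ n) {θ : ℝ} (hθ0 : 0 < θ) (hθ1 : θ < 1) :
    ∃ C : ℝ, 0 < C ∧ ∀ u : EE n → ℝ, TF u → ∀ i x,
      ENNReal.ofReal |pd i u x| ≤ ENNReal.ofReal C *
        ∫⁻ y, ENNReal.ofReal (Hk θ x y * |lpl u y|) := by
  obtain ⟨C, hC, hK⟩ := kernel_diff hn hθ0 hθ1
  have hn0 : (0:ℝ) < n := by have : 0 < n := by omega
                             exact_mod_cast this
  set c0 := ∫ z : EE n, (n * wt (-n-2) z) with hc0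
  have hi : Integrable (fun z : EE n => n * wt (-n-2) z) := by
    have := (integrable_wt (n := n) (e := n + 2) (by linarith)).const_mul n
    simpa [neg_add, sub_eq_add_neg, add_comm] using this
  have hc0p : 0 < c0 := by
    refine integral_pos_of_integrable_nonneg_nonzero (x := 0)
      (continuous_const.mul (continuous_wt _)) hi (fun z => ?_) ?_
    · have := wt_pos (-n-2) z
      exact (by positivity : 0 ≤ n * wt (-n-2) z)
    · have := wt_pos (-n-2) (0 : EE n)
      exact (by positivity : n * wt (-n-2) (0 : EE n) ≠ 0)
  refine ⟨c0⁻¹ * C, by positivity, fun u hu i x => ?_⟩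
  have hid : ∀ ε : ℝ, 0 < ε → ∫ z, (n * wt (-n-2) z) * pd i u (x + (-ε) • z) =
      ∫ y, ((x i - y i) * (ε * wt 1 (ε⁻¹ • (x - y))) ^ (-(n:ℝ)) - x i * wt (-n) x) * lpl u y := by
    intro ε hε
    have h1 := grad_id (hu.affine x (neg_ne_zero.mpr hε.ne')) i
    rw [pd_affine hu.differentiable] at h1
    simp_rw [lpl_affine hu.1] at h1
    have h2 : ∫ z, (n * wt (-n-2) z) * (-ε * pd i u (x + (-ε) • z)) =
        -ε * ∫ z, (n * wt (-n-2) z) * pd i u (x + (-ε) • z) := by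
      rw [← integral_const_mul]; congr 1; funext z; ring
    have h3 := integral_affine (fun y => kc i (ε⁻¹ • (x - y)) * lpl u y) x (c := -ε)
    have h4 : ∀ z : EE n, ε⁻¹ • (x - (x + (-ε) • z)) = z := by
      intro z
      rw [sub_add_cancel_left, neg_smul, neg_neg, smul_smul, inv_mul_cancel₀ hε.ne', one_smul]
    simp_rw [h4] at h3
    have h5 : ∫ z, kc i z * ((-ε)^2 * lpl u (x + (-ε) • z)) =
        ε^2 * ∫ z, kc i z * lpl u (x + (-ε) • z) := by
      rw [← integral_const_mul]; congr 1; funext z; ring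
    rw [h2, h5, h3] at h1
    have h6 : ∫ z, (n * wt (-n-2) z) * pd i u (x + (-ε) • z) =
        ε * (|((-ε) ^ n)⁻¹| * ∫ y, kc i (ε⁻¹ • (x - y)) * lpl u y) := by
      have : ε * (∫ z, (n * wt (-n-2) z) * pd i u (x + (-ε) • z)) =
        ε * (ε * (|((-ε) ^ n)⁻¹| * ∫ y, kc i (ε⁻¹ • (x - y)) * lpl u y)) := by linarith
      exact mul_left_cancel₀ hε.ne' this
    rw [h6, ← integral_const_mul, ← integral_const_mul]
    have hker : ∀ y, ε * (|((-ε) ^ n)⁻¹| * (kc i (ε⁻¹ • (x - y)) * lpl u y)) =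
        ((x i - y i) * (ε * wt 1 (ε⁻¹ • (x - y))) ^ (-(n:ℝ))) * lpl u y := by
      intro y
      have hw := wt_pos 1 (ε⁻¹ • (x - y))
      rw [abs_inv, abs_pow, abs_neg, abs_of_pos hε, Real.mul_rpow hε.le hw.le, ← wt_eq, kc,
        Real.rpow_neg hε.le, Real.rpow_natCast]
      simp only [PiLp.smul_apply, PiLp.sub_apply, smul_eq_mul]
      field_simp
    simp_rw [hker, sub_mul]
    have hcw : Continuous fun y => (x i - y i) * (ε * wt 1 (ε⁻¹ • (x - y))) ^ (-(n:ℝ)) := by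
      have hcw1 : Continuous fun y : EE n => ε * wt 1 (ε⁻¹ • (x - y)) :=
        continuous_const.mul ((continuous_wt 1).comp (by fun_prop))
      refine Continuous.mul (by fun_prop) (hcw1.rpow_const fun y => Or.inl ?_)
      have := wt_pos 1 (ε⁻¹ • (x - y))
      positivity
    simp_rw [← sub_mul]
    have e8 : ∀ y, ((x i - y i) * (ε * wt 1 (ε⁻¹ • (x - y))) ^ (-(n:ℝ)) - x i * wt (-n) x) * lpl u y
      = ((x i - y i) * (ε * wt 1 (ε⁻¹ • (x - y))) ^ (-(n:ℝ))) * lpl u y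
        - (x i * wt (-n) x) * lpl u y := fun y => by ring
    simp_rw [e8]
    rw [integral_sub (hu.lpl.cc.mul_left hcw).integrable (hu.lpl.cc.integrable.const_mul _),
      integral_const_mul, integral_lpl hu, mul_zero, sub_zero]
  have hbd : ∀ ε : ℝ, 0 < ε → ε ≤ 1 →
      ENNReal.ofReal |∫ z, (n * wt (-n-2) z) * pd i u (x + (-ε) • z)| ≤
      ENNReal.ofReal C * ∫⁻ y, ENNReal.ofReal (Hk θ x y * |lpl u y|) := by
    intro ε hε hε1
    rw [hid ε hε, ← Real.norm_eq_abs, ofReal_norm,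
      ← lintegral_const_mul' _ _ ENNReal.ofReal_ne_top]
    refine (enorm_integral_le_lintegral_enorm _).trans (lintegral_mono fun y => ?_)
    rw [← ofReal_norm, ← ENNReal.ofReal_mul hC.le, Real.norm_eq_abs, abs_mul, ← mul_assoc]
    apply ENNReal.ofReal_le_ofReal
    gcongr
    have hw := wt_pos 1 (ε⁻¹ • (x - y))
    refine hK x y i ε hε hε1 _ (by positivity) ?_
    rw [mul_pow, wt_one_sq, norm_smul, norm_inv, Real.norm_of_nonneg hε.le]
    field_simp
  have hlim := ENNReal.tendsto_ofReal ((grad_lim hu i x).abs)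
  have hfin := le_of_tendsto hlim (b := ENNReal.ofReal C * ∫⁻ y, ENNReal.ofReal (Hk θ x y * |lpl u y|)) (by
    filter_upwards [Ioc_mem_nhdsGT (zero_lt_one : (0:ℝ) < 1)] with ε hε
    exact hbd ε hε.1 hε.2)
  rw [← hc0, abs_mul, abs_of_pos hc0p, ENNReal.ofReal_mul hc0p.le] at hfin
  rw [ENNReal.ofReal_mul (by positivity), mul_assoc]
  calc ENNReal.ofReal |pd i u x| = ENNReal.ofReal c0⁻¹ * (ENNReal.ofReal c0 * ENNReal.ofReal |pd i u x|) := by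
        rw [← mul_assoc, ← ENNReal.ofReal_mul (by positivity), inv_mul_cancel₀ hc0p.ne',
          ENNReal.ofReal_one, one_mul]
    _ ≤ _ := by gcongr

lemma grad_bound {n : ℕ} (hn : 2 ≤ n) {p σ s : ℝ} (hp : 1 < p) (hσ0 : 0 < σ) (hσ1 : σ < 1)
    (hs : s = n - n / p + σ) :
    ∃ C : ℝ, 0 < C ∧ ∀ u : EE n → ℝ, TF u → ∀ i,
      NN p (s-1) (pd i u) ≤ C * NN p s (lpl u) := by
  have hp0 : 0 < p := by linarith
  obtain ⟨C1, hC1, h1⟩ := grad_schur hn hp hσ0 hσ1 hs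
  obtain ⟨C2, hC2, h2⟩ := grad_ptwise hn (θ := (1+σ)/2) (by linarith) (by linarith)
  refine ⟨(C2 ^ p * C1) ^ (1/p), by positivity, fun u hu i => ?_⟩
  have hlint : ∀ (t : ℝ) (f : EE n → ℝ), CC f → ENNReal.ofReal (∫ x, (wt t x * |f x|) ^ p) =
      ∫⁻ x, (ENNReal.ofReal (wt t x * |f x|)) ^ p := by
    intro t f hf
    have hnn : ∀ x, 0 ≤ wt t x * |f x| := fun x => by have := wt_pos t x; positivity
    rw [ofReal_integral_eq_lintegral_ofReal]
    · congr 1; funext x; rw [ENNReal.ofReal_rpow_of_nonneg (hnn x) hp0.le]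
    · have hc : Continuous fun x => (wt t x * |f x|) ^ p :=
        ((continuous_wt t).mul hf.1.abs).rpow_const fun x => Or.inr hp0.le
      refine hc.integrable_of_hasCompactSupport ?_
      refine (hf.2.comp_left (g := fun y : ℝ => |y|) (by simp)).mul_left.comp_left (g := fun y : ℝ => y ^ p) ?_
      exact Real.zero_rpow hp0.ne'
    · exact Eventually.of_forall fun x => Real.rpow_nonneg (hnn x) _
  have hkey : ENNReal.ofReal (∫ x, (wt (s-1) x * |pd i u x|) ^ p) ≤
      ENNReal.ofReal (C2 ^ p * C1 * ∫ x, (wt s x * |lpl u x|) ^ p) := by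
    rw [hlint _ _ (hu.pd i).cc, ENNReal.ofReal_mul (by positivity), hlint _ _ hu.lpl.cc,
      ENNReal.ofReal_mul (by positivity), mul_assoc]
    have hgm : Measurable fun y => ENNReal.ofReal (wt s y * |lpl u y|) :=
      ((continuous_wt s).mul hu.lpl.1.continuous.abs).measurable.ennreal_ofReal
    refine le_trans ?_ (mul_le_mul_right (h1 _ hgm) _)
    rw [← ENNReal.ofReal_rpow_of_pos hC2, ← lintegral_const_mul' _ _
      (ENNReal.rpow_ne_top_of_nonneg hp0.le ENNReal.ofReal_ne_top)]
    apply lintegral_mono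
    intro x
    dsimp only
    rw [← ENNReal.mul_rpow_of_nonneg _ _ hp0.le]
    refine ENNReal.rpow_le_rpow ?_ hp0.le
    have hwx := wt_pos (s-1) x
    have e : ∀ y, ENNReal.ofReal (wt (s-1) x * Hk ((1+σ)/2) x y * wt (-s) y) *
        ENNReal.ofReal (wt s y * |lpl u y|) =
        ENNReal.ofReal (wt (s-1) x) * ENNReal.ofReal (Hk ((1+σ)/2) x y * |lpl u y|) := by
      intro y
      have h3 := Hk_nonneg ((1+σ)/2) x y
      have h4 := wt_pos (-s) y
      have h5 : wt (-s) y * wt s y = 1 := by rw [← wt_add, ← wt_zero y]; congr 1; ring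
      rw [← ENNReal.ofReal_mul (by positivity), ← ENNReal.ofReal_mul (by positivity)]
      congr 1
      calc _ = wt (s-1) x * (Hk ((1+σ)/2) x y * |lpl u y|) * (wt (-s) y * wt s y) := by ring
        _ = _ := by rw [h5, mul_one]
    simp_rw [e]
    rw [lintegral_const_mul' _ _ ENNReal.ofReal_ne_top, ENNReal.ofReal_mul hwx.le]
    calc _ ≤ ENNReal.ofReal (wt (s-1) x) * (ENNReal.ofReal C2 *
        ∫⁻ y, ENNReal.ofReal (Hk ((1+σ)/2) x y * |lpl u y|)) := by gcongr; exact h2 u hu i x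
      _ = _ := by ring
  have hnn : 0 ≤ ∫ x, (wt s x * |lpl u x|) ^ p := integral_nonneg fun x => by
    have := wt_pos s x
    exact Real.rpow_nonneg (by positivity) _
  rw [ENNReal.ofReal_le_ofReal_iff (by positivity)] at hkey
  unfold NN
  rw [← Real.mul_rpow (by positivity) hnn]
  refine Real.rpow_le_rpow (integral_nonneg fun x => ?_) hkey (by positivity)
  have := wt_pos (s-1) x
  exact Real.rpow_nonneg (by positivity) _


/-! ## Convolutions and dilated averages -/

def cv {n : ℕ} (k g : EE n → ℝ) (x : EE n) : ℝ := ∫ t, k t * g (x - t)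

lemma cv_eq {n : ℕ} (k g : EE n → ℝ) :
    cv k g = convolution k g (ContinuousLinearMap.mul ℝ ℝ) volume := by
  funext x; rfl

lemma cv_contDiff {n : ℕ} {k g : EE n → ℝ} (hk : Continuous k) (hg : TF g) :
    ContDiff ℝ (⊤ : ℕ∞) (cv k g) := by
  rw [cv_eq]
  exact hg.2.contDiff_convolution_right _ hk.locallyIntegrable hg.1

lemma pd_cv {n : ℕ} {k g : EE n → ℝ} (hk : Continuous k) (hg : TF g) (i : Fin n) :
    pd i (cv k g) = cv k (pd i g) := by
  funext x
  have h := hg.2.hasFDerivAt_convolution_right (ContinuousLinearMap.mul ℝ ℝ)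
    hk.locallyIntegrable (μ := volume) (hg.1.of_le (by simp)) x
  rw [cv_eq, pd, h.fderiv]
  rw [convolution_precompR_apply]
  · rfl
  · exact hk.locallyIntegrable
  · exact hg.2.fderiv (𝕜 := ℝ)
  · exact (hg.1.fderiv_right (m := (⊤ : ℕ∞)) (by simp)).continuous

lemma cv_int {n : ℕ} {k g : EE n → ℝ} (hk : Continuous k) (hg : CC g) (x : EE n) :
    Integrable fun t => k t * g (x - t) := by
  have hc : HasCompactSupport fun t => g (x - t) :=
    hg.2.comp_homeomorph (Homeomorph.subLeft x)
  exact CC.integrable ⟨hk.mul (hg.1.comp (by fun_prop)), hc.mul_left⟩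

lemma lpl_cv {n : ℕ} {k g : EE n → ℝ} (hk : Continuous k) (hg : TF g) :
    lpl (cv k g) = cv k (lpl g) := by
  funext x
  simp only [lpl, pd_cv hk hg, pd_cv hk (hg.pd _), cv]
  rw [← integral_finsetSum _ fun i _ => cv_int hk ((hg.pd i).pd i).cc x]
  congr 1; funext t; rw [Finset.mul_sum]

/-- dilated average -/
def PR {n : ℕ} (κ g : EE n → ℝ) (r : ℝ) (x : EE n) : ℝ := ∫ z, κ z * g (x + (-r) • z)

def dk {n : ℕ} (κ : EE n → ℝ) (r : ℝ) (t : EE n) : ℝ := |(r ^ n)⁻¹| * κ (r⁻¹ • t)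

lemma dk_cont {n : ℕ} {κ : EE n → ℝ} (hκ : Continuous κ) (r : ℝ) : Continuous (dk κ r) := by
  unfold dk
  exact continuous_const.mul (hκ.comp (by fun_prop))

lemma PR_eq_cv {n : ℕ} (κ g : EE n → ℝ) {r : ℝ} (hr : 0 < r) : PR κ g r = cv (dk κ r) g := by
  funext x
  have h := integral_affine (fun t => κ (r⁻¹ • t) * g (x - t)) 0 (c := r)
  simp only [zero_add, smul_smul, inv_mul_cancel₀ hr.ne', one_smul] at h
  simp only [PR, cv, dk, mul_assoc]
  rw [integral_const_mul, ← h]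
  congr 1; funext z; rw [neg_smul, ← sub_eq_add_neg]

/-- decay condition -/
def Dec {n : ℕ} (κ : EE n → ℝ) : Prop := Continuous κ ∧ ∃ C, ∀ z, |κ z| ≤ C * wt (-(n+2)) z

lemma Dec.integrable {n : ℕ} {κ : EE n → ℝ} (h : Dec κ) : Integrable κ := by
  obtain ⟨hc, C, hC⟩ := h
  exact ((integrable_wt (n := n) (e := n+2) (by linarith)).const_mul C).mono'
    hc.aestronglyMeasurable (Eventually.of_forall hC)

lemma Dec.integrable_mul {n : ℕ} {κ : EE n → ℝ} (h : Dec κ) : Integrable (fun z => ‖z‖ * |κ z|) := by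
  obtain ⟨hc, C, hC⟩ := h
  refine ((integrable_wt (n := n) (e := n+1) (by linarith)).const_mul C).mono'
    (continuous_norm.mul hc.abs).aestronglyMeasurable (Eventually.of_forall fun z => ?_)
  rw [Real.norm_of_nonneg (by positivity)]
  have h1 := norm_le_wt z
  have h2 := hC z
  have h3 : wt (-(n+1)) z = wt 1 z * wt (-(n+2)) z := by rw [← wt_add]; congr 1; ring
  rw [h3]
  calc ‖z‖ * |κ z| ≤ wt 1 z * (C * wt (-(n+2)) z) := by
        have := wt_pos 1 z
        gcongr
    _ = _ := by ring

lemma PR_cont {n : ℕ} {κ g : EE n → ℝ} (hκ : Dec κ) (hg : CC g) :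
    Continuous (fun q : ℝ × EE n => PR κ g q.1 q.2) := by
  obtain ⟨M, hM, hb⟩ := hg.bounded
  refine continuous_of_dominated (bound := fun z => |κ z| * M) ?_ ?_ (hκ.integrable.abs.mul_const M) ?_
  · intro q
    exact (hκ.1.mul (hg.1.comp (by fun_prop))).aestronglyMeasurable
  · intro q
    refine Eventually.of_forall fun z => ?_
    rw [Real.norm_eq_abs, abs_mul]; gcongr; exact hb _
  · refine Eventually.of_forall fun z => ?_
    exact continuous_const.mul (hg.1.comp (by fun_prop))

lemma PR_int {n : ℕ} {κ g : EE n → ℝ} (hκ : Dec κ) (hg : CC g) (r : ℝ) (x : EE n) :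
    Integrable (fun z => κ z * g (x + (-r) • z)) := by
  obtain ⟨M, hM, hb⟩ := hg.bounded
  refine (hκ.integrable.abs.mul_const M).mono'
    (hκ.1.mul (hg.1.comp (by fun_prop))).aestronglyMeasurable (Eventually.of_forall fun z => ?_)
  rw [Real.norm_eq_abs, abs_mul]; gcongr; exact hb _

lemma PR_contDiff {n : ℕ} {κ g : EE n → ℝ} (hκ : Continuous κ) (hg : TF g) {r : ℝ} (hr : 0 < r) :
    ContDiff ℝ (⊤ : ℕ∞) (PR κ g r) := by
  rw [PR_eq_cv κ g hr]; exact cv_contDiff (dk_cont hκ r) hg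

lemma pd_PR {n : ℕ} {κ g : EE n → ℝ} (hκ : Continuous κ) (hg : TF g) {r : ℝ} (hr : 0 < r)
    (i : Fin n) : pd i (PR κ g r) = PR κ (pd i g) r := by
  rw [PR_eq_cv κ g hr, PR_eq_cv κ _ hr, pd_cv (dk_cont hκ r) hg]

lemma lpl_PR {n : ℕ} {κ g : EE n → ℝ} (hκ : Continuous κ) (hg : TF g) {r : ℝ} (hr : 0 < r) :
    lpl (PR κ g r) = PR κ (lpl g) r := by
  rw [PR_eq_cv κ g hr, PR_eq_cv κ _ hr, lpl_cv (dk_cont hκ r) hg]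

lemma fderiv_eq_sum {n : ℕ} (g : EE n → ℝ) (x z : EE n) :
    fderiv ℝ g x z = ∑ i, z i * pd i g x := by
  have h : z = ∑ i, z i • bv i := by
    ext j
    simp [bv, Finset.sum_apply, Pi.single_apply]
  conv_lhs => rw [h]
  rw [map_sum]
  simp [pd]

lemma PR_hasDerivAt {n : ℕ} {κ η g : EE n → ℝ} (hκ : Dec κ) (hη : ContDiff ℝ (⊤ : ℕ∞) η)
    (hηκ : ∀ i z, pd i η z = - (z i * κ z)) (hg : TF g) {r : ℝ} (hr : r ≠ 0) (x : EE n) :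
    HasDerivAt (fun r => PR κ g r x) (r * PR η (lpl g) r x) r := by
  have hdb : ∃ M, 0 < M ∧ ∀ y, ‖fderiv ℝ g y‖ ≤ M := by
    have hc : Continuous (fderiv ℝ g) := (hg.1.fderiv_right (m := (⊤ : ℕ∞)) (by simp)).continuous
    obtain ⟨M, hM⟩ := hc.bounded_above_of_compact_support (hg.2.fderiv (𝕜 := ℝ))
    exact ⟨|M| + 1, by positivity, fun x => (hM x).trans (by linarith [le_abs_self M])⟩
  obtain ⟨M, hM, hb⟩ := hdb
  have hline : ∀ z (s : ℝ), HasDerivAt (fun s : ℝ => g (x + (-s) • z))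
      (- fderiv ℝ g (x + (-s) • z) z) s := by
    intro z s
    have h1 : HasDerivAt (fun s : ℝ => x + (-s) • z) (-z) s := by
      have := ((hasDerivAt_neg s).smul_const z).const_add x
      simpa using this
    have h := (hg.differentiable (x + (-s) • z)).hasFDerivAt.comp_hasDerivAt s h1
    rw [map_neg] at h
    exact h
  have hD := hasDerivAt_integral_of_dominated_loc_of_deriv_le (μ := volume) (x₀ := r)
    (s := univ) (F := fun s z => κ z * g (x + (-s) • z))
    (F' := fun s z => κ z * (- fderiv ℝ g (x + (-s) • z) z))
    (bound := fun z => (‖z‖ * |κ z|) * M) univ_mem ?_ (PR_int hκ hg.cc r x) ?_ ?_ ?_ ?_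
  · have h2 := hD.2
    have hval : ∫ z, κ z * (- fderiv ℝ g (x + (-r) • z) z) = r * PR η (lpl g) r x := by
      have e1 : ∀ z, κ z * (- fderiv ℝ g (x + (-r) • z) z) =
          ∑ i, pd i g (x + (-r) • z) * pd i η z := by
        intro z
        rw [fderiv_eq_sum, mul_neg, Finset.mul_sum, ← Finset.sum_neg_distrib]
        refine Finset.sum_congr rfl fun i _ => ?_
        rw [hηκ]; ring
      simp_rw [e1]
      have hT : ∀ i, TF fun z => pd i g (x + (-r) • z) := fun i =>
        (hg.pd i).affine x (neg_ne_zero.mpr hr)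
      rw [integral_finsetSum _ fun i _ =>
        ((hT i).cc.mul_right (contDiff_pd i hη).continuous).integrable]
      have e2 : ∀ i, ∫ z, pd i g (x + (-r) • z) * pd i η z =
          r * ∫ z, η z * pd i (pd i g) (x + (-r) • z) := by
        intro i
        rw [ibp_pd (hT i) hη i, pd_affine (hg.pd i).differentiable, ← integral_neg,
          ← integral_const_mul]
        congr 1; funext z; ring
      simp_rw [e2]
      rw [← Finset.mul_sum, PR]
      congr 1
      rw [← integral_finsetSum _ fun i _ =>
        ((((hg.pd i).pd i).affine x (neg_ne_zero.mpr hr)).cc.mul_left hη.continuous).integrable]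
      congr 1; funext z; rw [lpl, Finset.mul_sum]
    rw [hval] at h2
    exact h2
  · exact Eventually.of_forall fun s => (hκ.1.mul (hg.1.continuous.comp (by fun_prop))).aestronglyMeasurable
  · have hc : Continuous (fderiv ℝ g) := (hg.1.fderiv_right (m := (⊤ : ℕ∞)) (by simp)).continuous
    refine (hκ.1.mul (Continuous.neg ?_)).aestronglyMeasurable
    exact (hc.comp (by fun_prop)).clm_apply continuous_id
  · refine Eventually.of_forall fun z s _ => ?_
    rw [Real.norm_eq_abs, abs_mul, abs_neg]
    calc |κ z| * |fderiv ℝ g (x + (-s) • z) z| ≤ |κ z| * (M * ‖z‖) := by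
          gcongr
          exact ((fderiv ℝ g (x + (-s) • z)).le_opNorm z).trans (by gcongr; exact hb _)
      _ = _ := by ring
  · exact hκ.integrable_mul.mul_const M
  · refine Eventually.of_forall fun z s _ => ?_
    exact (hline z s).const_mul _

lemma PR_abs_le {n : ℕ} {κ g : EE n → ℝ} (hκ : Dec κ) {M : ℝ} (hM : ∀ y, |g y| ≤ M)
    (r : ℝ) (x : EE n) : |PR κ g r x| ≤ (∫ z, |κ z|) * M := by
  rw [← integral_mul_const, ← Real.norm_eq_abs]
  refine norm_integral_le_of_norm_le (hκ.integrable.abs.mul_const M) (Eventually.of_forall fun z => ?_)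
  rw [Real.norm_eq_abs, abs_mul]; gcongr; exact hM _

lemma PR_sub {n : ℕ} {κ g h : EE n → ℝ} (hκ : Dec κ) (hg : CC g) (hh : CC h) (r : ℝ) (x : EE n) :
    PR κ (fun y => g y - h y) r x = PR κ g r x - PR κ h r x := by
  unfold PR
  rw [← integral_sub (PR_int hκ hg r x) (PR_int hκ hh r x)]
  congr 1; funext z; ring


/-! ## Gaussian averages -/

structure GK {n : ℕ} (G : EE n → ℝ) : Prop where
  dec : Dec G
  smooth : ContDiff ℝ (⊤ : ℕ∞) G
  grad : ∀ i z, pd i G z = - (z i * G z)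
  pos : ∀ z, 0 < G z
  mass : ∫ z, G z = 1

lemma exists_gauss (n : ℕ) : ∃ G : EE n → ℝ, GK G := by
  set E : EE n → ℝ := fun z => Real.exp (-(1/2) * (1 + ‖z‖^2)) with hE
  have hs : ContDiff ℝ (⊤ : ℕ∞) E :=
    (contDiff_const.mul (contDiff_const.add (contDiff_norm_sq ℝ))).exp
  have hdec : ∀ z, |E z| ≤ (2^(n+2) * ((n+2).factorial : ℝ)) * wt (-(n+2)) z := by
    intro z
    have hb := base_pos z
    have h1 := Real.pow_div_factorial_le_exp (x := (1/2) * (1 + ‖z‖^2)) (by positivity) (n+2)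
    have hf : (0:ℝ) < ((n+2).factorial : ℝ) := by positivity
    rw [div_le_iff₀ hf, mul_pow] at h1
    have h2 : wt (n+2) z ≤ (1 + ‖z‖^2)^(n+2) := by
      rw [wt, ← Real.rpow_natCast (1 + ‖z‖^2) (n+2)]
      apply Real.rpow_le_rpow_of_exponent_le (by nlinarith [sq_nonneg ‖z‖])
      push_cast; linarith [Nat.cast_nonneg (α := ℝ) n]
    have h3 : wt (-(n+2)) z = (wt (n+2) z)⁻¹ := by
      rw [wt, wt, neg_div, Real.rpow_neg hb.le]
    rw [abs_of_pos (Real.exp_pos _), h3, ← div_eq_mul_inv, le_div_iff₀ (wt_pos _ _)]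
    have h4 : Real.exp (-(1/2) * (1 + ‖z‖^2)) * Real.exp ((1/2) * (1 + ‖z‖^2)) = 1 := by
      rw [← Real.exp_add]; simp
    have he := Real.exp_pos (-(1/2) * (1 + ‖z‖^2))
    set e1 := Real.exp (-(1/2) * (1 + ‖z‖^2))
    have h5 : (1 + ‖z‖^2)^(n+2) ≤ 2^(n+2) * (Real.exp ((1/2) * (1 + ‖z‖^2)) * ((n+2).factorial : ℝ)) := by
      have : (1 + ‖z‖^2)^(n+2) = 2^(n+2) * ((1/2)^(n+2) * (1 + ‖z‖^2)^(n+2)) := by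
        rw [← mul_assoc, ← mul_pow]; norm_num
      rw [this]; gcongr
    calc e1 * wt (n+2) z ≤ e1 * (2^(n+2) * (Real.exp ((1/2) * (1 + ‖z‖^2)) * ((n+2).factorial : ℝ))) := by
          gcongr; exact h2.trans h5
      _ = (e1 * Real.exp ((1/2) * (1 + ‖z‖^2))) * (2^(n+2) * ((n+2).factorial : ℝ)) := by ring
      _ = _ := by rw [h4, one_mul]
  have hD : Dec E := ⟨hs.continuous, _, hdec⟩
  have hpos : 0 < ∫ z, E z := by
    refine (integral_pos_iff_support_of_nonneg (fun z => (Real.exp_pos _).le) hD.integrable).mpr ?_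
    have : Function.support E = univ := by
      ext z; simp [hE, (Real.exp_pos _).ne']
    rw [this]; exact isOpen_univ.measure_pos _ ⟨0, trivial⟩
  set c := (∫ z, E z)⁻¹ with hc
  have hc0 : 0 < c := inv_pos.mpr hpos
  have hgradE : ∀ i z, pd i E z = - (z i * E z) := by
    intro i z
    have h1 : HasFDerivAt (fun x : EE n => -(1/2) * (1 + ‖x‖^2)) ((-(1/2) : ℝ) • (2 • (innerSL ℝ z))) z := by
      have : HasFDerivAt (fun x : EE n => 1 + ‖x‖^2) (2 • (innerSL ℝ z)) z := by
        simpa using (hasStrictFDerivAt_norm_sq z).hasFDerivAt.const_add 1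
      exact this.const_mul _
    have h2 : HasFDerivAt E _ z := h1.exp
    rw [pd, h2.fderiv]
    simp only [_root_.smul_apply, innerSL_apply_apply, inner_bv, smul_eq_mul,
      nsmul_eq_mul]
    simp only [hE]
    push_cast; ring
  refine ⟨fun z => c * E z, ⟨continuous_const.mul hs.continuous, c * (2^(n+2) * ((n+2).factorial : ℝ)), fun z => ?_⟩,
    contDiff_const.mul hs, ?_, fun z => mul_pos hc0 (Real.exp_pos _), ?_⟩
  · rw [abs_mul, abs_of_pos hc0, mul_assoc]; gcongr; exact hdec z
  · intro i z
    rw [pd_const_mul (hs.differentiable (by simp))]; simp only [hgradE]; ring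
  · rw [integral_const_mul, hc, inv_mul_cancel₀ hpos.ne']

section
variable {n : ℕ} {G : EE n → ℝ}

lemma PR_zero (hG : GK G) (φ : EE n → ℝ) (x : EE n) : PR G φ 0 x = φ x := by
  simp [PR, integral_mul_const, hG.mass]

lemma GK.hasDerivAt (hG : GK G) {φ : EE n → ℝ} (hφ : TF φ) {r : ℝ} (hr : 0 < r) (x : EE n) :
    HasDerivAt (fun r => PR G φ r x) (r * lpl (PR G φ r) x) r := by
  have := PR_hasDerivAt hG.dec hG.smooth hG.grad hφ hr.ne' x
  rwa [lpl_PR hG.dec.1 hφ hr]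

lemma GK.sup_le (hG : GK G) {φ : EE n → ℝ} {M : ℝ} (hM : ∀ y, |φ y| ≤ M)
    (r : ℝ) (x : EE n) : |PR G φ r x| ≤ M := by
  have := PR_abs_le hG.dec hM r x
  simpa [abs_of_pos (hG.pos _), hG.mass] using this

lemma GK.nonneg (hG : GK G) {φ : EE n → ℝ} (h : ∀ y, 0 ≤ φ y)
    (r : ℝ) (x : EE n) : 0 ≤ PR G φ r x :=
  integral_nonneg fun z => mul_nonneg (hG.pos z).le (h _)

lemma GK.strict (hG : GK G) {φ : EE n → ℝ} (hφ : CC φ) (h : ∀ y, 0 ≤ φ y) (h0 : ∃ y, φ y ≠ 0)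
    {r : ℝ} (hr : 0 < r) (x : EE n) : 0 < PR G φ r x := by
  obtain ⟨y, hy⟩ := h0
  have hc : Continuous fun z => G z * φ (x + (-r) • z) :=
    hG.dec.1.mul (hφ.1.comp (by fun_prop))
  refine hc.integral_pos_of_hasCompactSupport_nonneg_nonzero ?_
    (fun z => mul_nonneg (hG.pos z).le (h _)) (x := r⁻¹ • (x - y)) ?_
  · exact (HasCompactSupport.affine hφ.2 x (neg_ne_zero.mpr hr.ne')).mul_left
  · have : x + (-r) • (r⁻¹ • (x - y)) = y := by
      rw [smul_smul, neg_mul, mul_inv_cancel₀ hr.ne', neg_one_smul]; abel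
    rw [this]; exact mul_ne_zero (hG.pos _).ne' hy

lemma integral_dk (κ : EE n → ℝ) {r : ℝ} (hr : 0 < r) : ∫ t, dk κ r t = ∫ z, κ z := by
  have h := integral_affine (fun t => κ (r⁻¹ • t)) 0 (c := r)
  simp only [zero_add, smul_smul, inv_mul_cancel₀ hr.ne', one_smul] at h
  rw [h]; simp only [dk]; rw [integral_const_mul]

lemma dk_integrable {κ : EE n → ℝ} (hκ : Integrable κ) {r : ℝ} (hr : 0 < r) :
    Integrable (dk κ r) := by
  exact (hκ.comp_smul (inv_ne_zero hr.ne')).const_mul _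

lemma PR_integrable {κ φ : EE n → ℝ} (hκ : Integrable κ) (hφ : CC φ) {r : ℝ} (hr : 0 < r) :
    Integrable (PR κ φ r) := by
  rw [PR_eq_cv κ φ hr, cv_eq]
  exact (dk_integrable hκ hr).integrable_convolution _ hφ.integrable

lemma PR_integral {κ φ : EE n → ℝ} (hκ : Integrable κ) (hφ : CC φ) {r : ℝ} (hr : 0 < r) :
    ∫ x, PR κ φ r x = (∫ z, κ z) * ∫ x, φ x := by
  rw [PR_eq_cv κ φ hr, cv_eq, integral_convolution _ (dk_integrable hκ hr) hφ.integrable,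
    integral_dk κ hr]
  rfl

lemma CC.abs {φ : EE n → ℝ} (hφ : CC φ) : CC (fun x => |φ x|) :=
  ⟨hφ.1.abs, hφ.2.comp_left abs_zero⟩

lemma GK.abs_le (hG : GK G) {φ : EE n → ℝ} (r : ℝ) (x : EE n) :
    |PR G φ r x| ≤ PR G (fun y => |φ y|) r x := by
  unfold PR
  refine (abs_integral_le_integral_abs).trans (le_of_eq ?_)
  simp [abs_mul, abs_of_pos (hG.pos _)]

lemma GK.L1 (hG : GK G) {φ : EE n → ℝ} (hφ : CC φ) {r : ℝ} (hr : 0 < r) :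
    ∫ x, |PR G φ r x| ≤ ∫ x, |φ x| := by
  have h := PR_integral hG.dec.integrable hφ.abs hr
  rw [hG.mass, one_mul] at h
  rw [← h]
  exact integral_mono (PR_integrable hG.dec.integrable hφ hr).abs
    (PR_integrable hG.dec.integrable hφ.abs hr) fun x => hG.abs_le r x

lemma GK.decay (hG : GK G) (hn : 1 ≤ n) : ∃ C, 0 < C ∧ ∀ φ : EE n → ℝ, CC φ → ∀ r, 1 ≤ r →
    ∀ x, |PR G φ r x| ≤ C / r * ∫ x, |φ x| := by
  obtain ⟨C, hC⟩ := hG.dec.2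
  have hC0 : ∀ z, |G z| ≤ |C| + 1 := by
    intro z
    have h1 : wt (-((n:ℝ)+2)) z ≤ 1 := by
      rw [← wt_zero z]; exact wt_mono (by linarith [Nat.cast_nonneg (α := ℝ) n]) z
    have h2 := wt_pos (-((n:ℝ)+2)) z
    calc |G z| ≤ C * wt (-(n+2)) z := hC z
      _ ≤ |C| * 1 := by gcongr; exact le_abs_self C
      _ ≤ _ := by linarith
  refine ⟨|C| + 1, by positivity, fun φ hφ r hr x => ?_⟩
  have hr0 : 0 < r := by linarith
  rw [PR_eq_cv G φ hr0, cv]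
  have hk : ∀ t, |dk G r t| ≤ (|C| + 1) / r := by
    intro t
    rw [dk, abs_mul, abs_abs, abs_of_pos (by positivity), mul_comm, div_eq_mul_inv]
    gcongr
    · exact hC0 _
    · exact le_self_pow₀ hr (by omega)
  have e : ∫ t, |φ (x - t)| = ∫ t, |φ t| := integral_sub_left_eq_self (fun t => |φ t|) volume x
  rw [← e, ← integral_const_mul, ← Real.norm_eq_abs]
  have hi : Integrable fun t => |φ (x - t)| := hφ.abs.integrable.comp_sub_left x
  refine norm_integral_le_of_norm_le (hi.const_mul _) (Eventually.of_forall fun t => ?_)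
  rw [Real.norm_eq_abs, abs_mul]; gcongr; exact hk t

end


/-! ## Parabolic calculus -/

lemma ContDiff.dfb {n : ℕ} {f : EE n → ℝ} (h : ContDiff ℝ (⊤ : ℕ∞) f) : Differentiable ℝ f :=
  h.differentiable (by simp)

lemma lpl_mul {n : ℕ} {f g : EE n → ℝ} (hf : ContDiff ℝ (⊤ : ℕ∞) f) (hg : ContDiff ℝ (⊤ : ℕ∞) g)
    (x : EE n) : lpl (fun x => f x * g x) x =
      f x * lpl g x + g x * lpl f x + 2 * ∑ k, pd k f x * pd k g x := by
  have h1 : ∀ k, pd k (fun x => f x * g x) = fun x => f x * pd k g x + pd k f x * g x := by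
    intro k; funext y; exact pd_mul hf.dfb hg.dfb k y
  simp only [lpl, h1, Finset.mul_sum]
  rw [← Finset.sum_add_distrib, ← Finset.sum_add_distrib]
  refine Finset.sum_congr rfl fun k _ => ?_
  have hgk := contDiff_pd k hg
  have hfk := contDiff_pd k hf
  rw [pd_add (hf.mul hgk).dfb (hfk.mul hg).dfb, pd_mul hf.dfb hgk.dfb, pd_mul hfk.dfb hg.dfb]
  ring

lemma lpl_add {n : ℕ} {f g : EE n → ℝ} (hf : ContDiff ℝ (⊤ : ℕ∞) f) (hg : ContDiff ℝ (⊤ : ℕ∞) g)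
    (x : EE n) : lpl (fun x => f x + g x) x = lpl f x + lpl g x := by
  have h1 : ∀ k, pd k (fun x => f x + g x) = fun x => pd k f x + pd k g x := by
    intro k; funext y; exact pd_add hf.dfb hg.dfb k y
  simp only [lpl, h1]
  rw [← Finset.sum_add_distrib]
  refine Finset.sum_congr rfl fun k _ => ?_
  rw [pd_add (contDiff_pd k hf).dfb (contDiff_pd k hg).dfb]

lemma pd_rpow {n : ℕ} {f : EE n → ℝ} (hf : ContDiff ℝ (⊤ : ℕ∞) f) (h0 : ∀ x, 0 < f x) (a : ℝ)
    (i : Fin n) : pd i (fun x => f x ^ a) = fun x => a * f x ^ (a - 1) * pd i f x := by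
  funext x
  have h := (hf.dfb x).hasFDerivAt.rpow_const (p := a) (Or.inl (h0 x).ne')
  rw [pd, h.fderiv]
  simp [pd]

lemma contDiff_rpow {n : ℕ} {f : EE n → ℝ} (hf : ContDiff ℝ (⊤ : ℕ∞) f) (h0 : ∀ x, 0 < f x) (a : ℝ) :
    ContDiff ℝ (⊤ : ℕ∞) (fun x => f x ^ a) := hf.rpow_const_of_ne fun x => (h0 x).ne'

lemma lpl_rpow {n : ℕ} {f : EE n → ℝ} (hf : ContDiff ℝ (⊤ : ℕ∞) f) (h0 : ∀ x, 0 < f x) (a : ℝ)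
    (x : EE n) : lpl (fun x => f x ^ a) x =
      a * f x ^ (a - 1) * lpl f x + a * (a - 1) * f x ^ (a - 2) * ∑ k, pd k f x ^ 2 := by
  simp only [lpl, pd_rpow hf h0, Finset.mul_sum]
  rw [← Finset.sum_add_distrib]
  refine Finset.sum_congr rfl fun k _ => ?_
  have hfk := contDiff_pd k hf
  have hr := contDiff_rpow hf h0 (a - 1)
  rw [pd_mul (contDiff_const.mul hr).dfb hfk.dfb, pd_const_mul hr.dfb, pd_rpow hf h0]
  rw [show a - 1 - 1 = a - 2 by ring]
  ring

def HS (n : ℕ) : Set (ℝ × EE n) := Ioi 0 ×ˢ univ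

structure PD {n : ℕ} (f h : ℝ → EE n → ℝ) : Prop where
  sm : ∀ r, 0 < r → ContDiff ℝ (⊤ : ℕ∞) (f r)
  cf : ContinuousOn (fun q : ℝ × EE n => f q.1 q.2) (HS n)
  cg : ∀ k, ContinuousOn (fun q : ℝ × EE n => pd k (f q.1) q.2) (HS n)
  cl : ContinuousOn (fun q : ℝ × EE n => lpl (f q.1) q.2) (HS n)
  ch : ContinuousOn (fun q : ℝ × EE n => h q.1 q.2) (HS n)
  hd : ∀ r, 0 < r → ∀ x, HasDerivAt (fun r => f r x) (r * (lpl (f r) x + h r x)) r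

section
variable {n : ℕ} {f g h e : ℝ → EE n → ℝ}

lemma PD.congr {h' : ℝ → EE n → ℝ} (H : PD f h) (he : ∀ r, 0 < r → ∀ x, h r x = h' r x) : PD f h' :=
  ⟨H.sm, H.cf, H.cg, H.cl, H.ch.congr fun q hq => (he q.1 hq.1 q.2).symm,
    fun r hr x => by rw [← he r hr x]; exact H.hd r hr x⟩

lemma PD_U {G φ : EE n → ℝ} (hG : GK G) (hφ : TF φ) : PD (fun r => PR G φ r) (fun _ _ => 0) where
  sm := fun r hr => PR_contDiff hG.dec.1 hφ hr
  cf := (PR_cont hG.dec hφ.cc).continuousOn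
  cg := fun k => (PR_cont hG.dec (hφ.pd k).cc).continuousOn.congr fun q hq => by
    have := pd_PR hG.dec.1 hφ hq.1 k
    rw [this]
  cl := (PR_cont hG.dec hφ.lpl.cc).continuousOn.congr fun q hq => by
    have := lpl_PR hG.dec.1 hφ hq.1
    rw [this]
  ch := continuousOn_const
  hd := fun r hr x => by simpa using hG.hasDerivAt hφ hr x

lemma PD.add (H : PD f h) (K : PD g e) : PD (fun r x => f r x + g r x) (fun r x => h r x + e r x) where
  sm := fun r hr => (H.sm r hr).add (K.sm r hr)
  cf := H.cf.add K.cf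
  cg := fun k => ((H.cg k).add (K.cg k)).congr fun q hq => by
    exact pd_add (H.sm _ hq.1).dfb (K.sm _ hq.1).dfb k q.2
  cl := (H.cl.add K.cl).congr fun q hq => lpl_add (H.sm _ hq.1) (K.sm _ hq.1) q.2
  ch := H.ch.add K.ch
  hd := fun r hr x => by
    rw [lpl_add (H.sm _ hr) (K.sm _ hr)]
    exact ((H.hd r hr x).add (K.hd r hr x)).congr_deriv (by ring)

lemma PD.mul (H : PD f h) (K : PD g e) : PD (fun r x => f r x * g r x)
    (fun r x => f r x * e r x + g r x * h r x - 2 * ∑ k, pd k (f r) x * pd k (g r) x) where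
  sm := fun r hr => (H.sm r hr).mul (K.sm r hr)
  cf := H.cf.mul K.cf
  cg := fun k => ((H.cf.mul (K.cg k)).add ((H.cg k).mul K.cf)).congr fun q hq => by
    exact pd_mul (H.sm _ hq.1).dfb (K.sm _ hq.1).dfb k q.2
  cl := (((H.cf.mul K.cl).add (K.cf.mul H.cl)).add (continuousOn_const.mul
    (continuousOn_finsetSum Finset.univ fun k _ => (H.cg k).mul (K.cg k)))).congr fun q hq =>
      lpl_mul (H.sm _ hq.1) (K.sm _ hq.1) q.2
  ch := ((H.cf.mul K.ch).add (K.cf.mul H.ch)).sub (continuousOn_const.mul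
    (continuousOn_finsetSum Finset.univ fun k _ => (H.cg k).mul (K.cg k)))
  hd := fun r hr x => by
    rw [lpl_mul (H.sm _ hr) (K.sm _ hr)]
    exact ((H.hd r hr x).mul (K.hd r hr x)).congr_deriv (by ring)

lemma PD.const_mul (H : PD f h) (c : ℝ) : PD (fun r x => c * f r x) (fun r x => c * h r x) where
  sm := fun r hr => contDiff_const.mul (H.sm r hr)
  cf := continuousOn_const.mul H.cf
  cg := fun k => (continuousOn_const.mul (H.cg k)).congr fun q hq => by
    have := pd_const_mul (H.sm _ hq.1).dfb c k
    exact congrFun this q.2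
  cl := (continuousOn_const.mul H.cl).congr fun q hq =>
    congrFun (lpl_const_mul (H.sm _ hq.1) c) q.2
  ch := continuousOn_const.mul H.ch
  hd := fun r hr x => by
    have := congrFun (lpl_const_mul (H.sm _ hr) c) x
    rw [this]
    exact ((H.hd r hr x).const_mul c).congr_deriv (by ring)

lemma PD.rpow (H : PD f h) (h0 : ∀ r, 0 < r → ∀ x, 0 < f r x) (a : ℝ) : PD (fun r x => f r x ^ a)
    (fun r x => a * f r x ^ (a - 1) * h r x
      - a * (a - 1) * f r x ^ (a - 2) * ∑ k, pd k (f r) x ^ 2) := by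
  have hrp : ∀ b : ℝ, ContinuousOn (fun q : ℝ × EE n => f q.1 q.2 ^ b) (HS n) := fun b =>
    H.cf.rpow_const fun q hq => Or.inl (h0 q.1 hq.1 q.2).ne'
  have hsum : ContinuousOn (fun q : ℝ × EE n => ∑ k, pd k (f q.1) q.2 ^ 2) (HS n) :=
    continuousOn_finsetSum Finset.univ fun k _ => (H.cg k).pow 2
  refine ⟨fun r hr => contDiff_rpow (H.sm r hr) (h0 r hr) a, hrp a, fun k => ?_, ?_, ?_, ?_⟩
  · refine ((continuousOn_const (c := a).mul (hrp (a-1))).mul (H.cg k)).congr fun q hq => ?_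
    exact congrFun (pd_rpow (H.sm _ hq.1) (h0 _ hq.1) a k) q.2
  · refine (((continuousOn_const (c := a).mul (hrp (a-1))).mul H.cl).add
      ((continuousOn_const (c := a * (a-1)).mul (hrp (a-2))).mul hsum)).congr fun q hq => ?_
    exact lpl_rpow (H.sm _ hq.1) (h0 _ hq.1) a q.2
  · exact ((continuousOn_const.mul (hrp (a-1))).mul H.ch).sub
      ((continuousOn_const.mul (hrp (a-2))).mul hsum)
  · intro r hr x
    rw [lpl_rpow (H.sm _ hr) (h0 _ hr)]
    refine ((H.hd r hr x).rpow_const (p := a) (Or.inl (h0 r hr x).ne')).congr_deriv ?_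
    ring

/-- derivative under the integral sign with a compactly supported cutoff -/
lemma deriv_cutoff {χ : EE n → ℝ} (hχ : CC χ) {f f' : ℝ → EE n → ℝ}
    (cf : ContinuousOn (fun q : ℝ × EE n => f q.1 q.2) (HS n))
    (cf' : ContinuousOn (fun q : ℝ × EE n => f' q.1 q.2) (HS n))
    (hd : ∀ r, 0 < r → ∀ x, HasDerivAt (fun r => f r x) (f' r x) r) {r : ℝ} (hr : 0 < r) :
    HasDerivAt (fun r => ∫ x, χ x * f r x) (∫ x, χ x * f' r x) r := by
  have hslice : ∀ {u : ℝ → EE n → ℝ}, ContinuousOn (fun q : ℝ × EE n => u q.1 q.2) (HS n) →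
      ∀ s, 0 < s → Continuous (u s) := by
    intro u hu s hs
    rw [← continuousOn_univ]
    exact hu.comp (f := fun x => (s, x)) (by fun_prop) fun x _ => ⟨hs, trivial⟩
  have hK : IsCompact (Icc (r/2) (2*r) ×ˢ tsupport χ) := isCompact_Icc.prod hχ.2
  have hsub : Icc (r/2) (2*r) ×ˢ tsupport χ ⊆ HS n := fun q hq => ⟨by
    have := hq.1.1
    simp only [mem_Ioi]; linarith, trivial⟩
  obtain ⟨M, hM⟩ := hK.exists_bound_of_continuousOn (cf'.mono hsub)
  refine (hasDerivAt_integral_of_dominated_loc_of_deriv_le (μ := volume) (x₀ := r)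
    (s := Icc (r/2) (2*r)) (F := fun s x => χ x * f s x)
    (F' := fun s x => χ x * f' s x)
    (bound := fun x => |χ x| * |M|) (Icc_mem_nhds (by linarith) (by linarith)) ?_ ?_ ?_ ?_ ?_ ?_).2
  · filter_upwards [Ioi_mem_nhds hr] with s hs
    exact (hχ.1.mul (hslice cf s hs)).aestronglyMeasurable
  · exact (hχ.mul_right (hslice cf r hr)).integrable
  · exact (hχ.mul_right (hslice cf' r hr)).integrable.aestronglyMeasurable
  · refine Eventually.of_forall fun x s hs => ?_
    rw [Real.norm_eq_abs, abs_mul]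
    by_cases hx : x ∈ tsupport χ
    · refine mul_le_mul_of_nonneg_left ?_ (abs_nonneg _)
      exact (hM (s, x) ⟨hs, hx⟩).trans (le_abs_self M)
    · rw [image_eq_zero_of_notMem_tsupport hx]; simp
  · exact hχ.abs.integrable.mul_const _
  · refine Eventually.of_forall fun x s hs => ?_
    exact (hd s (by have := hs.1; linarith) x).const_mul _

lemma ibp_lpl {φ g : EE n → ℝ} (hφ : TF φ) (hg : ContDiff ℝ (⊤ : ℕ∞) g) :
    ∫ x, φ x * lpl g x = ∫ x, lpl φ x * g x := by
  simp only [lpl, Finset.mul_sum, Finset.sum_mul]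
  rw [integral_finsetSum _ fun i _ => (hφ.cc.mul_right (contDiff_pd i (contDiff_pd i hg)).continuous).integrable,
    integral_finsetSum _ fun i _ => (((hφ.pd i).pd i).cc.mul_right hg.continuous).integrable]
  refine Finset.sum_congr rfl fun i _ => ?_
  rw [ibp_pd hφ (contDiff_pd i hg), ibp_pd (hφ.pd i) hg, neg_neg]

lemma PD.slice (H : PD f h) {r : ℝ} (hr : 0 < r) : Continuous (h r) := by
  rw [← continuousOn_univ]
  exact H.ch.comp (f := fun x => (r, x)) (by fun_prop) fun x _ => ⟨hr, trivial⟩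

lemma PD.deriv (H : PD f h) {χ : EE n → ℝ} (hχ : TF χ) {r : ℝ} (hr : 0 < r) :
    HasDerivAt (fun r => ∫ x, χ x * f r x)
      (r * (∫ x, lpl χ x * f r x + χ x * h r x)) r := by
  have h1 := deriv_cutoff hχ.cc H.cf (f' := fun r x => r * (lpl (f r) x + h r x))
    (continuousOn_fst.mul (H.cl.add H.ch)) H.hd hr
  refine h1.congr_deriv ?_
  have hl : Continuous (lpl (f r)) := by
    unfold lpl
    exact continuous_finsetSum _ fun k _ => (contDiff_pd k (contDiff_pd k (H.sm r hr))).continuous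
  have e1 : ∫ x, χ x * (r * (lpl (f r) x + h r x)) = r * ∫ x, χ x * lpl (f r) x + χ x * h r x := by
    rw [← integral_const_mul]; congr 1; funext x; ring
  rw [e1, integral_add (hχ.cc.mul_right hl).integrable (hχ.cc.mul_right (H.slice hr)).integrable,
    integral_add (hχ.lpl.cc.mul_right (H.sm r hr).continuous).integrable
      (hχ.cc.mul_right (H.slice hr)).integrable, ibp_lpl hχ (H.sm r hr)]

end


/-! ## The Bellman function -/

lemma bell_fin {U P Q S s t ρ z zi k : ℝ} (hU : 0 < U) (hP : 0 ≤ P) (hQ : 0 ≤ Q)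
    (hS : S^2 ≤ P * Q) (hs0 : 0 ≤ s) (hs1 : s ≤ 1) (ht0 : 0 ≤ t) (ht1 : t ≤ 1)
    (hρ0 : 0 ≤ ρ) (hρ1 : ρ < 1) (hz : U ≤ z) (hzi0 : 0 ≤ zi) (hzi : zi ≤ U⁻¹) (hk1 : 1 ≤ k)
    (hk : (1 - ρ) * k = 1) :
    √P * √Q ≤ 5 * U⁻¹ * P + ρ * k * (k - 1) * (t * z) * Q
      - ρ * (1 - ρ) * (s^2 * zi * P + 2 * k * (s * t) * S + k^2 * (t^2 * z) * Q)
      + 2 * z * Q + 4 * ρ * (s * S + k * (t * z) * Q) := by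
  set α := √P with hα
  set β := √Q with hβ
  have hα0 : 0 ≤ α := Real.sqrt_nonneg _
  have hβ0 : 0 ≤ β := Real.sqrt_nonneg _
  have hPα : P = α^2 := (Real.sq_sqrt hP).symm
  have hQβ : Q = β^2 := (Real.sq_sqrt hQ).symm
  have hSab : |S| ≤ α * β := by
    apply abs_le_of_sq_le_sq _ (by positivity)
    rw [mul_pow, ← hPα, ← hQβ]; exact hS
  have hUi : 0 < U⁻¹ := inv_pos.mpr hU
  have hk2 : ρ * (1 - ρ) * (2 * k * (s * t) * S) = 2 * ρ * (s * t) * S := by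
    linear_combination (2 * ρ * (s*t) * S) * hk
  have hk3 : ρ * (1 - ρ) * (k^2 * (t^2 * z) * Q) = ρ * k * (t^2 * z) * Q := by
    linear_combination (ρ * k * (t^2 * z) * Q) * hk
  have hz0 : 0 < z := hU.trans_le hz
  have h1 : ρ * (1 - ρ) * (s^2 * zi * P) ≤ U⁻¹ * P := by
    have a1 : ρ * (1 - ρ) ≤ 1 := by nlinarith
    have a2 : s^2 ≤ 1 := by nlinarith
    have a0 : 0 ≤ ρ * (1 - ρ) := mul_nonneg hρ0 (by linarith)
    calc ρ * (1 - ρ) * (s^2 * zi * P) ≤ 1 * (1 * U⁻¹ * P) := by gcongr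
      _ = _ := by ring
  have h2 : -(4 * (α * β)) ≤ (4 * ρ * s - 2 * ρ * (s * t)) * S := by
    have b0 : 0 ≤ 4 * ρ * s - 2 * ρ * (s * t) := by
      have : 0 ≤ ρ * s * (4 - 2 * t) := mul_nonneg (mul_nonneg hρ0 hs0) (by linarith)
      nlinarith
    have b1 : 4 * ρ * s - 2 * ρ * (s * t) ≤ 4 := by
      have : ρ * s ≤ 1 := by nlinarith
      have : 0 ≤ ρ * (s * t) := by positivity
      nlinarith
    have c1 : |(4 * ρ * s - 2 * ρ * (s * t)) * S| ≤ 4 * (α * β) := by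
      rw [abs_mul, abs_of_nonneg b0]; gcongr
    linarith [neg_abs_le ((4 * ρ * s - 2 * ρ * (s * t)) * S)]
  have h3 : 0 ≤ ρ * k * (t * z) * (k - 1 + 4 - t) * Q := by
    have : 0 ≤ k - 1 + 4 - t := by linarith
    positivity
  have h4 : 2 * U * Q ≤ 2 * z * Q := by gcongr
  have h5 : 5 * (α * β) ≤ 4 * U⁻¹ * P + 2 * U * Q := by
    have : 0 ≤ U⁻¹ * (4 * α^2 - 5 * α * (U * β) + 2 * (U * β)^2) := by
      apply mul_nonneg hUi.le
      nlinarith [sq_nonneg (2 * α - (5/4) * (U * β)), sq_nonneg (U * β)]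
    have e : U⁻¹ * (4 * α^2 - 5 * α * (U * β) + 2 * (U * β)^2) =
        4 * U⁻¹ * P - 5 * (α * β) + 2 * U * Q := by
      rw [hPα, hQβ]; field_simp
    linarith
  have e : 5 * U⁻¹ * P + ρ * k * (k - 1) * (t * z) * Q
      - ρ * (1 - ρ) * (s^2 * zi * P + 2 * k * (s * t) * S + k^2 * (t^2 * z) * Q)
      + 2 * z * Q + 4 * ρ * (s * S + k * (t * z) * Q) =
      5 * U⁻¹ * P - ρ * (1 - ρ) * (s^2 * zi * P) + (4 * ρ * s - 2 * ρ * (s * t)) * S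
        + ρ * k * (t * z) * (k - 1 + 4 - t) * Q + 2 * z * Q := by
    linear_combination - hk2 - hk3
  rw [e]
  clear_value α β
  linarith [h1, h2, h3, h4, h5]

/-- The Bellman function -/
def bel (p q u v : ℝ) : ℝ := (5 / (p * (p - 1))) * u ^ p + (v * v) * (u + v ^ (q - 1)) ^ (2 - p)

lemma bel_cont {p q : ℝ} (hp : 1 < p) (hp2 : p ≤ 2) (hq : 1 < q) :
    Continuous (fun y : ℝ × ℝ => bel p q y.1 y.2) := by
  unfold bel
  refine (continuous_const.mul (continuous_fst.rpow_const fun _ => Or.inr (by linarith))).add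
    ((continuous_snd.mul continuous_snd).mul ?_)
  exact (continuous_fst.add (continuous_snd.rpow_const fun _ => Or.inr (by linarith))).rpow_const
    fun _ => Or.inr (by linarith)

lemma bel_nonneg {p q u v : ℝ} (hp : 1 < p) (hu : 0 ≤ u) (hv : 0 ≤ v) : 0 ≤ bel p q u v := by
  have : 0 < p - 1 := by linarith
  unfold bel; positivity

lemma bel_le {p q u v : ℝ} (hp : 1 < p) (hp2 : p ≤ 2) (hpq : (p - 1) * (q - 1) = 1)
    (hu : 0 < u) (hv : 0 < v) :
    bel p q u v ≤ (5 / (p * (p - 1)) + 2) * (u ^ p + v ^ q) := by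
  have hp1 : 0 < p - 1 := by linarith
  have hup := Real.rpow_pos_of_pos hu p
  have hvq := Real.rpow_pos_of_pos hv q
  have hvv : v * v = v ^ (2:ℝ) := by rw [Real.rpow_two]; ring
  have h2 : (2:ℝ) ^ (2 - p) ≤ 2 := by
    calc (2:ℝ) ^ (2 - p) ≤ 2 ^ (1:ℝ) := Real.rpow_le_rpow_of_exponent_le (by norm_num) (by linarith)
      _ = 2 := by simp
  have key : (v * v) * (u + v ^ (q - 1)) ^ (2 - p) ≤ 2 * (u ^ p + v ^ q) := by
    have hw := Real.rpow_pos_of_pos hv (q - 1)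
    have hvw : v = (v ^ (q-1)) ^ (p - 1) := by
      rw [← Real.rpow_mul hv.le, mul_comm, hpq, Real.rpow_one]
    rcases le_total (v ^ (q - 1)) u with h | h
    · have hvu : v ≤ u ^ (p - 1) := by
        rw [hvw]; exact Real.rpow_le_rpow hw.le h hp1.le
      calc (v * v) * (u + v ^ (q - 1)) ^ (2 - p) ≤ (u ^ (p-1) * u ^ (p-1)) * (2 * u) ^ (2 - p) := by
            gcongr; linarith
        _ = 2 ^ (2 - p) * u ^ p := by
            rw [Real.mul_rpow (by norm_num) hu.le, ← Real.rpow_add hu, mul_left_comm, ← Real.rpow_add hu]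
            ring_nf
        _ ≤ 2 * (u ^ p + v ^ q) := by nlinarith
    · calc (v * v) * (u + v ^ (q - 1)) ^ (2 - p) ≤ v ^ (2:ℝ) * (2 * v ^ (q-1)) ^ (2 - p) := by
            rw [hvv]; gcongr; linarith
        _ = 2 ^ (2 - p) * v ^ q := by
            rw [Real.mul_rpow (by norm_num) hw.le, ← Real.rpow_mul hv.le, mul_left_comm,
              ← Real.rpow_add hv]
            congr 2; nlinarith
        _ ≤ 2 * (u ^ p + v ^ q) := by nlinarith
  have h5 : 0 < 5 / (p * (p - 1)) := by positivity
  unfold bel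
  nlinarith

lemma bel_cont_le {p q : ℝ} (hp : 1 < p) (hp2 : p ≤ 2) (hpq : (p - 1) * (q - 1) = 1)
    {u v : ℝ} (hu : 0 ≤ u) (hv : 0 ≤ v) :
    bel p q u v ≤ (5 / (p * (p - 1)) + 2) * (u ^ p + v ^ q) := by
  have hp1 : 0 < p - 1 := by linarith
  have hq : 1 < q := by
    by_contra h
    have : (p - 1) * (q - 1) ≤ 0 := mul_nonpos_of_nonneg_of_nonpos hp1.le (by linarith)
    linarith
  have hc1 : Continuous fun t : ℝ => bel p q (u + t) (v + t) :=
    (bel_cont hp hp2 hq).comp (f := fun t : ℝ => (u + t, v + t)) (by fun_prop)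
  have hc2 : Continuous fun t : ℝ => (5 / (p * (p - 1)) + 2) * ((u + t) ^ p + (v + t) ^ q) := by
    refine continuous_const.mul (((continuous_const.add continuous_id).rpow_const fun _ => Or.inr (by linarith)).add
      ((continuous_const.add continuous_id).rpow_const fun _ => Or.inr (by linarith)))
  have h1 := (hc1.tendsto 0).mono_left (nhdsWithin_le_nhds (s := Ioi 0))
  have h2 := (hc2.tendsto 0).mono_left (nhdsWithin_le_nhds (s := Ioi 0))
  have := le_of_tendsto_of_tendsto h1 h2 (by
    filter_upwards [self_mem_nhdsWithin] with t ht
    have ht0 : 0 < t := ht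
    exact bel_le hp hp2 hpq (by linarith) (by linarith))
  simpa using this

lemma bell_point {n : ℕ} {p q u v : ℝ} (hp : 1 < p) (hp2 : p ≤ 2) (hpq : (p - 1) * (q - 1) = 1)
    (hu : 0 < u) (hv : 0 < v) (a b : Fin n → ℝ) (i j : Fin n) :
    |a i| * |b j| ≤ -((5 / (p * (p - 1))) * (p * u ^ (p - 1) * 0 - p * (p - 1) * u ^ (p - 2) * ∑ k, a k ^ 2)
      + ((v * v) * ((2 - p) * (u + v ^ (q - 1)) ^ (2 - p - 1) * (0 + ((q - 1) * v ^ (q - 1 - 1) * 0 -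
            (q - 1) * (q - 1 - 1) * v ^ (q - 1 - 2) * ∑ k, b k ^ 2))
          - (2 - p) * (2 - p - 1) * (u + v ^ (q - 1)) ^ (2 - p - 2) *
            ∑ k, (a k + (q - 1) * v ^ (q - 1 - 1) * b k) ^ 2)
        + (u + v ^ (q - 1)) ^ (2 - p) * (v * 0 + v * 0 - 2 * ∑ k, b k * b k)
        - 2 * ∑ k, (v * b k + b k * v) * ((2 - p) * (u + v ^ (q - 1)) ^ (2 - p - 1) *
            (a k + (q - 1) * v ^ (q - 1 - 1) * b k)))) := by
  have hp1 : 0 < p - 1 := by linarith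
  set P := ∑ k, a k ^ 2 with hP
  set Q := ∑ k, b k ^ 2 with hQ
  set S := ∑ k, a k * b k with hS
  set c := (q - 1) * v ^ (q - 1 - 1) with hc
  have e1 : ∑ k, (a k + c * b k) ^ 2 = P + 2 * c * S + c^2 * Q := by
    rw [hP, hQ, hS, Finset.mul_sum, Finset.mul_sum, ← Finset.sum_add_distrib, ← Finset.sum_add_distrib]
    exact Finset.sum_congr rfl fun k _ => by ring
  have e2 : ∑ k, b k * b k = Q := Finset.sum_congr rfl fun k _ => by ring
  set W := u + v ^ (q - 1) with hW
  have e3 : ∑ k, (v * b k + b k * v) * ((2 - p) * W ^ (2 - p - 1) * (a k + c * b k)) =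
      2 * v * ((2 - p) * W ^ (2 - p - 1)) * (S + c * Q) := by
    rw [hQ, hS, mul_add, Finset.mul_sum, Finset.mul_sum, Finset.mul_sum, ← Finset.sum_add_distrib]
    exact Finset.sum_congr rfl fun k _ => by ring
  rw [e1, e2, e3]
  have hw := Real.rpow_pos_of_pos hv (q - 1)
  have hW0 : 0 < W := by positivity
  set ρ := 2 - p with hρ
  set w := v ^ (q - 1) with hwdef
  have hvw : v = w ^ (p - 1) := by
    rw [hwdef, ← Real.rpow_mul hv.le, mul_comm, hpq, Real.rpow_one]
  have hk1 : 1 ≤ q - 1 := by nlinarith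
  have hvk : v * v ^ (q - 1 - 1) = w := by
    rw [hwdef, Real.rpow_sub_one hv.ne']; field_simp
  have hvk2 : v * v * v ^ (q - 1 - 2) = w := by
    rw [show q - 1 - 2 = q - 1 - 1 - 1 by ring, Real.rpow_sub_one hv.ne' (q-1-1), ← hvk]; field_simp
  have hfin := bell_fin (U := u ^ ρ) (P := P) (Q := Q) (S := S) (s := v * W ^ (ρ - 1)) (t := w / W)
    (ρ := ρ) (z := W ^ ρ) (zi := W ^ (-ρ)) (k := q - 1) (Real.rpow_pos_of_pos hu _)
    (Finset.sum_nonneg fun k _ => sq_nonneg _) (Finset.sum_nonneg fun k _ => sq_nonneg _)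
    (Finset.sum_mul_sq_le_sq_mul_sq _ _ _) (by positivity) (by
      have : W ^ (ρ - 1) = (W ^ (p - 1))⁻¹ := by
        rw [← Real.rpow_neg hW0.le]; congr 1; rw [hρ]; ring
      rw [this, ← div_eq_mul_inv, div_le_one (by positivity)]
      conv_lhs => rw [hvw]
      exact Real.rpow_le_rpow hw.le (by rw [hW]; linarith) hp1.le) (by positivity)
    (by rw [div_le_one hW0, hW]; linarith) (by linarith) (by linarith)
    (Real.rpow_le_rpow hu.le (by rw [hW]; linarith) (by linarith)) (by positivity) (by
      rw [Real.rpow_neg hW0.le]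
      exact inv_anti₀ (Real.rpow_pos_of_pos hu _)
        (Real.rpow_le_rpow hu.le (by rw [hW]; linarith) (by linarith))) hk1
    (by rw [hρ]; linarith)
  have hai : |a i| ≤ √P := Real.abs_le_sqrt (Finset.single_le_sum (f := fun k => a k ^ 2) (fun k _ => sq_nonneg _) (Finset.mem_univ i))
  have hbj : |b j| ≤ √Q := Real.abs_le_sqrt (Finset.single_le_sum (f := fun k => b k ^ 2) (fun k _ => sq_nonneg _) (Finset.mem_univ j))
  refine ((mul_le_mul hai hbj (abs_nonneg _) (Real.sqrt_nonneg _)).trans hfin).trans (le_of_eq ?_)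
  have hWρ : W ^ ρ = W ^ (ρ - 1) * W := by rw [Real.rpow_sub_one hW0.ne']; field_simp
  have hWρ2 : W ^ (ρ - 1) = W ^ (ρ - 2) * W := by
    rw [show ρ - 2 = ρ - 1 - 1 by ring, Real.rpow_sub_one hW0.ne' (ρ - 1)]; field_simp
  have hi : W ^ (-ρ) * (W ^ (ρ - 1))^2 = W ^ (ρ - 2) := by
    rw [← Real.rpow_natCast (W ^ (ρ-1)), ← Real.rpow_mul hW0.le, ← Real.rpow_add hW0]
    congr 1; push_cast; ring
  have hu2 : (u ^ ρ)⁻¹ = u ^ (p - 2) := by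
    rw [← Real.rpow_neg hu.le]; congr 1; rw [hρ]; ring
  have t1 : w / W * W ^ ρ = w * W ^ (ρ - 1) := by rw [hWρ]; field_simp
  have t2 : (w / W)^2 * W ^ ρ = w^2 * W ^ (ρ - 2) := by rw [hWρ, hWρ2]; field_simp
  have t3 : v * W ^ (ρ - 1) * (w / W) = v * w * W ^ (ρ - 2) := by rw [hWρ2]; field_simp
  have t4 : (v * W ^ (ρ - 1))^2 * W ^ (-ρ) = v^2 * W ^ (ρ - 2) := by rw [← hi]; ring
  rw [t1, t2, t3, t4, hu2]
  have hpne : p ≠ 0 := by linarith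
  have hp1ne : p - 1 ≠ 0 := hp1.ne'
  have e5 : 5 / (p * (p - 1)) * (p * u ^ (p - 1) * 0 - p * (p - 1) * u ^ (p - 2) * P) =
      - (5 * u ^ (p-2) * P) := by field_simp; ring
  rw [e5, hc]
  set V := v ^ (q - 1 - 1)
  set X1 := W ^ (ρ - 1)
  set X2 := W ^ (ρ - 2)
  set X0 := W ^ ρ
  set V2 := v ^ (q - 1 - 2)
  clear_value V X1 X2 X0 V2 w P Q S
  linear_combination (-(ρ * (q-1) * (q-1-1) * X1 * Q)) * hvk2 + (ρ * (1 - ρ) * 2 * (q-1) * X2 * S * v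
    + ρ * (1 - ρ) * (q-1)^2 * X2 * Q * (v * V + w) - 4 * ρ * (q-1) * X1 * Q) * hvk

/-- Existence of a Bellman function controlling gradients. -/
lemma bellman_le_two {p q : ℝ} (hp : 1 < p) (hp2 : p ≤ 2) (hpq : (p - 1) * (q - 1) = 1) {n : ℕ}
    {G φ ψ : EE n → ℝ} (hG : GK G) (hφ : TF φ) (hψ : TF ψ) (hφ0 : ∀ x, 0 ≤ φ x)
    (hψ0 : ∀ x, 0 ≤ ψ x) (hφn : ∃ x, φ x ≠ 0) (hψn : ∃ x, ψ x ≠ 0) :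
    ∃ h : ℝ → EE n → ℝ, PD (fun r x => bel p q (PR G φ r x) (PR G ψ r x)) h ∧
      ∀ i j, ∀ r, 0 < r → ∀ x, |pd i (PR G φ r) x| * |pd j (PR G ψ r) x| ≤ - h r x := by
  have hu : ∀ r, 0 < r → ∀ x, 0 < PR G φ r x := fun r hr x => hG.strict hφ.cc hφ0 hφn hr x
  have hv : ∀ r, 0 < r → ∀ x, 0 < PR G ψ r x := fun r hr x => hG.strict hψ.cc hψ0 hψn hr x
  have Pu := PD_U hG hφ
  have Pv := PD_U hG hψ
  have Pw := Pv.rpow hv (q - 1)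
  have PZ := Pu.add Pw
  have hZ : ∀ r, 0 < r → ∀ x, 0 < PR G φ r x + PR G ψ r x ^ (q - 1) := fun r hr x =>
    add_pos (hu r hr x) (Real.rpow_pos_of_pos (hv r hr x) _)
  have Pb := ((Pu.rpow hu p).const_mul (5 / (p * (p - 1)))).add
    ((Pv.mul Pv).mul (PZ.rpow hZ (2 - p)))
  refine ⟨_, Pb, fun i j r hr x => ?_⟩
  have hs1 := Pu.sm r hr
  have hs2 := Pv.sm r hr
  have hbp := bell_point hp hp2 hpq (hu r hr x) (hv r hr x) (fun k => pd k (PR G φ r) x)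
    (fun k => pd k (PR G ψ r) x) i j
  have d1 : ∀ k, pd k (fun x => PR G φ r x + PR G ψ r x ^ (q - 1)) x =
      pd k (PR G φ r) x + (q - 1) * PR G ψ r x ^ (q - 1 - 1) * pd k (PR G ψ r) x := by
    intro k
    rw [pd_add hs1.dfb (contDiff_rpow hs2 (hv r hr) _).dfb, pd_rpow hs2 (hv r hr)]
  have d2 : ∀ k, pd k (fun x => (PR G φ r x + PR G ψ r x ^ (q - 1)) ^ (2 - p)) x =
      (2 - p) * (PR G φ r x + PR G ψ r x ^ (q - 1)) ^ (2 - p - 1) *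
       (pd k (PR G φ r) x + (q - 1) * PR G ψ r x ^ (q - 1 - 1) * pd k (PR G ψ r) x) := by
    intro k
    rw [pd_rpow (hs1.add (contDiff_rpow hs2 (hv r hr) _)) (hZ r hr)]; simp only [d1]
  have d3 : ∀ k, pd k (fun x => PR G ψ r x * PR G ψ r x) x =
      PR G ψ r x * pd k (PR G ψ r) x + pd k (PR G ψ r) x * PR G ψ r x := fun k =>
    pd_mul hs2.dfb hs2.dfb k x
  simp only [d1, d2, d3]
  exact hbp

lemma bellman {p q : ℝ} (hp : 1 < p) (hpq : (p - 1) * (q - 1) = 1) (n : ℕ) :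
    ∃ B : ℝ → ℝ → ℝ, ∃ C, 0 < C ∧ Continuous (fun y : ℝ × ℝ => B y.1 y.2) ∧
    (∀ u v, 0 ≤ u → 0 ≤ v → 0 ≤ B u v ∧ B u v ≤ C * (u ^ p + v ^ q)) ∧
    ∀ G φ ψ : EE n → ℝ, GK G → TF φ → TF ψ → (∀ x, 0 ≤ φ x) → (∀ x, 0 ≤ ψ x) →
      (∃ x, φ x ≠ 0) → (∃ x, ψ x ≠ 0) →
      ∃ h : ℝ → EE n → ℝ, PD (fun r x => B (PR G φ r x) (PR G ψ r x)) h ∧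
      ∀ i j, ∀ r, 0 < r → ∀ x, |pd i (PR G φ r) x| * |pd j (PR G ψ r) x| ≤ - h r x := by
  have hp1 : 0 < p - 1 := by linarith
  have hq : 1 < q := by
    by_contra h
    have : (p - 1) * (q - 1) ≤ 0 := mul_nonpos_of_nonneg_of_nonpos hp1.le (by linarith)
    linarith
  have hq1 : 0 < q - 1 := by linarith
  rcases le_total p 2 with hp2 | hp2
  · refine ⟨bel p q, 5 / (p * (p - 1)) + 2, by positivity, bel_cont hp hp2 hq,
      fun u v hu hv => ⟨bel_nonneg hp hu hv, bel_cont_le hp hp2 hpq hu hv⟩, ?_⟩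
    intro G φ ψ hG hφ hψ hφ0 hψ0 hφn hψn
    exact bellman_le_two hp hp2 hpq hG hφ hψ hφ0 hψ0 hφn hψn
  · have hq2 : q ≤ 2 := by nlinarith
    have hqp : (q - 1) * (p - 1) = 1 := by rw [mul_comm]; exact hpq
    refine ⟨fun u v => bel q p v u, 5 / (q * (q - 1)) + 2, by positivity,
      (bel_cont hq hq2 hp).comp continuous_swap,
      fun u v hu hv => ⟨bel_nonneg hq hv hu, ?_⟩, ?_⟩
    · rw [add_comm (u ^ p)]; exact bel_cont_le hq hq2 hqp hv hu
    intro G φ ψ hG hφ hψ hφ0 hψ0 hφn hψn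
    obtain ⟨h, H, hh⟩ := bellman_le_two hq hq2 hqp hG hψ hφ hψ0 hφ0 hψn hφn
    exact ⟨h, H, fun i j r hr x => by rw [mul_comm]; exact hh j i r hr x⟩


/-! ## The bilinear estimate -/

lemma exists_cut (n : ℕ) : ∃ χ : ℝ → EE n → ℝ, ∃ K, 0 < K ∧ ∀ R, 1 ≤ R → TF (χ R) ∧
    (∀ x, 0 ≤ χ R x) ∧ (∀ x, χ R x ≤ 1) ∧ (∀ x, ‖x‖ ≤ R → χ R x = 1) ∧
    (∀ k x, |pd k (χ R) x| ≤ K / R) ∧ (∀ x, |lpl (χ R) x| ≤ K / R) := by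
  let b : ContDiffBump (0 : EE n) := ⟨1, 2, by norm_num, by norm_num⟩
  have hb : TF (b : EE n → ℝ) := ⟨b.contDiff, b.hasCompactSupport⟩
  choose M hM using fun k => (hb.pd k).cc.bounded
  obtain ⟨L, hL0, hL⟩ := hb.lpl.cc.bounded
  refine ⟨fun R x => b (0 + R⁻¹ • x), L + ∑ k, M k, by
    have : 0 ≤ ∑ k, M k := Finset.sum_nonneg fun k _ => (hM k).1.le
    linarith, fun R hR => ?_⟩
  have hR0 : 0 < R := by linarith
  have hRi : 0 < R⁻¹ := inv_pos.mpr hR0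
  have hRi1 : R⁻¹ ≤ 1 := inv_le_one_of_one_le₀ hR
  have hMs : 0 ≤ ∑ k, M k := Finset.sum_nonneg fun k _ => (hM k).1.le
  refine ⟨hb.affine 0 hRi.ne', fun x => b.nonneg, fun x => b.le_one, fun x hx => ?_, fun k x => ?_,
    fun x => ?_⟩
  · apply b.one_of_mem_closedBall
    rw [mem_closedBall_zero_iff, zero_add, norm_smul, Real.norm_of_nonneg hRi.le, inv_mul_le_one₀ hR0]
    exact hx
  · rw [pd_affine hb.differentiable 0 R⁻¹ k]
    simp only
    rw [abs_mul, abs_of_pos hRi, div_eq_inv_mul]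
    gcongr
    refine ((hM k).2 _).trans ?_
    have := Finset.single_le_sum (f := M) (fun k _ => (hM k).1.le) (Finset.mem_univ k)
    linarith
  · rw [lpl_affine hb.1 0 R⁻¹]
    rw [abs_mul, abs_of_pos (by positivity), div_eq_inv_mul]
    have : R⁻¹ ^ 2 ≤ R⁻¹ := by nlinarith
    have h2 := hL (0 + R⁻¹ • x)
    calc R⁻¹ ^ 2 * |lpl (b : EE n → ℝ) (0 + R⁻¹ • x)| ≤ R⁻¹ * L := by gcongr
      _ ≤ _ := by gcongr; linarith

lemma cutoff_cont {n : ℕ} {χ : EE n → ℝ} (hχ : CC χ) {f : ℝ → EE n → ℝ}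
    (hf : Continuous (fun q : ℝ × EE n => f q.1 q.2)) : Continuous (fun r => ∫ x, χ x * f r x) := by
  rw [← continuousOn_univ]
  refine continuousOn_integral_of_compact_support (k := tsupport χ) hχ.2 ?_ ?_
  · exact ((hχ.1.comp continuous_snd).mul hf).continuousOn
  · intro r x _ hx
    rw [image_eq_zero_of_notMem_tsupport hx, zero_mul]

lemma err_le {n : ℕ} {a v c : EE n → ℝ} {A M : ℝ} (hA : ∀ x, |a x| ≤ A) (hv : Integrable v)
    (hM : ∀ x, |c x| ≤ M) : |∫ x, a x * v x * c x| ≤ A * M * ∫ x, |v x| := by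
  have hA0 : 0 ≤ A := (abs_nonneg _).trans (hA 0)
  rw [← integral_const_mul, ← Real.norm_eq_abs]
  refine norm_integral_le_of_norm_le (hv.abs.const_mul _) (Eventually.of_forall fun x => ?_)
  rw [Real.norm_eq_abs, abs_mul, abs_mul]
  calc |a x| * |v x| * |c x| ≤ A * |v x| * M := by gcongr; exact hA x; exact hM x
    _ = _ := by ring

lemma bell_int {n : ℕ} {p q : ℝ} (hp : 1 < p) (hq : 1 < q) {G : EE n → ℝ} (hG : GK G) {χ : ℝ → EE n → ℝ} {K : ℝ}
    (hK : 0 < K) (hχ : ∀ R, 1 ≤ R → TF (χ R) ∧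
    (∀ x, 0 ≤ χ R x) ∧ (∀ x, χ R x ≤ 1) ∧ (∀ x, ‖x‖ ≤ R → χ R x = 1) ∧
    (∀ k x, |pd k (χ R) x| ≤ K / R) ∧ (∀ x, |lpl (χ R) x| ≤ K / R))
    {B : ℝ → ℝ → ℝ} {C : ℝ} (hC : 0 < C)
    (hB : ∀ u v, 0 ≤ u → 0 ≤ v → 0 ≤ B u v ∧ B u v ≤ C * (u ^ p + v ^ q))
    {φ ψ : EE n → ℝ} (hφ : TF φ) (hψ : TF ψ) (hφ0 : ∀ x, 0 ≤ φ x) (hψ0 : ∀ x, 0 ≤ ψ x)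
    {h : ℝ → EE n → ℝ} (H : PD (fun r x => B (PR G φ r x) (PR G ψ r x)) h)
    (hh : ∀ i j, ∀ r, 0 < r → ∀ x, |pd i (PR G φ r) x| * |pd j (PR G ψ r) x| ≤ - h r x) :
    ∃ E, 0 ≤ E ∧ ∀ i j, ∀ R, 1 ≤ R → ∀ r, 0 < r → ∃ D,
      HasDerivAt (fun r => ∫ x, χ R x * B (PR G φ r x) (PR G ψ r x)) D r ∧
      D ≤ r * (E / R - ∫ x, χ R x * (|pd i (PR G φ r) x| * |pd j (PR G ψ r) x|)) := by
  obtain ⟨M, hM0, hM⟩ := hφ.cc.bounded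
  obtain ⟨N, hN0, hN⟩ := hψ.cc.bounded
  have hI1 : 0 ≤ ∫ x, |φ x| := integral_nonneg fun x => abs_nonneg _
  have hI2 : 0 ≤ ∫ x, |ψ x| := integral_nonneg fun x => abs_nonneg _
  refine ⟨K * (C * (M ^ (p-1) * ∫ x, |φ x|) + C * (N ^ (q-1) * ∫ x, |ψ x|)), by positivity,
    fun i j R hR r hr => ?_⟩
  obtain ⟨c1, c2, c3, c4, c5, c6⟩ := hχ R hR
  have hR0 : 0 < R := by linarith
  refine ⟨_, H.deriv c1 hr, ?_⟩
  have hpow : ∀ {u m s : ℝ}, 1 < s → 0 ≤ u → u ≤ m → u ^ s ≤ m ^ (s-1) * |u| := by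
    intro u m s hs hu hum
    rw [abs_of_nonneg hu]
    rcases hu.eq_or_lt with h0 | h0
    · rw [← h0, Real.zero_rpow (by linarith)]; simp
    · have : u ^ s = u ^ (s-1) * u := by rw [Real.rpow_sub_one h0.ne']; field_simp
      rw [this]; gcongr
  have hle : ∀ x, |B (PR G φ r x) (PR G ψ r x)| ≤ C * (M^(p-1)) * |PR G φ r x| + C * (N ^ (q-1)) * |PR G ψ r x| := by
    intro x
    have n1 := hG.nonneg hφ0 r x
    have n2 := hG.nonneg hψ0 r x
    obtain ⟨b1, b2⟩ := hB _ _ n1 n2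
    rw [abs_of_nonneg b1]
    have s1 := hpow hp n1 ((le_abs_self _).trans (hG.sup_le hM r x))
    have s2 := hpow hq n2 ((le_abs_self _).trans (hG.sup_le hN r x))
    calc _ ≤ C * (PR G φ r x ^ p + PR G ψ r x ^ q) := b2
      _ ≤ C * (M ^ (p-1) * |PR G φ r x| + N ^ (q-1) * |PR G ψ r x|) := by gcongr
      _ = _ := by ring
  have i1 := (PR_integrable hG.dec.integrable hφ.cc hr).abs
  have i2 := (PR_integrable hG.dec.integrable hψ.cc hr).abs
  have hcB : Continuous fun x => B (PR G φ r x) (PR G ψ r x) := (H.sm r hr).continuous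
  have t1 : ∫ x, lpl (χ R) x * B (PR G φ r x) (PR G ψ r x) ≤
      (K * (C * (M ^ (p-1) * ∫ x, |φ x|) + C * (N ^ (q-1) * ∫ x, |ψ x|))) / R := by
    have hintg := ((i1.const_mul (C * M^(p-1))).add (i2.const_mul (C * N^(q-1)))).const_mul (K / R)
    calc _ ≤ ∫ x, K / R * (C * M^(p-1) * |PR G φ r x| + C * N ^ (q-1) * |PR G ψ r x|) := by
          refine integral_mono (c1.lpl.cc.mul_right hcB).integrable hintg fun x => ?_
          refine (le_abs_self _).trans ?_
          simp only
          rw [abs_mul]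
          exact mul_le_mul (c6 x) (hle x) (abs_nonneg _) (by positivity)
      _ = K / R * (C * M^(p-1) * (∫ x, |PR G φ r x|) + C * N ^ (q-1) * ∫ x, |PR G ψ r x|) := by
          rw [integral_const_mul, integral_add (i1.const_mul _) (i2.const_mul _),
            integral_const_mul, integral_const_mul]
      _ ≤ K / R * (C * M^(p-1) * (∫ x, |φ x|) + C * N ^ (q-1) * ∫ x, |ψ x|) := by
          have := hG.L1 hφ.cc hr
          have := hG.L1 hψ.cc hr
          gcongr
      _ = _ := by ring
  have hcu : Continuous fun x => |pd i (PR G φ r) x| * |pd j (PR G ψ r) x| :=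
    (contDiff_pd i (PR_contDiff hG.dec.1 hφ hr)).continuous.abs.mul
      (contDiff_pd j (PR_contDiff hG.dec.1 hψ hr)).continuous.abs
  have t2 : ∫ x, χ R x * (|pd i (PR G φ r) x| * |pd j (PR G ψ r) x|) ≤ - ∫ x, χ R x * h r x := by
    rw [← integral_neg]
    refine integral_mono (c1.cc.mul_right hcu).integrable (c1.cc.mul_right (H.slice hr)).integrable.neg fun x => ?_
    have := mul_le_mul_of_nonneg_left (hh i j r hr x) (c2 x)
    simp only
    linarith
  rw [integral_add (c1.lpl.cc.mul_right hcB).integrable (c1.cc.mul_right (H.slice hr)).integrable]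
  gcongr
  linarith

lemma pair_deriv {n : ℕ} {G : EE n → ℝ} (hG : GK G) {χ : ℝ → EE n → ℝ} {K : ℝ}
    (hK : 0 < K) (hχ : ∀ R, 1 ≤ R → TF (χ R) ∧
    (∀ x, 0 ≤ χ R x) ∧ (∀ x, χ R x ≤ 1) ∧ (∀ x, ‖x‖ ≤ R → χ R x = 1) ∧
    (∀ k x, |pd k (χ R) x| ≤ K / R) ∧ (∀ x, |lpl (χ R) x| ≤ K / R))
    {F g : EE n → ℝ} (hF : TF F) (hg : TF g) (i j : Fin n) :
    ∃ E, 0 ≤ E ∧ ∀ R, 1 ≤ R → ∀ r, 0 < r → ∃ D,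
      HasDerivAt (fun r => ∫ x, χ R x * (PR G (pd i (pd j F)) r x * PR G g r x)) D r ∧
      |D| ≤ r * (E / R + 2 * ∫ x, χ R x * (|pd j (PR G (lpl F) r) x| * |pd i (PR G g r) x|)) := by
  set w := pd i (pd j F) with hw
  have hwT : TF w := (hF.pd j).pd i
  obtain ⟨M0, hM00, hM0⟩ := hwT.cc.bounded
  obtain ⟨M1, hM10, hM1⟩ := (hF.lpl.pd j).cc.bounded
  choose M2 hM20 hM2 using fun k => (hwT.pd k).cc.bounded
  have hN : 0 ≤ ∫ x, |g x| := integral_nonneg fun x => abs_nonneg _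
  have hS : 0 ≤ ∑ k, M2 k := Finset.sum_nonneg fun k _ => (hM20 k).le
  refine ⟨K * (2 * M1 + M0 + 2 * ∑ k, M2 k) * ∫ x, |g x|, by positivity, fun R hR r hr => ?_⟩
  obtain ⟨c1, c2, c3, c4, c5, c6⟩ := hχ R hR
  have hR0 : 0 < R := by linarith
  have PW := PD_U hG hwT
  have Pv := PD_U hG hg
  have hd := deriv_cutoff c1.cc (PW.cf.mul Pv.cf)
    (f' := fun r x => r * (lpl (PR G w r) x * PR G g r x + PR G w r x * lpl (PR G g r) x))
    (continuousOn_fst.mul ((PW.cl.mul Pv.cf).add (PW.cf.mul Pv.cl)))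
    (fun r hr x => ((PW.hd r hr x).mul (Pv.hd r hr x)).congr_deriv (by ring)) hr
  refine ⟨_, hd, ?_⟩
  set W := PR G w r with hWd
  set v := PR G g r with hvd
  set u := PR G (lpl F) r with hud
  have sW : ContDiff ℝ (⊤ : ℕ∞) W := PW.sm r hr
  have sv : ContDiff ℝ (⊤ : ℕ∞) v := Pv.sm r hr
  have su : ContDiff ℝ (⊤ : ℕ∞) u := PR_contDiff hG.dec.1 hF.lpl hr
  have hlW : lpl W = pd i (pd j u) := by
    rw [hWd, lpl_PR hG.dec.1 hwT hr, hw, lpl_pd (hF.pd j), lpl_pd hF, hud,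
      pd_PR hG.dec.1 hF.lpl hr, pd_PR hG.dec.1 (hF.lpl.pd j) hr]
  have iv : Integrable v := PR_integrable hG.dec.integrable hg.cc hr
  have hv1 : ∫ x, |v x| ≤ ∫ x, |g x| := hG.L1 hg.cc hr
  have cpd : ∀ {k : Fin n} {f : EE n → ℝ}, ContDiff ℝ (⊤ : ℕ∞) f → Continuous (pd k f) :=
    fun h => (contDiff_pd _ h).continuous
  have hlc : ∀ {f : EE n → ℝ}, ContDiff ℝ (⊤ : ℕ∞) f → Continuous (lpl f) := by
    intro f hf
    unfold lpl
    exact continuous_finsetSum _ fun k _ => cpd (contDiff_pd k hf)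
  -- first term
  have hTv : TF (fun x => v x * χ R x) := c1.mul_left sv
  have hTW : TF (fun x => W x * χ R x) := c1.mul_left sW
  have e1 : ∫ x, χ R x * (lpl W x * v x) = - (∫ x, χ R x * (pd j u x * pd i v x)) - ∫ x, pd i (χ R) x * v x * pd j u x := by
    have := ibp_pd hTv (contDiff_pd j su) i
    have e0 : ∫ x, χ R x * (lpl W x * v x) = ∫ x, v x * χ R x * pd i (pd j u) x := by
      rw [hlW]; congr 1; funext x; ring
    rw [e0, this, ← integral_neg, ← integral_neg, ← integral_sub]
    · congr 1; funext x; rw [pd_mul sv.dfb c1.differentiable]; ring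
    · exact (c1.cc.mul_right ((cpd su).mul (cpd sv))).integrable.neg
    · exact (((c1.pd i).cc.mul_right sv.continuous).mul_right (cpd su)).integrable
  have iA : Integrable fun x => χ R x * (lpl W x * v x) :=
    (c1.cc.mul_right ((hlc sW).mul sv.continuous)).integrable
  have iB : Integrable fun x => χ R x * (W x * lpl v x) :=
    (c1.cc.mul_right (sW.continuous.mul (hlc sv))).integrable
  have e2 : ∫ x, χ R x * (W x * lpl v x) = (∫ x, χ R x * (lpl W x * v x)) +
      ((∫ x, lpl (χ R) x * v x * W x) + 2 * ∑ k, ∫ x, pd k (χ R) x * v x * pd k W x) := by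
    have := ibp_lpl hTW sv
    have e0 : ∫ x, χ R x * (W x * lpl v x) = ∫ x, W x * χ R x * lpl v x := by
      congr 1; funext x; ring
    rw [e0, this, ← integral_finsetSum _ fun k _ =>
      (((c1.pd k).cc.mul_right sv.continuous).mul_right (cpd sW)).integrable, ← integral_const_mul,
      ← integral_add (((c1.lpl.cc.mul_right sv.continuous).mul_right sW.continuous).integrable),
      ← integral_add iA]
    · congr 1; funext x; rw [lpl_mul sW c1.1, Finset.mul_sum, Finset.mul_sum, add_mul, add_mul, Finset.sum_mul]
      have : ∀ k, 2 * (pd k W x * pd k (χ R) x) * v x = 2 * (pd k (χ R) x * v x * pd k W x) := fun k => by ring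
      simp only [this]; ring
    · refine (((c1.lpl.cc.mul_right sv.continuous).mul_right sW.continuous).integrable).add ?_
      exact (integrable_finset_sum _ fun k _ =>
        (((c1.pd k).cc.mul_right sv.continuous).mul_right (cpd sW)).integrable).const_mul 2
    · exact (integrable_finset_sum _ fun k _ =>
        (((c1.pd k).cc.mul_right sv.continuous).mul_right (cpd sW)).integrable).const_mul 2
  have etot : ∫ x, χ R x * (r * (lpl W x * v x + W x * lpl v x)) =
      r * ((∫ x, χ R x * (lpl W x * v x)) + ∫ x, χ R x * (W x * lpl v x)) := by
    rw [← integral_add iA iB, ← integral_const_mul]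
    congr 1; funext x; ring
  rw [etot, abs_mul, abs_of_pos hr, e2, e1]
  have b1 : |∫ x, χ R x * (pd j u x * pd i v x)| ≤ ∫ x, χ R x * (|pd j u x| * |pd i v x|) := by
    refine abs_integral_le_integral_abs.trans (le_of_eq ?_)
    congr 1; funext x; rw [abs_mul, abs_mul, abs_of_nonneg (c2 x)]
  have b2 : |∫ x, pd i (χ R) x * v x * pd j u x| ≤ K / R * M1 * ∫ x, |g x| := by
    refine (err_le (c5 i) iv (M := M1) fun x => ?_).trans (by gcongr)
    rw [hud, pd_PR hG.dec.1 hF.lpl hr]; exact hG.sup_le hM1 r x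
  have b3 : |∫ x, lpl (χ R) x * v x * W x| ≤ K / R * M0 * ∫ x, |g x| :=
    (err_le c6 iv fun x => hG.sup_le hM0 r x).trans (by gcongr)
  have b4 : |∑ k, ∫ x, pd k (χ R) x * v x * pd k W x| ≤ K / R * (∑ k, M2 k) * ∫ x, |g x| := by
    refine (Finset.abs_sum_le_sum_abs _ _).trans ?_
    rw [Finset.mul_sum, Finset.sum_mul]
    refine Finset.sum_le_sum fun k _ => ?_
    refine (err_le (c5 k) iv (M := M2 k) fun x => ?_).trans (by have := hM20 k; gcongr)
    rw [hWd, pd_PR hG.dec.1 hwT hr]; exact hG.sup_le (hM2 k) r x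
  apply mul_le_mul_of_nonneg_left _ hr.le
  have er : K * (2 * M1 + M0 + 2 * ∑ k, M2 k) * (∫ x, |g x|) / R =
    2 * (K / R * M1 * ∫ x, |g x|) + K / R * M0 * (∫ x, |g x|) + 2 * (K / R * (∑ k, M2 k) * ∫ x, |g x|) := by
    field_simp
  rw [er]
  rw [abs_le] at b1 b2 b3 b4 ⊢
  constructor <;> linarith [b1.1, b1.2, b2.1, b2.2, b3.1, b3.2, b4.1, b4.2]


lemma anti_bound {f : ℝ → ℝ} (hc : Continuous f) (hd : ∀ r, 0 < r → ∃ D, HasDerivAt f D r ∧ D ≤ 0)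
    {T : ℝ} (hT : 0 ≤ T) : f T ≤ f 0 := by
  have : AntitoneOn f (Icc 0 T) := by
    refine antitoneOn_of_deriv_nonpos (convex_Icc 0 T) hc.continuousOn ?_ ?_
    · intro r hr
      rw [interior_Icc] at hr
      obtain ⟨D, hD, _⟩ := hd r hr.1
      exact hD.differentiableAt.differentiableWithinAt
    · intro r hr
      rw [interior_Icc] at hr
      obtain ⟨D, hD, h⟩ := hd r hr.1
      rw [hD.deriv]; exact h
  exact this (left_mem_Icc.mpr hT) (right_mem_Icc.mpr hT) hT

lemma PR_split {n : ℕ} {G : EE n → ℝ} (hG : GK G) {φ : Fin 2 → EE n → ℝ} (hφ : ∀ a, TF (φ a))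
    {f : EE n → ℝ} (hf : f = fun x => φ 0 x - φ 1 x) {r : ℝ} (hr : 0 < r) (j : Fin n) (x : EE n) :
    |pd j (PR G f r) x| ≤ ∑ a, |pd j (PR G (φ a) r) x| := by
  have e : PR G f r = fun x => PR G (φ 0) r x - PR G (φ 1) r x := by
    funext y; rw [hf]; exact PR_sub hG.dec (hφ 0).cc (hφ 1).cc r y
  have d : ∀ a, Differentiable ℝ (PR G (φ a) r) := fun a => (PR_contDiff hG.dec.1 (hφ a) hr).dfb
  have : pd j (PR G f r) x = pd j (PR G (φ 0) r) x - pd j (PR G (φ 1) r) x := by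
    rw [e]; unfold pd
    rw [fderiv_fun_sub (d 0 x) (d 1 x)]; rfl
  rw [this, Fin.sum_univ_two]
  exact abs_sub _ _

lemma bilinear {n : ℕ} (hn : 1 ≤ n) {p q : ℝ} (hp : 1 < p) (hpq : (p-1)*(q-1) = 1) :
    ∃ C, 0 < C ∧ ∀ F g : EE n → ℝ, TF F → TF g → ∀ φ ψ : Fin 2 → EE n → ℝ, (∀ a, TF (φ a)) → (∀ a, TF (ψ a)) →
      (∀ a x, 0 ≤ φ a x) → (∀ a x, 0 ≤ ψ a x) → (∀ a, ∃ x, φ a x ≠ 0) → (∀ a, ∃ x, ψ a x ≠ 0) →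
      (lpl F = fun x => φ 0 x - φ 1 x) → (g = fun x => ψ 0 x - ψ 1 x) → ∀ i j : Fin n,
      |∫ x, pd i (pd j F) x * g x| ≤ C * ((∑ a, ∫ x, φ a x ^ p) + ∑ a, ∫ x, ψ a x ^ q) := by
  have hq : 1 < q := by nlinarith
  obtain ⟨B, C, hC, hBc, hB, hbell⟩ := bellman hp hpq n
  obtain ⟨G, hG⟩ := exists_gauss n
  obtain ⟨χ, K, hK, hχ⟩ := exists_cut n
  obtain ⟨D0, hD0, hdec⟩ := hG.decay hn
  refine ⟨4 * C, by positivity, ?_⟩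
  intro F g hF hg φ ψ hφ hψ hφ0 hψ0 hφn hψn hFe hge i j
  choose h hPD hh using fun a b => hbell G (φ a) (ψ b) hG (hφ a) (hψ b) (hφ0 a) (hψ0 b) (hφn a) (hψn b)
  choose E hE0 hE using fun a b => bell_int hp hq hG hK hχ hC hB (hφ a) (hψ b) (hφ0 a) (hψ0 b) (hPD a b) (hh a b)
  obtain ⟨E', hE'0, hE'⟩ := pair_deriv hG hK hχ hF hg i j
  set w := pd i (pd j F) with hw
  have hwT : TF w := (hF.pd j).pd i
  set S := (∑ a, ∫ x, φ a x ^ p) + ∑ a, ∫ x, ψ a x ^ q with hS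
  have cPR : ∀ {f : EE n → ℝ}, TF f → Continuous (fun q : ℝ × EE n => PR G f q.1 q.2) :=
    fun hf => PR_cont hG.dec hf.cc
  have cpd : ∀ {k : Fin n} {f : EE n → ℝ} {r : ℝ}, 0 < r → TF f → Continuous (pd k (PR G f r)) :=
    fun hr h => (contDiff_pd _ (PR_contDiff hG.dec.1 h hr)).continuous
  have hI0 : ∀ R, 1 ≤ R → ∀ a b r, 0 ≤ ∫ x, χ R x * B (PR G (φ a) r x) (PR G (ψ b) r x) := by
    intro R hR a b r
    refine integral_nonneg fun x => mul_nonneg ((hχ R hR).2.1 x) ?_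
    exact (hB _ _ (hG.nonneg (hφ0 a) r x) (hG.nonneg (hψ0 b) r x)).1
  have hpi : ∀ {f : EE n → ℝ} {s : ℝ}, 1 < s → TF f → Integrable (fun x => f x ^ s) := by
    intro f s hs hf
    refine Continuous.integrable_of_hasCompactSupport
      (hf.1.continuous.rpow_const fun x => Or.inr (by linarith)) ?_
    exact hf.2.comp_left (g := fun t => t ^ s) (Real.zero_rpow (by linarith))
  have hI1 : ∀ R, 1 ≤ R → ∑ a, ∑ b, ∫ x, χ R x * B (PR G (φ a) 0 x) (PR G (ψ b) 0 x) ≤ 2 * C * S := by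
    intro R hR
    have : ∀ a b, ∫ x, χ R x * B (PR G (φ a) 0 x) (PR G (ψ b) 0 x) ≤
        C * ((∫ x, φ a x ^ p) + ∫ x, ψ b x ^ q) := by
      intro a b
      have i1 := hpi hp (hφ a)
      have i2 := hpi hq (hψ b)
      rw [← integral_add i1 i2, ← integral_const_mul]
      refine integral_mono ((hχ R hR).1.cc.mul_right ?_).integrable ((i1.add i2).const_mul C) fun x => ?_
      · exact hBc.comp (((cPR (hφ a)).comp (Continuous.prodMk continuous_const continuous_id)).prodMk
          ((cPR (hψ b)).comp (Continuous.prodMk continuous_const continuous_id)))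
      · simp only [PR_zero hG]
        have := hB _ _ (hφ0 a x) (hψ0 b x)
        calc _ ≤ 1 * B (φ a x) (ψ b x) := by gcongr; exact this.1; exact (hχ R hR).2.2.1 x
          _ ≤ _ := by rw [one_mul]; exact this.2
    refine (Finset.sum_le_sum fun a _ => Finset.sum_le_sum fun b _ => this a b).trans (le_of_eq ?_)
    rw [hS]; simp only [Fin.sum_univ_two]; ring
  set Et := E' + 2 * ∑ a, ∑ b, E a b with hEt
  have hEt0 : 0 ≤ Et := by
    have : 0 ≤ ∑ a, ∑ b, E a b := Finset.sum_nonneg fun a _ => Finset.sum_nonneg fun b _ => hE0 a b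
    linarith
  have key : ∀ R, 1 ≤ R → ∀ T, 0 ≤ T → ∀ e : ℝ, |e| = 1 →
      -(e * ∫ x, χ R x * (w x * g x)) ≤ 4 * C * S + |∫ x, χ R x * (PR G w T x * PR G g T x)| + Et / R * (T ^ 2 / 2) := by
    intro R hR T hT e he
    obtain ⟨c1, c2, c3, c4, c5, c6⟩ := hχ R hR
    have hR0 : 0 < R := by linarith
    have hcJ : Continuous (fun r => ∫ x, χ R x * (PR G w r x * PR G g r x)) :=
      cutoff_cont c1.cc ((cPR hwT).mul (cPR hg))
    have hcI : ∀ a b, Continuous (fun r => ∫ x, χ R x * B (PR G (φ a) r x) (PR G (ψ b) r x)) := fun a b =>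
      cutoff_cont c1.cc (hBc.comp ((cPR (hφ a)).prodMk (cPR (hψ b))))
    have := anti_bound (f := fun r => e * (∫ x, χ R x * (PR G w r x * PR G g r x)) +
      2 * ∑ a, ∑ b, (∫ x, χ R x * B (PR G (φ a) r x) (PR G (ψ b) r x)) - Et / R * (r ^ 2 / 2)) ?_ ?_ hT
    · simp only [PR_zero hG] at this hI1
      have t1 := hI1 R hR
      have t2 : 0 ≤ ∑ a, ∑ b, (∫ x, χ R x * B (PR G (φ a) T x) (PR G (ψ b) T x)) :=
        Finset.sum_nonneg fun a _ => Finset.sum_nonneg fun b _ => hI0 R hR a b T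
      have t3 : |e * ∫ x, χ R x * (PR G w T x * PR G g T x)| = |∫ x, χ R x * (PR G w T x * PR G g T x)| := by
        rw [abs_mul, he, one_mul]
      have t4 := neg_abs_le (e * ∫ x, χ R x * (PR G w T x * PR G g T x))
      rw [t3] at t4
      have t5 : Et / R * ((0:ℝ) ^ 2 / 2) = 0 := by ring
      linarith
    · refine ((hcJ.const_mul e).add (Continuous.const_mul ?_ 2)).sub (by fun_prop)
      exact continuous_finsetSum _ fun a _ => continuous_finsetSum _ fun b _ => hcI a b
    · intro r hr
      obtain ⟨D, hD, hDle⟩ := hE' R hR r hr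
      choose D2 hD2 hD2le using fun a b => hE a b j i R hR r hr
      refine ⟨_, ((hD.const_mul e).add ((HasDerivAt.fun_sum fun a _ => HasDerivAt.fun_sum fun b _ =>
        hD2 a b).const_mul 2)).sub ((((hasDerivAt_id r).pow 2).div_const 2).const_mul (Et / R)), ?_⟩
      have k1 : e * D ≤ |D| := by
        refine (le_abs_self _).trans ?_; rw [abs_mul, he, one_mul]
      have iX : ∀ a b, Integrable fun x => χ R x * (|pd j (PR G (φ a) r) x| * |pd i (PR G (ψ b) r) x|) := fun a b =>
        (c1.cc.mul_right ((cpd hr (hφ a)).abs.mul (cpd hr (hψ b)).abs)).integrable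
      have k2 : ∫ x, χ R x * (|pd j (PR G (lpl F) r) x| * |pd i (PR G g r) x|) ≤
          ∑ a, ∑ b, ∫ x, χ R x * (|pd j (PR G (φ a) r) x| * |pd i (PR G (ψ b) r) x|) := by
        have : ∑ a, ∑ b, ∫ x, χ R x * (|pd j (PR G (φ a) r) x| * |pd i (PR G (ψ b) r) x|) =
            ∫ x, ∑ a, ∑ b, χ R x * (|pd j (PR G (φ a) r) x| * |pd i (PR G (ψ b) r) x|) := by
          rw [integral_finsetSum _ fun a _ => integrable_finsetSum _ fun b _ => iX a b]
          refine Finset.sum_congr rfl fun a _ => ?_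
          rw [integral_finsetSum _ fun b _ => iX a b]
        rw [this]
        refine integral_mono (c1.cc.mul_right ((cpd hr hF.lpl).abs.mul (cpd hr hg).abs)).integrable
          (integrable_finsetSum _ fun a _ => integrable_finsetSum _ fun b _ => iX a b) fun x => ?_
        simp only [← Finset.mul_sum]
        rw [← Finset.sum_mul]
        refine mul_le_mul_of_nonneg_left ?_ (c2 x)
        exact mul_le_mul (PR_split hG hφ hFe hr j x) (PR_split hG hψ hge hr i x) (abs_nonneg _)
          (Finset.sum_nonneg fun a _ => abs_nonneg _)
      have k3 : ∑ a, ∑ b, D2 a b ≤ r * ((∑ a, ∑ b, E a b) / R -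
          ∑ a, ∑ b, ∫ x, χ R x * (|pd j (PR G (φ a) r) x| * |pd i (PR G (ψ b) r) x|)) := by
        refine (Finset.sum_le_sum fun a _ => Finset.sum_le_sum fun b _ => hD2le a b).trans (le_of_eq ?_)
        simp only [← Finset.mul_sum, Finset.sum_sub_distrib, ← Finset.sum_div]
      have k4 : |D| ≤ r * (E' / R + 2 * ∑ a, ∑ b, ∫ x, χ R x * (|pd j (PR G (φ a) r) x| * |pd i (PR G (ψ b) r) x|)) := by
        refine hDle.trans ?_
        gcongr
      have k5 : Et / R = E' / R + 2 * ((∑ a, ∑ b, E a b) / R) := by rw [hEt]; ring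
      simp only [id, Nat.cast_ofNat]
      rw [k5]
      have k6 : ∀ z : ℝ, z * (2 * r ^ (2 - 1) * 1 / 2) = r * z := by intro z; norm_num; ring
      rw [k6]
      generalize (∑ a, ∑ b, ∫ x, χ R x * (|pd j (PR G (φ a) r) x| * |pd i (PR G (ψ b) r) x|)) = X at k3 k4
      generalize (∑ a, ∑ b, E a b) / R = Y at k3 ⊢
      generalize E' / R = Z at k4 ⊢
      linarith
  -- let R go to infinity
  have stepR : ∀ T, 1 ≤ T → |∫ x, w x * g x| ≤ 4 * C * S + D0 / T * (∫ x, |w x|) * (∫ x, |g x|) := by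
    intro T hT
    have hT0 : 0 < T := by linarith
    obtain ⟨R0, hR0⟩ := hg.2.isBounded.subset_closedBall 0
    have hJT : ∀ R, 1 ≤ R → |∫ x, χ R x * (PR G w T x * PR G g T x)| ≤ D0 / T * (∫ x, |w x|) * (∫ x, |g x|) := by
      intro R hR
      have hw0 : 0 ≤ ∫ x, |w x| := integral_nonneg fun x => abs_nonneg _
      have ig := (PR_integrable hG.dec.integrable hg.cc hT0).abs
      rw [← Real.norm_eq_abs]
      refine (norm_integral_le_of_norm_le (ig.const_mul (D0 / T * ∫ x, |w x|)) (Eventually.of_forall fun x => ?_)).trans ?_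
      · rw [Real.norm_eq_abs, abs_mul, abs_mul, abs_of_nonneg ((hχ R hR).2.1 x)]
        calc χ R x * (|PR G w T x| * |PR G g T x|) ≤ 1 * (D0 / T * (∫ x, |w x|) * |PR G g T x|) := by
              gcongr
              · exact (hχ R hR).2.2.1 x
              · exact hdec w hwT.cc T hT x
          _ = _ := one_mul _
      · rw [integral_const_mul]
        have := hG.L1 hg.cc hT0
        gcongr
    have hlim : Tendsto (fun R : ℝ => 4 * C * S + D0 / T * (∫ x, |w x|) * (∫ x, |g x|) + Et / R * (T ^ 2 / 2)) atTop
        (𝓝 (4 * C * S + D0 / T * (∫ x, |w x|) * (∫ x, |g x|))) := by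
      have h1 : Tendsto (fun R : ℝ => Et / R) atTop (𝓝 0) := tendsto_const_nhds.div_atTop tendsto_id
      simpa using tendsto_const_nhds.add (h1.mul_const (T ^ 2 / 2))
    refine ge_of_tendsto hlim ?_
    filter_upwards [eventually_ge_atTop (max 1 R0)] with R hR
    have hR1 : 1 ≤ R := (le_max_left _ _).trans hR
    have e1 : ∫ x, χ R x * (w x * g x) = ∫ x, w x * g x := by
      congr 1; funext x
      by_cases hx : x ∈ tsupport g
      · have := hR0 hx
        rw [mem_closedBall_zero_iff] at this
        rw [(hχ R hR1).2.2.2.1 x (this.trans ((le_max_right _ _).trans hR)), one_mul]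
      · rw [image_eq_zero_of_notMem_tsupport hx]; simp
    have k1 := key R hR1 T hT0.le 1 (by norm_num)
    have k2 := key R hR1 T hT0.le (-1) (by norm_num)
    rw [e1] at k1 k2
    have k3 := hJT R hR1
    rw [abs_le]
    constructor <;> linarith
  have hlim : Tendsto (fun T : ℝ => 4 * C * S + D0 / T * (∫ x, |w x|) * (∫ x, |g x|)) atTop (𝓝 (4 * C * S)) := by
    have h1 : Tendsto (fun R : ℝ => D0 / R) atTop (𝓝 0) := tendsto_const_nhds.div_atTop tendsto_id
    simpa using tendsto_const_nhds.add ((h1.mul_const (∫ x, |w x|)).mul_const (∫ x, |g x|))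
  refine ge_of_tendsto hlim ?_
  filter_upwards [eventually_ge_atTop 1] with T hT using stepR T hT


lemma absp_integrable {n : ℕ} {f : EE n → ℝ} {s : ℝ} (hs : 1 < s) (hf : CC f) :
    Integrable (fun x => |f x| ^ s) := by
  refine Continuous.integrable_of_hasCompactSupport
    (hf.1.abs.rpow_const fun x => Or.inr (by linarith)) ?_
  exact hf.2.comp_left (g := fun t => |t| ^ s) (by simp [Real.zero_rpow (show s ≠ 0 by linarith)])

lemma add_rpow_le' {a b s : ℝ} (ha : 0 ≤ a) (hb : 0 ≤ b) (hs : 0 < s) :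
    (a + b) ^ s ≤ 2 ^ s * (a ^ s + b ^ s) := by
  rcases le_total a b with h | h
  · calc (a + b) ^ s ≤ (2 * b) ^ s := Real.rpow_le_rpow (by positivity) (by linarith) hs.le
      _ = 2 ^ s * b ^ s := Real.mul_rpow (by norm_num) hb
      _ ≤ _ := by gcongr; have := Real.rpow_nonneg ha s; linarith
  · calc (a + b) ^ s ≤ (2 * a) ^ s := Real.rpow_le_rpow (by positivity) (by linarith) hs.le
      _ = 2 ^ s * a ^ s := Real.mul_rpow (by norm_num) ha
      _ ≤ _ := by gcongr; have := Real.rpow_nonneg hb s; linarith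

lemma split_tf {n : ℕ} {f : EE n → ℝ} (hf : TF f) {s : ℝ} (hs : 1 < s) {η : ℝ} (hη : 0 < η) :
    ∃ φ : Fin 2 → EE n → ℝ, (∀ a, TF (φ a)) ∧ (∀ a x, 0 ≤ φ a x) ∧ (∀ a, ∃ x, φ a x ≠ 0) ∧
      (f = fun x => φ 0 x - φ 1 x) ∧
      ∑ a, ∫ x, φ a x ^ s ≤ 2 * 2 ^ s * (∫ x, |f x| ^ s) + η := by
  obtain ⟨χ, K, hK, hχ⟩ := exists_cut n
  obtain ⟨R0, hR0⟩ := hf.2.isBounded.subset_closedBall 0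
  obtain ⟨c1, c2, c3, c4, -, -⟩ := hχ (max 1 R0) (le_max_left _ _)
  set ζ := χ (max 1 R0) with hζ
  have iζ : Integrable (fun x => |ζ x| ^ s) := absp_integrable hs c1.cc
  have hI : 0 ≤ ∫ x, |ζ x| ^ s := integral_nonneg fun x => by positivity
  set Q := 2 * 2 ^ s * (∫ x, |ζ x| ^ s) + 1 with hQ
  have hQ0 : 0 < Q := by positivity
  set ε := (η / Q) ^ (1 / s) with hε
  have hε0 : 0 < ε := by positivity
  have hεs : ε ^ s = η / Q := by
    rw [hε, ← Real.rpow_mul (by positivity), one_div_mul_cancel (by linarith), Real.rpow_one]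
  let sg : Fin 2 → ℝ := ![1, -1]
  have hsg : ∀ a, |sg a| = 1 := by intro a; fin_cases a <;> simp [sg]
  have hlt : ∀ x, |f x| < √(f x ^ 2 + ε ^ 2) := fun x => by
    apply Real.lt_sqrt_of_sq_lt; rw [sq_abs]; nlinarith
  have habs : ∀ a x, |sg a * f x| = |f x| := fun a x => by rw [abs_mul, hsg, one_mul]
  have hpos : ∀ a x, 0 < (√(f x ^ 2 + ε ^ 2) + sg a * f x) / 2 := fun a x => by
    have := hlt x
    have h2 := neg_abs_le (sg a * f x)
    rw [habs] at h2
    linarith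
  have hle : ∀ x, √(f x ^ 2 + ε ^ 2) ≤ |f x| + ε := fun x => by
    rw [Real.sqrt_le_left (by positivity)]
    have := sq_abs (f x)
    nlinarith [abs_nonneg (f x)]
  refine ⟨fun a x => (√(f x ^ 2 + ε ^ 2) + sg a * f x) / 2 * ζ x, fun a => c1.mul_left ?_, fun a x =>
    mul_nonneg (hpos a x).le (c2 x), fun a => ⟨0, ?_⟩, ?_, ?_⟩
  · refine ContDiff.div_const (ContDiff.add (ContDiff.sqrt ((hf.1.pow 2).add contDiff_const) fun x => ?_)
      (contDiff_const.mul hf.1)) _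
    positivity
  · beta_reduce; rw [c4 0 (by simp), mul_one]; exact (hpos a 0).ne'
  · funext x
    by_cases hx : x ∈ tsupport f
    · have := hR0 hx
      rw [mem_closedBall_zero_iff] at this
      beta_reduce
      rw [c4 x (this.trans (le_max_right _ _))]
      simp [sg]; ring
    · beta_reduce; rw [image_eq_zero_of_notMem_tsupport hx]; simp
  · have hone : ∀ a, ∫ x, ((√(f x ^ 2 + ε ^ 2) + sg a * f x) / 2 * ζ x) ^ s ≤
        2 ^ s * (∫ x, |f x| ^ s) + 2 ^ s * ((η / Q) * ∫ x, |ζ x| ^ s) := by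
      intro a
      have i1 := (absp_integrable hs hf.cc).const_mul (2 ^ s)
      have i2 := (iζ.const_mul (η / Q)).const_mul (2 ^ s)
      rw [← integral_const_mul, ← integral_const_mul, ← integral_const_mul, ← integral_add i1 i2]
      refine integral_mono_of_nonneg (Eventually.of_forall fun x => ?_) (i1.add i2) (Eventually.of_forall fun x => ?_)
      · exact Real.rpow_nonneg (mul_nonneg (hpos a x).le (c2 x)) _
      · have h1 : (√(f x ^ 2 + ε ^ 2) + sg a * f x) / 2 * ζ x ≤ |f x| + ε * |ζ x| := by
          have h2 := le_abs_self (sg a * f x)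
          rw [habs] at h2
          have h3 := hle x
          rw [abs_of_nonneg (c2 x)]
          calc _ ≤ (|f x| + ε) * ζ x := by gcongr; exact c2 x; linarith
            _ ≤ _ := by nlinarith [c3 x, c2 x, abs_nonneg (f x)]
        calc _ ≤ (|f x| + ε * |ζ x|) ^ s := Real.rpow_le_rpow (mul_nonneg (hpos a x).le (c2 x)) h1 (by linarith)
          _ ≤ 2 ^ s * (|f x| ^ s + (ε * |ζ x|) ^ s) := add_rpow_le' (abs_nonneg _) (by positivity) (by linarith)
          _ = _ := by rw [Real.mul_rpow hε0.le (abs_nonneg _), hεs]; simp only []; ring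
    rw [Fin.sum_univ_two]
    have h0 := hone 0
    have h1 := hone 1
    have h2 : 2 * (2 ^ s * ((η / Q) * ∫ x, |ζ x| ^ s)) ≤ η := by
      have : 2 * (2 ^ s * ((η / Q) * ∫ x, |ζ x| ^ s)) = η * ((2 * 2 ^ s * ∫ x, |ζ x| ^ s) / Q) := by ring
      rw [this]
      apply mul_le_of_le_one_right hη.le
      rw [div_le_one hQ0, hQ]; linarith
    linarith

lemma bilinear2 {n : ℕ} (hn : 1 ≤ n) {p q : ℝ} (hp : 1 < p) (hpq : (p-1)*(q-1) = 1) :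
    ∃ C, 0 < C ∧ ∀ F g : EE n → ℝ, TF F → TF g → ∀ i j : Fin n,
      |∫ x, pd i (pd j F) x * g x| ≤ C * ((∫ x, |lpl F x| ^ p) + ∫ x, |g x| ^ q) := by
  have hq : 1 < q := by nlinarith
  obtain ⟨C, hC, hb⟩ := bilinear hn hp hpq
  refine ⟨C * (2 * 2 ^ p + 2 * 2 ^ q), by positivity, fun F g hF hg i j => ?_⟩
  have i1 : 0 ≤ ∫ x, |lpl F x| ^ p := integral_nonneg fun x => by positivity
  have i2 : 0 ≤ ∫ x, |g x| ^ q := integral_nonneg fun x => by positivity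
  apply le_of_forall_pos_le_add
  intro η hη
  obtain ⟨φ, f1, f2, f3, f4, f5⟩ := split_tf hF.lpl hp (η := η / (2 * C)) (by positivity)
  obtain ⟨ψ, g1, g2, g3, g4, g5⟩ := split_tf hg hq (η := η / (2 * C)) (by positivity)
  refine (hb F g hF hg φ ψ f1 g1 f2 g2 f3 g3 f4 g4 i j).trans ?_
  calc _ ≤ C * ((2 * 2 ^ p * (∫ x, |lpl F x| ^ p) + η / (2 * C)) + (2 * 2 ^ q * (∫ x, |g x| ^ q) + η / (2 * C))) := by
        gcongr
    _ = C * (2 * 2 ^ p * (∫ x, |lpl F x| ^ p) + 2 * 2 ^ q * (∫ x, |g x| ^ q)) + η := by field_simp; ring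
    _ ≤ _ := by
        have a1 : (0:ℝ) ≤ 2 * 2 ^ p := by positivity
        have a2 : (0:ℝ) ≤ 2 * 2 ^ q := by positivity
        rw [mul_assoc C]
        gcongr
        nlinarith [mul_nonneg a1 i2, mul_nonneg a2 i1]

lemma cz_dual {n : ℕ} {p q : ℝ} (hp : 1 < p) (hpq : (p-1)*(q-1) = 1) {w : EE n → ℝ} (hw : TF w) {A C : ℝ}
    (H : ∀ g, TF g → |∫ x, w x * g x| ≤ C * (A + ∫ x, |g x| ^ q)) {l : ℝ} (hl : 0 < l) :
    l * (∫ x, |w x| ^ p) ≤ C * (A + l ^ q * ∫ x, |w x| ^ p) := by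
  have hq : 1 < q := by nlinarith
  obtain ⟨N, hN0, hN⟩ := hw.cc.bounded
  let e : ℕ → ℝ := fun k => 1 / ((k:ℝ) + 1)
  have he0 : ∀ k, 0 < e k := fun k => by positivity
  have he1 : ∀ k, e k ≤ 1 := fun k => by
    rw [div_le_one (by positivity)]; have : (0:ℝ) ≤ k := Nat.cast_nonneg k; linarith
  have het : Tendsto e atTop (𝓝 0) := tendsto_one_div_add_atTop_nhds_zero_nat
  let g : ℕ → EE n → ℝ := fun k x => (w x ^ 2 + e k) ^ ((p-2)/2) * w x
  have hb0 : ∀ k x, 0 < w x ^ 2 + e k := fun k x => by have := he0 k; positivity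
  have hg : ∀ k, TF (g k) := fun k => hw.mul_left
    (((hw.1.pow 2).add contDiff_const).rpow_const_of_ne fun x => (hb0 k x).ne')
  set M := (N ^ 2 + 1) ^ ((p-1)/2) with hM
  have hM0 : 0 ≤ M := by positivity
  have hgM : ∀ k x, |g k x| ≤ M := fun k x => by
    have h1 : |w x| ≤ (w x ^ 2 + e k) ^ ((1:ℝ)/2) := by
      rw [← Real.sqrt_eq_rpow]; apply Real.le_sqrt_of_sq_le; rw [sq_abs]; linarith [he0 k]
    calc |g k x| = (w x ^ 2 + e k) ^ ((p-2)/2) * |w x| := by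
          rw [abs_mul, abs_of_pos (Real.rpow_pos_of_pos (hb0 k x) _)]
      _ ≤ (w x ^ 2 + e k) ^ ((p-2)/2) * (w x ^ 2 + e k) ^ ((1:ℝ)/2) := by
          gcongr
      _ = (w x ^ 2 + e k) ^ ((p-1)/2) := by rw [← Real.rpow_add (hb0 k x)]; ring_nf
      _ ≤ M := by
          apply Real.rpow_le_rpow (hb0 k x).le _ (by linarith)
          have := hN x
          have h3 : w x ^ 2 ≤ N ^ 2 := by rw [← sq_abs]; gcongr
          linarith [he1 k]
  have hgl : ∀ x, Tendsto (fun k => g k x) atTop (𝓝 ((w x ^ 2) ^ ((p-2)/2) * w x)) := fun x => by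
    by_cases hx : w x = 0
    · simp [g, hx]
    · have : Tendsto (fun k => w x ^ 2 + e k) atTop (𝓝 (w x ^ 2)) := by
        simpa using tendsto_const_nhds.add het
      exact (this.rpow_const (Or.inl (by positivity))).mul_const _
  have hlim1 : ∀ x, w x * ((w x ^ 2) ^ ((p-2)/2) * w x) = |w x| ^ p := fun x => by
    by_cases hx : w x = 0
    · simp [hx, Real.zero_rpow (show p ≠ 0 by linarith)]
    · have h0 : 0 < |w x| := abs_pos.mpr hx
      have : w x * ((w x ^ 2) ^ ((p-2)/2) * w x) = (|w x| ^ 2) ^ ((p-2)/2) * |w x| ^ 2 := by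
        rw [sq_abs]; ring
      rw [this, ← Real.rpow_natCast, ← Real.rpow_mul h0.le, ← Real.rpow_add h0]
      congr 1; push_cast; ring
  have hlim2 : ∀ x, |(w x ^ 2) ^ ((p-2)/2) * w x| ^ q = |w x| ^ p := fun x => by
    by_cases hx : w x = 0
    · simp [hx, Real.zero_rpow (show p ≠ 0 by linarith), Real.zero_rpow (show q ≠ 0 by linarith)]
    · have h0 : 0 < |w x| := abs_pos.mpr hx
      have : |(w x ^ 2) ^ ((p-2)/2) * w x| = |w x| ^ (p-1) := by
        rw [abs_mul, abs_of_nonneg (by positivity), ← sq_abs, ← Real.rpow_natCast, ← Real.rpow_mul h0.le,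
          ← Real.rpow_add_one h0.ne']
        congr 1; push_cast; ring
      rw [this, ← Real.rpow_mul h0.le]
      congr 1; linarith
  have hK : volume (tsupport w) ≠ ⊤ := hw.2.isCompact.measure_lt_top.ne
  have hmK : MeasurableSet (tsupport w) := (isClosed_tsupport w).measurableSet
  have hout : ∀ x, x ∉ tsupport w → w x = 0 := fun x hx => image_eq_zero_of_notMem_tsupport hx
  have iC : ∀ c : ℝ, Integrable ((tsupport w).indicator fun _ => c) := fun c =>
    (integrable_indicator_iff hmK).mpr (integrableOn_const hK)
  have L1 : Tendsto (fun k => ∫ x, w x * g k x) atTop (𝓝 (∫ x, |w x| ^ p)) := by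
    refine tendsto_integral_of_dominated_convergence ((tsupport w).indicator fun _ => N * M)
      (fun k => (hw.1.continuous.mul (hg k).1.continuous).aestronglyMeasurable) (iC _) (fun k => ?_) ?_
    · refine Eventually.of_forall fun x => ?_
      by_cases hx : x ∈ tsupport w
      · rw [indicator_of_mem hx, Real.norm_eq_abs, abs_mul]
        exact mul_le_mul (hN x) (hgM k x) (abs_nonneg _) hN0.le
      · rw [indicator_of_notMem hx, hout x hx]; simp
    · refine Eventually.of_forall fun x => ?_
      rw [← hlim1 x]
      exact (hgl x).const_mul _
  have L2 : Tendsto (fun k => ∫ x, |g k x| ^ q) atTop (𝓝 (∫ x, |w x| ^ p)) := by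
    refine tendsto_integral_of_dominated_convergence ((tsupport w).indicator fun _ => M ^ q)
      (fun k => (absp_integrable hq (hg k).cc).1) (iC _) (fun k => ?_) ?_
    · refine Eventually.of_forall fun x => ?_
      by_cases hx : x ∈ tsupport w
      · rw [indicator_of_mem hx, Real.norm_eq_abs, abs_of_nonneg (by positivity)]
        exact Real.rpow_le_rpow (abs_nonneg _) (hgM k x) (by linarith)
      · rw [indicator_of_notMem hx]; simp [g, hout x hx, Real.zero_rpow (show q ≠ 0 by linarith)]
    · refine Eventually.of_forall fun x => ?_
      rw [← hlim2 x]
      exact (hgl x).abs.rpow_const (Or.inr (by linarith))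
  refine le_of_tendsto_of_tendsto (L1.const_mul l) (((L2.const_mul (l ^ q)).const_add A).const_mul C)
    (Eventually.of_forall fun k => ?_)
  have := H (fun x => l * g k x) ((hg k).mul_left contDiff_const)
  have e1 : ∫ x, w x * (l * g k x) = l * ∫ x, w x * g k x := by
    rw [← integral_const_mul]; congr 1; funext x; ring
  have e2 : ∫ x, |l * g k x| ^ q = l ^ q * ∫ x, |g k x| ^ q := by
    rw [← integral_const_mul]; congr 1; funext x
    rw [abs_mul, abs_of_pos hl, Real.mul_rpow hl.le (abs_nonneg _)]
  rw [e1, e2] at this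
  exact (le_abs_self _).trans this

theorem cz {n : ℕ} (hn : 1 ≤ n) {p : ℝ} (hp : 1 < p) :
    ∃ C, 0 < C ∧ ∀ F : EE n → ℝ, TF F → ∀ i j : Fin n, NN p 0 (pd i (pd j F)) ≤ C * NN p 0 (lpl F) := by
  set q := 1 / (p-1) + 1 with hqd
  have hp1 : 0 < p - 1 := by linarith
  have hpq : (p-1) * (q-1) = 1 := by rw [hqd]; field_simp; ring
  have hq : 1 < q := by nlinarith
  obtain ⟨C, hC, hb⟩ := bilinear2 hn hp hpq
  set l := (1 / (2 * C)) ^ (1 / (q-1)) with hl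
  have hl0 : 0 < l := by positivity
  have hlq : l ^ q = l * (1 / (2 * C)) := by
    have : l ^ (q-1) = 1 / (2 * C) := by
      rw [hl, ← Real.rpow_mul (by positivity), one_div_mul_cancel (by linarith), Real.rpow_one]
    rw [← this, mul_comm, ← Real.rpow_add_one hl0.ne']; congr 1; ring
  refine ⟨(2 * C / l) ^ (1/p), by positivity, fun F hF i j => ?_⟩
  have := cz_dual hp hpq ((hF.pd j).pd i) (fun g hg => hb F g hF hg i j) hl0
  unfold NN
  simp only [wt_zero, one_mul]
  have i1 : 0 ≤ ∫ x, |lpl F x| ^ p := integral_nonneg fun x => by positivity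
  have i2 : 0 ≤ ∫ x, |pd i (pd j F) x| ^ p := integral_nonneg fun x => by positivity
  rw [← Real.mul_rpow (by positivity) i1]
  refine Real.rpow_le_rpow i2 ?_ (by positivity)
  rw [hlq] at this
  have e : C * ((∫ x, |lpl F x| ^ p) + l * (1 / (2 * C)) * ∫ x, |pd i (pd j F) x| ^ p) =
    C * (∫ x, |lpl F x| ^ p) + l / 2 * ∫ x, |pd i (pd j F) x| ^ p := by field_simp
  rw [e] at this
  rw [div_mul_eq_mul_div, le_div_iff₀ hl0]
  linarith


/-! ## The weighted second order estimate -/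

lemma abs_pd_wt {n : ℕ} (s : ℝ) (k : Fin n) (x : EE n) : |pd k (wt s) x| ≤ |s| * wt (s-1) x := by
  rw [pd_wt, abs_mul, abs_mul, abs_of_pos (wt_pos _ _)]
  have : wt (s-1) x = wt 1 x * wt (s-2) x := by rw [← wt_add]; ring_nf
  rw [this]
  have h1 := abs_apply_le_wt x k
  have := wt_pos (s-2) x
  gcongr

lemma abs_pd2_wt {n : ℕ} (s : ℝ) (i j : Fin n) (x : EE n) :
    |pd i (pd j (wt s)) x| ≤ |s| * (1 + |s-2|) * wt (s-2) x := by
  have e : pd j (wt s : EE n → ℝ) = fun x => s * (x j * wt (s-2) x) := by funext x; exact pd_wt s j x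
  have hd : Differentiable ℝ (fun x : EE n => x j * wt (s-2) x) :=
    ((contDiff_coord j).mul (contDiff_wt (s-2))).dfb
  rw [e, pd_const_mul hd]
  beta_reduce
  rw [pd_mul (contDiff_coord j).dfb (contDiff_wt (s-2)).dfb, abs_mul, mul_assoc]
  apply mul_le_mul_of_nonneg_left _ (abs_nonneg _)
  have h1 : |pd i (fun y : EE n => y j) x| ≤ 1 := by
    rw [pd_coord2]; split_ifs <;> simp
  have h2 := abs_pd_wt (s-2) i x
  have h3 := abs_apply_le_wt x j
  have hw := wt_pos (s-2) x
  have hw1 := wt_pos (s-2-1) x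
  have hw2 := wt_pos 1 x
  refine (abs_add_le _ _).trans ?_
  rw [abs_mul, abs_mul, abs_of_pos hw]
  calc _ ≤ wt 1 x * (|s-2| * wt (s-2-1) x) + 1 * wt (s-2) x := by gcongr
    _ = |s-2| * (wt 1 x * wt (s-2-1) x) + wt (s-2) x := by ring
    _ = |s-2| * wt (s-2) x + wt (s-2) x := by rw [← wt_add]; ring_nf
    _ = _ := by ring

lemma two_weight {n : ℕ} (hn : 2 ≤ n) {p σ s : ℝ} (hp : 1 < p) (hσ0 : 0 < σ) (hσ1 : σ < 1)
    (hs : s = n - n/p + σ) : ∃ C, 0 < C ∧ ∀ u : EE n → ℝ, TF u → ∀ i j : Fin n,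
      NN p s (pd i (pd j u)) ≤ C * NN p s (lpl u) := by
  obtain ⟨A, hA, hcz⟩ := cz (n := n) (by omega) hp
  obtain ⟨G, hG, hgr⟩ := grad_bound hn hp hσ0 hσ1 hs
  have hn2 : (2:ℝ) ≤ n := by exact_mod_cast hn
  obtain ⟨H, hH, hha⟩ := hardy (n := n) (a := s - 2) (by omega) hp (by
    have : (s - 2) * p + n = (n - 2) * p + σ * p := by rw [hs]; field_simp; ring
    rw [this]
    have : 0 ≤ ((n:ℝ) - 2) * p := by apply mul_nonneg <;> linarith
    have : 0 < σ * p := by positivity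
    linarith)
  set K := |s| * (1 + |s-2|) with hK
  have hK0 : 0 ≤ K := by positivity
  set L := (A + 1) * (2 * |s| * (n * G) + n * K * (H * (n * G))) with hL
  refine ⟨A + L, by positivity, fun u hu i j => ?_⟩
  set v : EE n → ℝ := fun x => wt s x * u x with hv
  have hvT : TF v := hu.mul_left (contDiff_wt s)
  set Y := NN p s (lpl u) with hY
  have hY0 : 0 ≤ Y := NN_nonneg _ _ _
  have g1 : ∑ k, NN p (s-1) (pd k u) ≤ n * G * Y := by
    refine (Finset.sum_le_sum fun k _ => hgr u hu k).trans (le_of_eq ?_)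
    rw [Finset.sum_const, Finset.card_univ, Fintype.card_fin, nsmul_eq_mul]; ring
  have g2 : NN p (s-2) u ≤ H * (n * G * Y) := by
    have := hha u hu
    rw [show s - 2 + 1 = s - 1 by ring] at this
    exact this.trans (by gcongr)
  have hdu := hu.differentiable
  have hdw := (contDiff_wt (n := n) s).dfb
  have p1 : ∀ x, pd i (pd j v) x = wt s x * pd i (pd j u) x + pd i (wt s) x * pd j u x +
      (pd j (wt s) x * pd i u x + pd i (pd j (wt s)) x * u x) := by
    intro x
    have e1 : pd j v = fun x => wt s x * pd j u x + pd j (wt s) x * u x := by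
      funext y; exact pd_mul hdw hdu j y
    rw [e1, pd_add (((contDiff_wt s).mul (contDiff_pd j hu.1)).dfb)
      (((contDiff_pd j (contDiff_wt s)).mul hu.1).dfb), pd_mul hdw (hu.pd j).differentiable,
      pd_mul (contDiff_pd j (contDiff_wt s)).dfb hdu]
  have b0 := fun x : EE n => wt_pos s x
  have sgl : ∀ (k : Fin n) x, wt (s-1) x * |pd k u x| ≤ ∑ k, wt (s-1) x * |pd k u x| := fun k x =>
    Finset.single_le_sum (f := fun k => wt (s-1) x * |pd k u x|)
      (fun k _ => mul_nonneg (wt_pos _ _).le (abs_nonneg _)) (Finset.mem_univ k)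
  have ab : ∀ k l x, |pd k (wt s) x * pd l u x| ≤ |s| * (wt (s-1) x * |pd l u x|) := fun k l x => by
    rw [abs_mul, ← mul_assoc]; gcongr; exact abs_pd_wt s k x
  have ab2 : ∀ k l x, |pd k (pd l (wt s)) x * u x| ≤ K * (wt (s-2) x * |u x|) := fun k l x => by
    rw [abs_mul, ← mul_assoc]; gcongr; exact abs_pd2_wt s k l x
  have e1 : NN p s (pd i (pd j u)) ≤ NN p 0 (pd i (pd j v)) + (2 * |s| * (∑ k, NN p (s-1) (pd k u)) + n * K * NN p (s-2) u) := by
    have := NN_le_sum hp (s := s) (f := pd i (pd j u)) (S := (Finset.univ : Finset (Option (Option (Fin n)))))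
      (t := fun o => o.elim 0 fun o => o.elim (s-2) fun _ => s-1)
      (g := fun o => o.elim (pd i (pd j v)) fun o => o.elim u fun k => pd k u)
      (c := fun o => o.elim 1 fun o => o.elim (n * K) fun _ => 2 * |s|) ?_ ((hu.pd j).pd i).cc ?_ ?_
    · simp only [Fintype.sum_option, Option.elim, ← Finset.mul_sum] at this
      linarith
    · rintro (_ | _ | k) _ <;> simp only [Option.elim] <;> positivity
    · rintro (_ | _ | k) _ <;> simp only [Option.elim]
      exacts [((hvT.pd j).pd i).cc, hu.cc, (hu.pd k).cc]
    · intro x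
      simp only [Fintype.sum_option, Option.elim, ← Finset.mul_sum, wt_zero]
      have t0 : wt s x * |pd i (pd j u) x| = |wt s x * pd i (pd j u) x| := by rw [abs_mul, abs_of_pos (b0 x)]
      have t1 : wt s x * pd i (pd j u) x = pd i (pd j v) x + -(pd i (wt s) x * pd j u x) +
        (-(pd j (wt s) x * pd i u x) + -(pd i (pd j (wt s)) x * u x)) := by rw [p1]; ring
      rw [t0, t1]
      refine (abs_add_le _ _).trans ?_
      have a1 := abs_add_le (pd i (pd j v) x) (-(pd i (wt s) x * pd j u x))
      have a2 := abs_add_le (-(pd j (wt s) x * pd i u x)) (-(pd i (pd j (wt s)) x * u x))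
      simp only [abs_neg] at a1 a2
      have a3 := ab i j x
      have a4 := ab j i x
      have a5 := ab2 i j x
      have a6 := mul_le_mul_of_nonneg_left (sgl i x) (abs_nonneg s)
      have a7 := mul_le_mul_of_nonneg_left (sgl j x) (abs_nonneg s)
      have a8 : K * (wt (s-2) x * |u x|) ≤ n * K * (wt (s-2) x * |u x|) := by
        have : 0 ≤ K * (wt (s-2) x * |u x|) := mul_nonneg hK0 (mul_nonneg (wt_pos _ _).le (abs_nonneg _))
        rw [mul_assoc]; nlinarith
      simp only [← Finset.mul_sum] at *
      linarith
  have e2 : NN p 0 (lpl v) ≤ Y + (2 * |s| * (∑ k, NN p (s-1) (pd k u)) + n * K * NN p (s-2) u) := by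
    have := NN_le_sum hp (s := 0) (f := lpl v) (S := (Finset.univ : Finset (Option (Option (Fin n)))))
      (t := fun o => o.elim s fun o => o.elim (s-2) fun _ => s-1)
      (g := fun o => o.elim (lpl u) fun o => o.elim u fun k => pd k u)
      (c := fun o => o.elim 1 fun o => o.elim (n * K) fun _ => 2 * |s|) ?_ hvT.lpl.cc ?_ ?_
    · simp only [Fintype.sum_option, Option.elim, ← Finset.mul_sum] at this
      linarith
    · rintro (_ | _ | k) _ <;> simp only [Option.elim] <;> positivity
    · rintro (_ | _ | k) _ <;> simp only [Option.elim]
      exacts [hu.lpl.cc, hu.cc, (hu.pd k).cc]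
    · intro x
      simp only [Fintype.sum_option, Option.elim, wt_zero, one_mul]
      rw [hv, lpl_mul (contDiff_wt s) hu.1]
      have t0 : wt s x * |lpl u x| = |wt s x * lpl u x| := by rw [abs_mul, abs_of_pos (b0 x)]
      have t1 : |u x * lpl (wt s) x| ≤ n * K * (wt (s-2) x * |u x|) := by
        have : u x * lpl (wt s) x = ∑ k, pd k (pd k (wt s)) x * u x := by
          rw [← Finset.sum_mul, mul_comm]; rfl
        rw [this]
        refine (Finset.abs_sum_le_sum_abs _ _).trans ((Finset.sum_le_sum fun k _ => ab2 k k x).trans (le_of_eq ?_))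
        rw [Finset.sum_const, Finset.card_univ, Fintype.card_fin, nsmul_eq_mul]; ring
      have t2 : |2 * ∑ k, pd k (wt s) x * pd k u x| ≤ ∑ k, 2 * |s| * (wt (s-1) x * |pd k u x|) := by
        rw [abs_mul, abs_two]
        rw [← Finset.mul_sum, mul_assoc]
        gcongr
        rw [Finset.mul_sum]
        exact (Finset.abs_sum_le_sum_abs _ _).trans (Finset.sum_le_sum fun k _ => ab k k x)
      have a1 := abs_add_le (wt s x * lpl u x + u x * lpl (wt s) x) (2 * ∑ k, pd k (wt s) x * pd k u x)
      have a2 := abs_add_le (wt s x * lpl u x) (u x * lpl (wt s) x)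
      rw [t0]
      linarith
  have e3 := hcz v hvT i j
  set Z := 2 * |s| * (∑ k, NN p (s-1) (pd k u)) + n * K * NN p (s-2) u with hZ
  have hZle : Z ≤ (2 * |s| * (n * G) + n * K * (H * (n * G))) * Y := by
    calc Z ≤ 2 * |s| * (n * G * Y) + n * K * (H * (n * G * Y)) := by rw [hZ]; gcongr
      _ = _ := by ring
  calc NN p s (pd i (pd j u)) ≤ A * NN p 0 (lpl v) + Z := by linarith
    _ ≤ A * (Y + Z) + Z := by gcongr
    _ = A * Y + (A + 1) * Z := by ring
    _ ≤ A * Y + (A + 1) * ((2 * |s| * (n * G) + n * K * (H * (n * G))) * Y) := by gcongr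
    _ = _ := by rw [hL]; ring


/-! ## Higher derivatives -/

/-- iterated partial derivatives along a list of indices -/
def pds {n : ℕ} : List (Fin n) → (EE n → ℝ) → EE n → ℝ
  | [], f => f
  | i :: l, f => pd i (pds l f)

lemma TF.pds {n : ℕ} {f : EE n → ℝ} (hf : TF f) : ∀ l : List (Fin n), TF (pds l f)
  | [] => hf
  | i :: l => (TF.pds hf l).pd i

lemma lpl_pds {n : ℕ} {f : EE n → ℝ} (hf : TF f) : ∀ l : List (Fin n), lpl (pds l f) = pds l (lpl f)
  | [] => rfl
  | i :: l => by rw [pds, pds, lpl_pd (hf.pds l), lpl_pds hf l]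

lemma TF.lpl_iter {n : ℕ} {f : EE n → ℝ} (hf : TF f) (k : ℕ) : TF (_root_.lpl^[k] f) := by
  induction k generalizing f with
  | zero => exact hf
  | succ k ih => rw [Function.iterate_succ_apply]; exact ih hf.lpl

lemma top_lists {n : ℕ} (hn : 2 ≤ n) {p σ s : ℝ} (hp : 1 < p) (hσ0 : 0 < σ) (hσ1 : σ < 1)
    (hs : s = n - n/p + σ) (k : ℕ) : ∃ C, 0 < C ∧ ∀ f : EE n → ℝ, TF f → ∀ l : List (Fin n), l.length = 2 * k →
      NN p s (pds l f) ≤ C * NN p s (lpl^[k] f) := by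
  obtain ⟨A, hA, h2⟩ := two_weight hn hp hσ0 hσ1 hs
  induction k with
  | zero =>
    refine ⟨1, one_pos, fun f hf l hl => ?_⟩
    have : l = [] := List.eq_nil_of_length_eq_zero (by simpa using hl)
    rw [this]; simp [pds]
  | succ k ih =>
    obtain ⟨C, hC, ih⟩ := ih
    refine ⟨A * C, by positivity, fun f hf l hl => ?_⟩
    match l, hl with
    | [], hl => simp at hl
    | [_], hl => simp at hl; omega
    | i :: j :: l, hl =>
      have hl' : l.length = 2 * k := by simp at hl; omega
      rw [pds, pds, Function.iterate_succ_apply]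
      refine (h2 _ (hf.pds l) i j).trans ?_
      rw [lpl_pds hf l, mul_assoc]
      gcongr
      exact ih _ hf.lpl l hl'

lemma all_lists {n m : ℕ} (hn : 2 ≤ n) {p σ s : ℝ} (hp : 1 < p) (hσ0 : 0 < σ) (hσ1 : σ < 1)
    (hs : s = n - n/p + σ) (hm : n = 2 * m) (d : ℕ) (hd : d ≤ n) :
    ∃ C, 0 < C ∧ ∀ f : EE n → ℝ, TF f → ∀ l : List (Fin n), l.length + d = n →
      NN p (s - d) (pds l f) ≤ C * NN p s (lpl^[m] f) := by
  induction d with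
  | zero =>
    obtain ⟨C, hC, h⟩ := top_lists hn hp hσ0 hσ1 hs m
    refine ⟨C, hC, fun f hf l hl => ?_⟩
    simp only [Nat.cast_zero, sub_zero]
    exact h f hf l (by omega)
  | succ d ih =>
    obtain ⟨C, hC, ih⟩ := ih (by omega)
    have hdn : (d:ℝ) + 1 ≤ n := by exact_mod_cast hd
    obtain ⟨H, hH, hha⟩ := hardy (n := n) (a := s - (d + 1 : ℕ)) (by omega) hp (by
      push_cast
      have : (s - (d + 1)) * p + n = (n - (d + 1)) * p + σ * p := by rw [hs]; field_simp; ring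
      rw [this]
      have : 0 ≤ ((n:ℝ) - (d + 1)) * p := by apply mul_nonneg <;> linarith
      have : 0 < σ * p := by positivity
      linarith)
    refine ⟨H * (n * C), by positivity, fun f hf l hl => ?_⟩
    refine (hha _ (hf.pds l)).trans ?_
    rw [mul_assoc]
    gcongr
    have e : s - (d + 1 : ℕ) + 1 = s - d := by push_cast; ring
    rw [e]
    refine (Finset.sum_le_sum (g := fun _ => C * NN p s (lpl^[m] f)) fun i _ => ?_).trans (le_of_eq ?_)
    · exact ih f hf (i :: l) (by simp; omega)
    · rw [Finset.sum_const, Finset.card_univ, Fintype.card_fin, nsmul_eq_mul]; ring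

lemma NN_lpl_iter {n : ℕ} {p s : ℝ} (hp : 1 < p) (k : ℕ) : ∀ (f : EE n → ℝ), TF f → ∀ B : ℝ,
    (∀ l : List (Fin n), l.length = 2 * k → NN p s (pds l f) ≤ B) → NN p s (lpl^[k] f) ≤ n ^ k * B := by
  induction k with
  | zero => intro f hf B h; simpa [pds] using h [] rfl
  | succ k ih =>
    intro f hf B h
    rw [Function.iterate_succ_apply, pow_succ, mul_assoc]
    refine ih _ hf.lpl _ fun l hl => ?_
    rw [← lpl_pds hf]
    have := NN_le_sum hp (s := s) (f := lpl (pds l f)) (S := Finset.univ) (t := fun _ => s)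
      (g := fun i => pds (i :: i :: l) f) (c := fun _ => 1) (fun _ _ => zero_le_one) (hf.pds l).lpl.cc
      (fun i _ => (hf.pds _).cc) (fun x => by
        simp only [one_mul]
        rw [← Finset.mul_sum]
        apply mul_le_mul_of_nonneg_left _ (wt_pos _ _).le
        exact Finset.abs_sum_le_sum_abs _ _)
    refine this.trans ?_
    refine (Finset.sum_le_sum (g := fun _ => B) fun i _ => ?_).trans (le_of_eq ?_)
    · rw [one_mul]; exact h _ (by simp; omega)
    · rw [Finset.sum_const, Finset.card_univ, Fintype.card_fin, nsmul_eq_mul]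

lemma iter_pds {n : ℕ} {f : EE n → ℝ} (hf : ContDiff ℝ (⊤ : ℕ∞) f) (j : ℕ) : ∀ (I : Fin j → Fin n) (x : EE n),
    iteratedFDeriv ℝ j f x (fun a => bv (I a)) = pds (List.ofFn I) f x := by
  induction j with
  | zero => intro I x; simp [pds]
  | succ j ih =>
    intro I x
    rw [List.ofFn_succ, pds, iteratedFDeriv_succ_apply_left]
    have hd : DifferentiableAt ℝ (iteratedFDeriv ℝ j f) x :=
      (hf.differentiable_iteratedFDeriv (by exact_mod_cast ENat.natCast_lt_top j)) x
    have e : pds (List.ofFn fun i : Fin j => I i.succ) f =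
        fun y => iteratedFDeriv ℝ j f y (fun a => bv (I a.succ)) := by
      funext y; rw [ih]
    rw [e, pd, fderiv_continuousMultilinear_apply_const hd]
    rfl

lemma norm_iter_le {n : ℕ} {f : EE n → ℝ} (hf : ContDiff ℝ (⊤ : ℕ∞) f) (j : ℕ) (x : EE n) :
    ‖iteratedFDeriv ℝ j f x‖ ≤ ∑ I : Fin j → Fin n, |pds (List.ofFn I) f x| := by
  refine ContinuousMultilinearMap.opNorm_le_bound (Finset.sum_nonneg fun _ _ => abs_nonneg _) fun v => ?_
  have hv : v = fun a => ∑ k, v a k • bv k := by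
    funext a
    ext k
    simp [bv, Finset.sum_apply, Pi.single_apply]
  have e : iteratedFDeriv ℝ j f x v = ∑ I : Fin j → Fin n, (∏ a, v a (I a)) * pds (List.ofFn I) f x := by
    conv_lhs => rw [hv]
    rw [ContinuousMultilinearMap.map_sum]
    refine Finset.sum_congr rfl fun I _ => ?_
    rw [ContinuousMultilinearMap.map_smul_univ, iter_pds hf, smul_eq_mul]
  rw [e, Finset.sum_mul]
  refine (norm_sum_le _ _).trans (Finset.sum_le_sum fun I _ => ?_)
  rw [norm_mul, Real.norm_eq_abs, Real.norm_eq_abs, mul_comm, Finset.abs_prod]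
  gcongr with a
  exact PiLp.norm_apply_le (v a) (I a)

lemma pds_le_norm {n : ℕ} {f : EE n → ℝ} (hf : ContDiff ℝ (⊤ : ℕ∞) f) (l : List (Fin n)) {j : ℕ} (hl : l.length = j)
    (x : EE n) : |pds l f x| ≤ ‖iteratedFDeriv ℝ j f x‖ := by
  subst hl
  have := iter_pds hf l.length l.get x
  rw [List.ofFn_get] at this
  rw [← this]
  refine ((iteratedFDeriv ℝ l.length f x).le_opNorm _).trans ?_
  simp [norm_bv]

lemma iter_cc {n : ℕ} {f : EE n → ℝ} (hf : TF f) (j : ℕ) : CC (fun x => ‖iteratedFDeriv ℝ j f x‖) := by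
  refine ⟨(hf.1.continuous_iteratedFDeriv (by exact_mod_cast le_top)).norm, ?_⟩
  exact (hf.2.iteratedFDeriv j).comp_left norm_zero

lemma negLapPow_eq {m : ℕ} {f : Euc m → ℝ} (hf : TF (n := 2*m) f) (k : ℕ) :
    negLapPow k f = fun x => (-1) ^ k * (lpl (n := 2*m))^[k] f x := by
  induction k with
  | zero => funext x; simp [negLapPow]
  | succ k ih =>
    have : negLapPow (k+1) f = fun x => -(lap (negLapPow k f) x) := by
      unfold negLapPow; rw [Function.iterate_succ_apply']
    rw [this, ih]
    funext x
    have h1 : lap (m := m) = lpl (n := 2*m) := rfl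
    rw [h1, lpl_const_mul (hf.lpl_iter k).1, Function.iterate_succ_apply']
    ring

lemma part_norm (m : ℕ) (hm : 1 ≤ m) (p : ℝ) (hp : 1 < p)
    (δ : ℝ) (hδ : δ ∈ Set.Ioo (-(2*m : ℝ)/p) (-(2*m : ℝ)/p + 1)) :
    ∃ C : ℝ, 0 < C ∧
      (∀ f : Euc m → ℝ, ContDiff ℝ (⊤ : ℕ∞) f → HasCompactSupport f →
        Mnorm m (2*m) p δ f ≤ C * wLp m p (2*m + δ) (negLapPow m f) ∧
        wLp m p (2*m + δ) (negLapPow m f) ≤ C * Mnorm m (2*m) p δ f) := by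
  obtain ⟨hδ0, hδ1⟩ := hδ
  set s := (2*m:ℝ) + δ with hsd
  set σ := δ + (2*m:ℝ)/p with hσ
  have hs : s = ((2*m:ℕ):ℝ) - ((2*m:ℕ):ℝ)/p + σ := by rw [hsd, hσ]; push_cast; ring
  rw [neg_div] at hδ0 hδ1
  choose C hC hall using fun d : {d // d ≤ 2*m} =>
    all_lists (n := 2*m) (m := m) (by omega) hp (σ := σ) (s := s) (by linarith) (by linarith) hs rfl d.1 d.2
  let C' : ℕ → ℝ := fun d => if h : d ≤ 2*m then C ⟨d, h⟩ else 1
  have hC' : ∀ d, 0 < C' d := fun d => by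
    simp only [C']; split_ifs; exacts [hC _, one_pos]
  have hall' : ∀ d ≤ 2*m, ∀ f : EE (2*m) → ℝ, TF f → ∀ l : List (Fin (2*m)), l.length + d = 2*m →
      NN p (s - d) (pds l f) ≤ C' d * NN p s (lpl^[m] f) := fun d hd f hf l hl => by
    simp only [C', dif_pos hd]; exact hall ⟨d, hd⟩ f hf l hl
  set A := ∑ j ∈ Finset.range (2*m+1), ∑ I : Fin j → Fin (2*m), C' (2*m - j) with hA
  have hA0 : 0 ≤ A := Finset.sum_nonneg fun j _ => Finset.sum_nonneg fun I _ => (hC' _).le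
  have hB0 : (0:ℝ) ≤ ((2*m:ℕ):ℝ) ^ m := by positivity
  refine ⟨A + ((2*m:ℕ):ℝ) ^ m + 1, by positivity, fun f hf1 hf2 => ?_⟩
  have hf : TF (n := 2*m) f := ⟨hf1, hf2⟩
  have ew : wLp m p s (negLapPow m f) = NN (n := 2*m) p s (lpl^[m] f) := by
    rw [negLapPow_eq hf]
    unfold wLp NN wt
    simp only [abs_mul, abs_pow, abs_neg, abs_one, one_pow, one_mul]
  have eM : Mnorm m (2*m) p δ f = ∑ j ∈ Finset.range (2*m+1), NN (n := 2*m) p (δ + j) (fun x => ‖iteratedFDeriv ℝ j f x‖) := by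
    unfold Mnorm NN wt
    simp only [abs_norm]
  have hw0 : 0 ≤ NN (n := 2*m) p s (lpl^[m] f) := NN_nonneg _ _ _
  have hM0 : 0 ≤ Mnorm m (2*m) p δ f := by rw [eM]; exact Finset.sum_nonneg fun _ _ => NN_nonneg _ _ _
  rw [ew]
  constructor
  · have : Mnorm m (2*m) p δ f ≤ A * NN (n := 2*m) p s (lpl^[m] f) := by
      rw [eM, hA, Finset.sum_mul]
      refine Finset.sum_le_sum fun j hj => ?_
      have hj' : j ≤ 2*m := by have := Finset.mem_range.mp hj; omega
      rw [Finset.sum_mul]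
      have := NN_le_sum hp (s := δ + j) (f := fun x => ‖iteratedFDeriv ℝ j f x‖) (S := Finset.univ)
        (t := fun _ => δ + j) (g := fun I : Fin j → Fin (2*m) => pds (List.ofFn I) f) (c := fun _ => 1)
        (fun _ _ => zero_le_one) (iter_cc hf j) (fun I _ => (hf.pds _).cc) (fun x => by
          simp only [one_mul]
          rw [← Finset.mul_sum, abs_norm]
          exact mul_le_mul_of_nonneg_left (norm_iter_le hf.1 j x) (wt_pos _ _).le)
      refine this.trans (Finset.sum_le_sum fun I _ => ?_)
      rw [one_mul]
      have h2 := hall' (2*m - j) (by omega) f hf (List.ofFn I) (by simp; omega)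
      have e : s - ((2*m - j : ℕ):ℝ) = δ + j := by rw [Nat.cast_sub hj', hsd]; push_cast; ring
      rw [e] at h2
      exact h2
    nlinarith
  · have : NN (n := 2*m) p s (lpl^[m] f) ≤ ((2*m:ℕ):ℝ) ^ m * Mnorm m (2*m) p δ f := by
      refine NN_lpl_iter hp m f hf _ fun l hl => ?_
      have h1 : NN p s (pds l f) ≤ 1 * NN (n := 2*m) p s (fun x => ‖iteratedFDeriv ℝ (2*m) f x‖) :=
        NN_le_of_le hp zero_le_one (hf.pds l).cc (iter_cc hf _) fun x => by
          rw [one_mul, abs_norm]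
          exact mul_le_mul_of_nonneg_left (pds_le_norm hf.1 l hl x) (wt_pos _ _).le
      rw [one_mul] at h1
      refine h1.trans ?_
      rw [eM]
      have h3 := Finset.single_le_sum (f := fun j : ℕ => NN (n := 2*m) p (δ + j) (fun x => ‖iteratedFDeriv ℝ j f x‖))
        (s := Finset.range (2*m+1)) (fun _ _ => NN_nonneg _ _ _) (Finset.mem_range.mpr (Nat.lt_succ_self _))
      refine le_trans (le_of_eq ?_) h3
      have : s = δ + ((2*m:ℕ):ℝ) := by rw [hsd]; push_cast; ring
      rw [this]
    nlinarith


/-! ## Density: compactly supported profiles and truncated potentials -/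

lemma CC.dec {n : ℕ} {κ : EE n → ℝ} (h : CC κ) : Dec κ := by
  refine ⟨h.1, ?_⟩
  obtain ⟨M, -, hM⟩ := (h.mul_left (continuous_wt ((n:ℝ)+2))).bounded
  refine ⟨M, fun z => ?_⟩
  have h1 := hM z
  rw [abs_mul, abs_of_pos (wt_pos _ z)] at h1
  have h2 : wt (-((n:ℝ)+2)) z * wt ((n:ℝ)+2) z = 1 := by
    rw [← wt_add, neg_add_cancel, wt_zero]
  calc |κ z| = (wt (-((n:ℝ)+2)) z * wt ((n:ℝ)+2) z) * |κ z| := by rw [h2, one_mul]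
    _ = wt (-((n:ℝ)+2)) z * (wt ((n:ℝ)+2) z * |κ z|) := by ring
    _ ≤ wt (-((n:ℝ)+2)) z * M := by
      have := (wt_pos (-((n:ℝ)+2)) z).le
      gcongr
    _ = _ := mul_comm _ _

lemma exists_profile {n : ℕ} (hn : 1 ≤ n) : ∃ η κ : EE n → ℝ, TF η ∧ TF κ ∧
    (∀ i z, pd i η z = -(z i * κ z)) ∧ 0 < ∫ z, κ z := by
  have hS : ContDiff ℝ (⊤ : ℕ∞) Real.smoothTransition := Real.smoothTransition.contDiff
  have hS' : ContDiff ℝ (⊤ : ℕ∞) (deriv Real.smoothTransition) :=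
    (contDiff_infty_iff_deriv.1 hS).2
  have hq : ContDiff ℝ (⊤ : ℕ∞) (fun z : EE n => 1 - ‖z‖^2) :=
    contDiff_const.sub (contDiff_id.norm_sq ℝ)
  have hd : ∀ t : ℝ, t ≤ 0 → deriv Real.smoothTransition t = 0 := by
    have h1 : ∀ t : ℝ, t < 0 → deriv Real.smoothTransition t = 0 := by
      intro t ht
      have : Real.smoothTransition =ᶠ[𝓝 t] fun _ => 0 := by
        filter_upwards [Iio_mem_nhds ht] with u hu
        exact Real.smoothTransition.zero_of_nonpos (le_of_lt hu)
      rw [this.deriv_eq]; simp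
    intro t ht
    have hcl : IsClosed {t : ℝ | deriv Real.smoothTransition t = 0} :=
      isClosed_eq hS'.continuous continuous_const
    have : closure (Iio (0:ℝ)) ⊆ {t : ℝ | deriv Real.smoothTransition t = 0} :=
      hcl.closure_subset_iff.2 h1
    rw [closure_Iio] at this
    exact this ht
  have hsupp : ∀ F : ℝ → ℝ, (∀ t, t ≤ 0 → F t = 0) →
      HasCompactSupport (fun z : EE n => F (1 - ‖z‖^2)) := by
    intro F hF
    refine HasCompactSupport.of_support_subset_isCompact (isCompact_closedBall (0 : EE n) 1) ?_
    intro z hz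
    by_contra h
    rw [mem_closedBall_zero_iff, not_le] at h
    exact hz (hF _ (by nlinarith))
  let η : EE n → ℝ := fun z => Real.smoothTransition (1 - ‖z‖^2)
  let κ : EE n → ℝ := fun z => 2 * deriv Real.smoothTransition (1 - ‖z‖^2)
  have hη : TF η := ⟨hS.comp hq, hsupp _ fun t ht => Real.smoothTransition.zero_of_nonpos ht⟩
  have hκ : TF κ := ⟨contDiff_const.mul (hS'.comp hq),
    (hsupp (fun t => 2 * deriv Real.smoothTransition t) fun t ht => by simp [hd t ht])⟩
  have hpd : ∀ i z, pd i η z = -(z i * κ z) := by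
    intro i z
    have h1 : HasFDerivAt (fun z : EE n => 1 - ‖z‖^2) (-(2 • (innerSL ℝ) z)) z := by
      simpa using (hasStrictFDerivAt_norm_sq z).hasFDerivAt.const_sub 1
    have h2 := ((hS.differentiable (by simp)) (1 - ‖z‖^2)).hasDerivAt.comp_hasFDerivAt z h1
    have h3 : fderiv ℝ η z = _ := h2.fderiv
    rw [pd, h3]
    simp only [smul_apply, neg_apply, innerSL_apply_apply, inner_bv, κ]
    simp; ring
  refine ⟨η, κ, hη, hκ, hpd, ?_⟩
  have hnn : 0 ≤ κ := fun z => mul_nonneg zero_le_two Real.smoothTransition.monotone.deriv_nonneg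
  obtain ⟨z0, hz0⟩ : ∃ z, κ z ≠ 0 := by
   by_contra! h0
   have hf : ∀ z, fderiv ℝ η z = 0 := by
    intro z; ext w
    rw [fderiv_eq_sum]
    simp [hpd, h0]
   have := is_const_of_fderiv_eq_zero hη.differentiable hf 0 (bv ⟨0, hn⟩)
   simp [η, norm_bv] at this
  exact hκ.1.continuous.integral_pos_of_hasCompactSupport_nonneg_nonzero hκ.2 hnn hz0

/-- The truncated potential kernel. -/
def TK {n : ℕ} (η : EE n → ℝ) (τ T : ℝ) (t : EE n) : ℝ :=
  ∫ r in τ..T, max r τ * dk η (max r τ) t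

lemma dk_joint {n : ℕ} {η : EE n → ℝ} (hη : Continuous η) {τ : ℝ} (hτ : 0 < τ) :
    Continuous (fun q : EE n × ℝ => max q.2 τ * dk η (max q.2 τ) q.1) := by
  have h0 : ∀ q : EE n × ℝ, max q.2 τ ≠ 0 := fun q => (lt_of_lt_of_le hτ (le_max_right _ _)).ne'
  have hm : Continuous (fun q : EE n × ℝ => max q.2 τ) := by fun_prop
  unfold dk
  have h1 : Continuous (fun q : EE n × ℝ => |((max q.2 τ) ^ n)⁻¹|) :=
    ((hm.pow n).inv₀ fun q => pow_ne_zero _ (h0 q)).abs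
  have h2 : Continuous (fun q : EE n × ℝ => η ((max q.2 τ)⁻¹ • q.1)) :=
    hη.comp ((hm.inv₀ h0).smul continuous_fst)
  exact hm.mul (h1.mul h2)

lemma TK_cont {n : ℕ} {η : EE n → ℝ} (hη : Continuous η) {τ : ℝ} (hτ : 0 < τ) (T : ℝ) :
    Continuous (TK η τ T) :=
  intervalIntegral.continuous_parametric_intervalIntegral_of_continuous' (dk_joint hη hτ) τ T

lemma CC.supp_ball {n : ℕ} {f : EE n → ℝ} (hf : CC f) : ∃ R, 1 ≤ R ∧ ∀ x, R < ‖x‖ → f x = 0 := by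
  obtain ⟨R, hR⟩ := hf.2.isCompact.isBounded.subset_closedBall (0 : EE n)
  refine ⟨max R 1, le_max_right _ _, fun x hx => ?_⟩
  by_contra h
  have := hR (subset_tsupport f h)
  rw [mem_closedBall_zero_iff] at this
  linarith [le_max_left R 1]

lemma TK_supp {n : ℕ} {η : EE n → ℝ} (hη : CC η) {τ T : ℝ} (hτ : 0 < τ) (hT : τ ≤ T) :
    HasCompactSupport (TK η τ T) := by
  obtain ⟨R, hR1, hR⟩ := hη.supp_ball
  refine HasCompactSupport.of_support_subset_isCompact (isCompact_closedBall (0 : EE n) (T*R)) ?_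
  intro z hz
  by_contra h
  rw [mem_closedBall_zero_iff, not_le] at h
  apply hz
  unfold TK
  rw [intervalIntegral.integral_congr (g := fun _ => 0)]
  · simp
  · intro r hr
    rw [uIcc_of_le hT] at hr
    have hr0 : 0 < r := hτ.trans_le hr.1
    have : η (r⁻¹ • z) = 0 := by
      apply hR
      rw [norm_smul, Real.norm_eq_abs, abs_of_pos (inv_pos.2 hr0), lt_inv_mul_iff₀ hr0]
      exact lt_of_le_of_lt (mul_le_mul_of_nonneg_right hr.2 (by linarith)) h
    simp [dk, max_eq_left hr.1, this]

lemma cv_TK {n : ℕ} {η g : EE n → ℝ} (hη : Continuous η) (hg : CC g) {τ T : ℝ} (hτ : 0 < τ) (hT : τ ≤ T)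
    (x : EE n) : cv (TK η τ T) g x = ∫ r in τ..T, r * PR η g r x := by
  have hc : HasCompactSupport fun t => g (x - t) :=
    hg.2.comp_homeomorph (Homeomorph.subLeft x)
  have hF : Continuous (fun q : ℝ × EE n => max q.1 τ * dk η (max q.1 τ) q.2 * g (x - q.2)) :=
    ((dk_joint hη hτ).comp continuous_swap).mul (hg.1.comp (by fun_prop))
  have hsw := intervalIntegral_integral_swap (μ := (volume : Measure (EE n))) (a := τ) (b := T)
    (f := fun r t => max r τ * dk η (max r τ) t * g (x - t)) (by
      have h1 : IntegrableOn (fun q : ℝ × EE n => max q.1 τ * dk η (max q.1 τ) q.2 * g (x - q.2))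
          (Icc τ T ×ˢ tsupport fun t => g (x - t)) ((volume : Measure ℝ).prod volume) :=
        hF.continuousOn.integrableOn_compact (isCompact_Icc.prod hc)
      have h2 : (volume.restrict (uIoc τ T)).prod (volume : Measure (EE n)) =
          ((volume : Measure ℝ).prod (volume : Measure (EE n))).restrict (uIoc τ T ×ˢ univ) := by
        rw [← Measure.prod_restrict, Measure.restrict_univ]
      rw [h2]
      refine IntegrableOn.of_forall_sdiff_eq_zero h1 (measurableSet_uIoc.prod MeasurableSet.univ) ?_
      rintro ⟨r, t⟩ ⟨h3, h4⟩
      have h5 : t ∉ tsupport fun t => g (x - t) := by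
        intro h5
        apply h4
        refine ⟨?_, h5⟩
        have := h3.1
        rw [uIoc_of_le hT] at this
        exact Ioc_subset_Icc_self this
      have := image_eq_zero_of_notMem_tsupport h5
      simp [this])
  unfold cv TK
  simp_rw [← intervalIntegral.integral_mul_const]
  rw [← hsw]
  refine intervalIntegral.integral_congr fun r hr => ?_
  rw [uIcc_of_le hT] at hr
  beta_reduce
  rw [PR_eq_cv η g (hτ.trans_le hr.1), cv, ← integral_const_mul, max_eq_left hr.1]
  congr 1; funext t; ring

lemma lpl_potential {n : ℕ} {η κ g : EE n → ℝ} (hη : TF η) (hκ : TF κ)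
    (hηκ : ∀ i z, pd i η z = - (z i * κ z)) (hg : TF g) {τ T : ℝ} (hτ : 0 < τ) (hT : τ ≤ T) :
    TF (cv (TK η τ T) g) ∧ lpl (cv (TK η τ T) g) = fun x => PR κ g T x - PR κ g τ x := by
  refine ⟨⟨cv_contDiff (TK_cont hη.1.continuous hτ T) hg, ?_⟩, ?_⟩
  · rw [cv_eq]
    exact (TK_supp hη.cc hτ hT).convolution _ hg.2
  · rw [lpl_cv (TK_cont hη.1.continuous hτ T) hg]
    funext x
    rw [cv_TK hη.1.continuous hg.lpl.cc hτ hT]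
    rw [intervalIntegral.integral_eq_sub_of_hasDerivAt (f := fun r => PR κ g r x)]
    · intro r hr
      rw [uIcc_of_le hT] at hr
      exact PR_hasDerivAt hκ.cc.dec hη.1 hηκ hg (hτ.trans_le hr.1).ne' x
    · apply Continuous.intervalIntegrable
      exact continuous_id.mul ((PR_cont hη.cc.dec hg.lpl.cc).comp (Continuous.prodMk continuous_id continuous_const))



/-! ## Density: error estimates -/

lemma CC_of_zero {n : ℕ} {f : EE n → ℝ} (hf : Continuous f) {R : ℝ} (h : ∀ x, R < ‖x‖ → f x = 0) :
    CC f := by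
  refine ⟨hf, HasCompactSupport.of_support_subset_isCompact (isCompact_closedBall (0 : EE n) R) ?_⟩
  intro z hz
  by_contra h1
  rw [mem_closedBall_zero_iff, not_le] at h1
  exact hz (h z h1)

lemma PR_supp {n : ℕ} {κ g : EE n → ℝ} {A B r : ℝ} (hκ : ∀ x, A < ‖x‖ → κ x = 0)
    (hg : ∀ x, B < ‖x‖ → g x = 0) (hr : 0 < r) {x : EE n} (hx : B + r * A < ‖x‖) : PR κ g r x = 0 := by
  unfold PR
  rw [integral_eq_zero_of_ae]
  refine Eventually.of_forall fun z => ?_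
  simp only [Pi.zero_apply, mul_eq_zero]
  by_cases h : A < ‖z‖
  · exact Or.inl (hκ z h)
  · right
    apply hg
    push Not at h
    have h1 : ‖x‖ ≤ ‖x + (-r) • z‖ + ‖(-r) • z‖ := by
      have := norm_sub_le (x + (-r) • z) ((-r) • z)
      simpa using this
    rw [norm_smul, norm_neg, Real.norm_eq_abs, abs_of_pos hr] at h1
    have := mul_le_mul_of_nonneg_left h hr.le
    linarith

lemma TF.lip {n : ℕ} {h : EE n → ℝ} (hh : TF h) : ∃ L, 0 ≤ L ∧ ∀ x y, |h x - h y| ≤ L * ‖x - y‖ := by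
  obtain ⟨C, hC⟩ := hh.1.lipschitzWith_of_hasCompactSupport hh.2 (by simp)
  refine ⟨C, C.2, fun x y => ?_⟩
  have := hC.dist_le_mul x y
  rwa [Real.dist_eq, dist_eq_norm] at this

lemma NN_tri {n : ℕ} {p s : ℝ} (hp : 1 < p) {f g h : EE n → ℝ} (hf : CC f) (hg : CC g) (hh : CC h)
    (H : ∀ x, |h x| ≤ |f x| + |g x|) : NN p s h ≤ NN p s f + NN p s g := by
  have := NN_le_sum hp (s := s) (f := h) (S := (Finset.univ : Finset (Fin 2))) (t := fun _ => s)
    (g := ![f, g]) (c := fun _ => 1) (by simp) hh (by simp [Fin.forall_fin_two, hf, hg]) (by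
      intro x
      simp only [Fin.sum_univ_two, Matrix.cons_val_zero, Matrix.cons_val_one, one_mul]
      rw [← mul_add]
      exact mul_le_mul_of_nonneg_left (H x) (wt_pos s x).le)
  simpa [Fin.sum_univ_two] using this

lemma small_scale {n : ℕ} {p s : ℝ} (hp : 1 < p) {κ h : EE n → ℝ} (hκ : TF κ) (hc : 0 < ∫ z, κ z)
    (hh : TF h) : ∃ C, 0 ≤ C ∧ ∀ τ, 0 < τ → τ ≤ 1 →
      CC (fun x => (∫ z, κ z)⁻¹ * PR κ h τ x - h x) ∧
      NN p s (fun x => (∫ z, κ z)⁻¹ * PR κ h τ x - h x) ≤ C * τ := by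
  obtain ⟨χ, K, hK, hχ⟩ := exists_cut n
  obtain ⟨A, hA1, hA⟩ := hκ.cc.supp_ball
  obtain ⟨B, hB1, hB⟩ := hh.cc.supp_ball
  obtain ⟨L, hL0, hL⟩ := hh.lip
  obtain ⟨hχT, hχ0, hχ1, hχe, -⟩ := hχ (B + A) (by linarith)
  set c := ∫ z, κ z with hcdef
  set I := ∫ z, ‖z‖ * |κ z| with hI
  have hI0 : 0 ≤ I := integral_nonneg fun z => by positivity
  refine ⟨c⁻¹ * (L * I) * NN p s (χ (B+A)), by have := NN_nonneg p s (χ (B+A)); positivity, fun τ hτ hτ1 => ?_⟩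
  have hz : ∀ x, B + A < ‖x‖ → c⁻¹ * PR κ h τ x - h x = 0 := by
    intro x hx
    rw [PR_supp hA hB hτ (by nlinarith), hB x (by linarith)]; simp
  have hcc : CC (fun x => c⁻¹ * PR κ h τ x - h x) := by
    refine CC_of_zero ?_ hz
    exact (continuous_const.mul (PR_contDiff hκ.1.continuous hh hτ).continuous).sub hh.1.continuous
  refine ⟨hcc, ?_⟩
  have hb : ∀ x, |c⁻¹ * PR κ h τ x - h x| ≤ c⁻¹ * (L * I) * τ := by
    intro x
    have h1 : c⁻¹ * PR κ h τ x - h x = c⁻¹ * ∫ z, κ z * (h (x + (-τ) • z) - h x) := by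
      have : ∫ z, κ z * (h (x + (-τ) • z) - h x) = PR κ h τ x - c * h x := by
        simp only [mul_sub]
        rw [integral_sub (PR_int hκ.cc.dec hh.cc τ x) (hκ.cc.integrable.mul_const _), integral_mul_const]
        rfl
      rw [this]; field_simp
    rw [h1, abs_mul, abs_of_pos (inv_pos.2 hc), mul_assoc]
    refine mul_le_mul_of_nonneg_left ?_ (inv_pos.2 hc).le
    rw [← Real.norm_eq_abs]
    have h2 := norm_integral_le_of_norm_le (f := fun z => κ z * (h (x + (-τ) • z) - h x))
      ((hκ.cc.dec.integrable_mul).const_mul (L * τ)) (Eventually.of_forall fun z => by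
        rw [Real.norm_eq_abs, abs_mul]
        have h3 := hL (x + (-τ) • z) x
        rw [add_sub_cancel_left, norm_smul, norm_neg, Real.norm_eq_abs, abs_of_pos hτ] at h3
        have := mul_le_mul_of_nonneg_left h3 (abs_nonneg (κ z))
        linarith)
    rw [integral_const_mul] at h2
    refine h2.trans (le_of_eq ?_)
    rw [← hI]; ring
  have hCC : 0 ≤ c⁻¹ * (L * I) * τ :=
    mul_nonneg (mul_nonneg (inv_pos.2 hc).le (mul_nonneg hL0 hI0)) hτ.le
  have := NN_le_of_le hp (s := s) (t := s) (C := c⁻¹ * (L * I) * τ) hCC hcc hχT.cc (by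
    intro x
    by_cases hx : B + A < ‖x‖
    · rw [hz x hx, abs_zero, mul_zero]
      exact mul_nonneg hCC (mul_nonneg (wt_pos s x).le (abs_nonneg _))
    · rw [hχe x (not_lt.1 hx), abs_one, mul_one, mul_comm]
      exact mul_le_mul_of_nonneg_right (hb x) (wt_pos s x).le)
  linarith

lemma wt_scale {n : ℕ} {s T : ℝ} (hs : 0 ≤ s) (hT : 1 ≤ T) (z : EE n) :
    wt s (T • z) ≤ T ^ s * wt s z := by
  unfold wt
  have h0 : T ^ s = (T^2) ^ (s/2) := by
    rw [← Real.rpow_natCast, ← Real.rpow_mul (by linarith)]; congr 1; push_cast; ring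
  rw [h0, ← Real.mul_rpow (by positivity) (by positivity)]
  refine Real.rpow_le_rpow (by positivity) ?_ (by positivity)
  rw [norm_smul, Real.norm_eq_abs, abs_of_nonneg (by linarith)]
  have : 1 ≤ T^2 := one_le_pow₀ hT
  nlinarith

lemma NN_scale {n : ℕ} {p s T : ℝ} (hp : 1 < p) (hs : 0 ≤ s) (hT : 1 ≤ T) {b : EE n → ℝ} (hb : CC b) :
    NN p s (fun x => b (0 + T⁻¹ • x)) ≤ T ^ (s + n / p) * NN p s b := by
  have hT0 : 0 < T := by linarith
  have hp0 : 0 < p := by linarith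
  have h1 := integral_affine (fun x => (wt s x * |b (0 + T⁻¹ • x)|) ^ p) 0 (c := T)
  simp only [zero_add, smul_smul, inv_mul_cancel₀ hT0.ne', one_smul] at h1
  rw [abs_of_pos (by positivity)] at h1
  have h2 : ∫ x, (wt s x * |b (0 + T⁻¹ • x)|) ^ p = T ^ n * ∫ z, (wt s (T • z) * |b z|) ^ p := by
    simp only [zero_add]
    rw [h1]; field_simp
  have hi1 : Integrable fun z => (wt s z * |b z|) ^ p := by
    have := absp_integrable hp (hb.mul_left (continuous_wt s))
    simpa only [abs_mul, abs_of_pos (wt_pos s _)] using this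
  have hi2 : Integrable fun z => (wt s (T • z) * |b z|) ^ p := by
    have h : Continuous fun z : EE n => wt s (T • z) := (continuous_wt s).comp (by fun_prop)
    have := absp_integrable hp (hb.mul_left h)
    simpa only [abs_mul, abs_of_pos (wt_pos s _)] using this
  have h3 : ∫ z, (wt s (T • z) * |b z|) ^ p ≤ ∫ z, (T ^ s) ^ p * (wt s z * |b z|) ^ p := by
    refine integral_mono hi2 (hi1.const_mul _) fun z => ?_
    have := (wt_pos s z).le
    have := (wt_pos s (T • z)).le
    beta_reduce
    rw [← Real.mul_rpow (by positivity) (by positivity), ← mul_assoc]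
    have := wt_scale hs hT z
    gcongr
  rw [integral_const_mul] at h3
  have h4 : ∫ x, (wt s x * |b (0 + T⁻¹ • x)|) ^ p ≤ (T ^ (s + n/p)) ^ p * ∫ z, (wt s z * |b z|) ^ p := by
    rw [h2]
    refine (mul_le_mul_of_nonneg_left h3 (by positivity)).trans (le_of_eq ?_)
    rw [← mul_assoc]
    congr 1
    rw [← Real.rpow_natCast, ← Real.rpow_mul hT0.le, ← Real.rpow_mul hT0.le, ← Real.rpow_add hT0]
    congr 1
    field_simp; ring
  have hJ : 0 ≤ ∫ z, (wt s z * |b z|) ^ p := integral_nonneg fun z => by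
    have := (wt_pos s z).le
    positivity
  have h5 : 0 ≤ ∫ x, (wt s x * |b (0 + T⁻¹ • x)|) ^ p := integral_nonneg fun z => by
    have := (wt_pos s z).le
    positivity
  unfold NN
  refine (Real.rpow_le_rpow h5 h4 (by positivity)).trans (le_of_eq ?_)
  rw [Real.mul_rpow (by positivity) hJ, ← Real.rpow_mul (by positivity), mul_one_div_cancel hp0.ne', Real.rpow_one]

lemma large_scale {n : ℕ} {p s : ℝ} (hp : 1 < p) (hs : 0 ≤ s) {κ h : EE n → ℝ} (hκ : TF κ)
    (hh : TF h) (h0 : ∫ x, h x = 0) : ∃ C, 0 ≤ C ∧ ∀ T, 1 ≤ T →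
      CC (PR κ h T) ∧ NN p s (PR κ h T) ≤ C * T ^ (s + n/p - n - 1) := by
  obtain ⟨χ, K, hK, hχ⟩ := exists_cut n
  obtain ⟨A, hA1, hA⟩ := hκ.cc.supp_ball
  obtain ⟨B, hB1, hB⟩ := hh.cc.supp_ball
  obtain ⟨L, hL0, hL⟩ := hκ.lip
  obtain ⟨hχT, hχ0, hχ1, hχe, -⟩ := hχ (B + A) (by linarith)
  set I := ∫ z, ‖z‖ * |h z| with hI
  have hI0 : 0 ≤ I := integral_nonneg fun z => by positivity
  refine ⟨L * I * NN p s (χ (B+A)), by have := NN_nonneg p s (χ (B+A)); positivity, fun T hT => ?_⟩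
  have hT0 : 0 < T := by linarith
  have hz : ∀ x, T * (B + A) < ‖x‖ → PR κ h T x = 0 := by
    intro x hx
    exact PR_supp hA hB hT0 (by nlinarith)
  have hcc : CC (PR κ h T) := CC_of_zero (PR_contDiff hκ.1.continuous hh hT0).continuous hz
  refine ⟨hcc, ?_⟩
  have hb : ∀ x, |PR κ h T x| ≤ T ^ (-(n:ℝ) - 1) * (L * I) := by
    intro x
    have h1 : PR κ h T x = ∫ y, (dk κ T (x - y) - dk κ T x) * h y := by
      have e1 : PR κ h T x = ∫ y, dk κ T (x - y) * h y := by
        rw [PR_eq_cv κ h hT0, cv, ← integral_sub_left_eq_self (fun y => dk κ T (x - y) * h y) volume x]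
        simp
      have hi : Integrable fun y => dk κ T (x - y) * h y :=
        (hh.cc.mul_left ((dk_cont hκ.1.continuous T).comp (continuous_const.sub continuous_id))).integrable
      simp only [sub_mul]
      rw [integral_sub hi (hh.cc.integrable.const_mul _), integral_const_mul, h0, e1]; simp
    have hT1 : T ^ (-(n:ℝ) - 1) = |(T ^ n)⁻¹| * T⁻¹ := by
      rw [abs_of_pos (by positivity), Real.rpow_sub hT0, Real.rpow_neg hT0.le, Real.rpow_natCast, Real.rpow_one]
      rfl
    rw [h1, ← Real.norm_eq_abs]
    have h2 := norm_integral_le_of_norm_le (f := fun y => (dk κ T (x - y) - dk κ T x) * h y)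
      ((hh.cc.dec.integrable_mul).const_mul (T ^ (-(n:ℝ) - 1) * L)) (Eventually.of_forall fun y => by
        rw [Real.norm_eq_abs, abs_mul, dk, dk, ← mul_sub, abs_mul, abs_abs, hT1]
        have h3 := hL (T⁻¹ • (x - y)) (T⁻¹ • x)
        rw [← smul_sub, sub_sub_cancel_left, norm_smul, norm_neg, Real.norm_eq_abs, abs_of_pos (inv_pos.2 hT0)] at h3
        have := mul_le_mul_of_nonneg_left h3 (mul_nonneg (abs_nonneg ((T ^ n)⁻¹)) (abs_nonneg (h y)))
        linarith)
    rw [integral_const_mul] at h2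
    refine h2.trans (le_of_eq ?_)
    rw [← hI]; ring
  have hbb : CC (fun x => χ (B + A) (0 + T⁻¹ • x)) := (hχT.affine 0 (inv_ne_zero hT0.ne')).cc
  have hCC : 0 ≤ T ^ (-(n:ℝ) - 1) * (L * I) := mul_nonneg (Real.rpow_nonneg hT0.le _) (mul_nonneg hL0 hI0)
  have h6 := NN_le_of_le hp (s := s) (t := s) (C := T ^ (-(n:ℝ) - 1) * (L * I)) hCC hcc hbb (by
    intro x
    by_cases hx : T * (B + A) < ‖x‖
    · rw [hz x hx, abs_zero, mul_zero]
      exact mul_nonneg hCC (mul_nonneg (wt_pos s x).le (abs_nonneg _))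
    · rw [hχe, abs_one, mul_one, mul_comm]
      · exact mul_le_mul_of_nonneg_right (hb x) (wt_pos s x).le
      · rw [zero_add, norm_smul, Real.norm_eq_abs, abs_of_pos (inv_pos.2 hT0), inv_mul_le_iff₀ hT0]
        exact not_lt.1 hx)
  refine h6.trans ((mul_le_mul_of_nonneg_left (NN_scale hp hs hT hχT.cc) hCC).trans (le_of_eq ?_))
  have : T ^ (s + n/p - n - 1) = T ^ (-(n:ℝ) - 1) * T ^ (s + n/p) := by
    rw [← Real.rpow_add hT0]; congr 1; ring
  rw [this]; ring

lemma lpl_iter_cv {n : ℕ} {K g : EE n → ℝ} (hK : Continuous K) (hg : TF g) (k : ℕ) :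
    lpl^[k] (cv K g) = cv K (lpl^[k] g) := by
  induction k with
  | zero => rfl
  | succ k ih => rw [Function.iterate_succ_apply', ih, lpl_cv hK (hg.lpl_iter k), Function.iterate_succ_apply']

lemma lpl_iter_const_mul {n : ℕ} {u : EE n → ℝ} (hu : TF u) (c : ℝ) (k : ℕ) :
    lpl^[k] (fun x => c * u x) = fun x => c * lpl^[k] u x := by
  induction k with
  | zero => rfl
  | succ k ih => rw [Function.iterate_succ_apply', ih, lpl_const_mul (hu.lpl_iter k).1, Function.iterate_succ_apply']

lemma TF.const_mul {n : ℕ} {u : EE n → ℝ} (hu : TF u) (c : ℝ) : TF (fun x => c * u x) :=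
  hu.mul_left contDiff_const

lemma approx_step {n : ℕ} (hn : 1 ≤ n) {p s : ℝ} (hp : 1 < p) (hs : 0 ≤ s) (hs1 : s + n/p < n + 1)
    {f : EE n → ℝ} (hf : TF f) (k : ℕ) (h0 : ∫ x, lpl^[k] f x = 0) {ε : ℝ} (hε : 0 < ε) :
    ∃ u, TF u ∧ NN p s (fun x => lpl^[k+1] u x - lpl^[k] f x) < ε := by
  obtain ⟨η, κ, hη, hκ, hηκ, hc⟩ := exists_profile hn
  set h := lpl^[k] f with hdef
  have hh : TF h := hf.lpl_iter k
  obtain ⟨C1, hC1, H1⟩ := small_scale (s := s) hp hκ hc hh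
  obtain ⟨C2, hC2, H2⟩ := large_scale hp hs hκ hh h0
  set c := ∫ z, κ z with hcdef
  obtain ⟨τ, hτ0, hτ1, hτ⟩ : ∃ τ, 0 < τ ∧ τ ≤ 1 ∧ C1 * τ < ε / 2 := by
    refine ⟨min 1 (ε / (4 * (C1 + 1))), by positivity, min_le_left _ _, ?_⟩
    calc C1 * min 1 (ε / (4 * (C1 + 1))) ≤ C1 * (ε / (4 * (C1 + 1))) := by gcongr; exact min_le_right _ _
      _ ≤ (C1 + 1) * (ε / (4 * (C1 + 1))) := by gcongr; linarith
      _ = ε / 4 := by field_simp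
      _ < ε / 2 := by linarith
  obtain ⟨T, hT1, hT⟩ : ∃ T : ℝ, 1 ≤ T ∧ c⁻¹ * (C2 * T ^ (s + n/p - n - 1)) < ε / 2 := by
    have ht : Tendsto (fun T : ℝ => c⁻¹ * (C2 * T ^ (s + n/p - n - 1))) atTop (𝓝 (c⁻¹ * (C2 * 0))) := by
      have := tendsto_rpow_neg_atTop (y := -(s + n/p - n - 1)) (by linarith)
      rw [neg_neg] at this
      exact (this.const_mul C2).const_mul _
    simp only [mul_zero] at ht
    obtain ⟨T, h1, h2⟩ := ((eventually_ge_atTop (1:ℝ)).and (ht.eventually_lt_const (by positivity : 0 < ε/2))).exists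
    exact ⟨T, h1, h2⟩
  have hT0 : 0 < T := by linarith
  obtain ⟨hw, hlw⟩ := lpl_potential hη hκ hηκ hh hτ0 (hτ1.trans hT1)
  obtain ⟨hv, -⟩ := lpl_potential hη hκ hηκ hf hτ0 (hτ1.trans hT1)
  have hE : lpl^[k+1] (fun x => (-c⁻¹) * cv (TK η τ T) f x) = fun x => c⁻¹ * PR κ h τ x - c⁻¹ * PR κ h T x := by
    rw [lpl_iter_const_mul hv, Function.iterate_succ_apply', lpl_iter_cv (TK_cont hη.1.continuous hτ0 T) hf, hlw]
    funext x; ring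
  refine ⟨fun x => (-c⁻¹) * cv (TK η τ T) f x, hv.const_mul _, ?_⟩
  rw [hE]
  obtain ⟨a1, a2⟩ := H1 τ hτ0 hτ1
  obtain ⟨b1, b2⟩ := H2 T hT1
  have hbc : CC (fun x => c⁻¹ * PR κ h T x) := b1.mul_left continuous_const
  have hb3 : NN p s (fun x => c⁻¹ * PR κ h T x) ≤ c⁻¹ * NN p s (PR κ h T) :=
    NN_le_of_le hp (inv_pos.2 hc).le hbc b1 fun x => by
      rw [abs_mul, abs_of_pos (inv_pos.2 hc)]; exact le_of_eq (by ring)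
  have hb4 : c⁻¹ * NN p s (PR κ h T) ≤ c⁻¹ * (C2 * T ^ (s + n/p - n - 1)) :=
    mul_le_mul_of_nonneg_left b2 (inv_pos.2 hc).le
  have htot : CC (fun x => c⁻¹ * PR κ h τ x - c⁻¹ * PR κ h T x - h x) := by
    have := a1.add (hbc.mul_left (continuous_const (y := (-1:ℝ))))
    convert this using 2
    ring
  have := NN_tri (s := s) hp a1 hbc htot fun x => by
    have e : c⁻¹ * PR κ h τ x - c⁻¹ * PR κ h T x - h x =
        (c⁻¹ * PR κ h τ x - h x) - (c⁻¹ * PR κ h T x) := by ring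
    rw [e]; exact abs_sub _ _
  linarith

lemma approx_smooth {n : ℕ} (hn : 1 ≤ n) {p s : ℝ} (hp : 1 < p) (hs : 0 ≤ s) (hs1 : s + n/p < n + 1)
    {g : EE n → ℝ} (hg : TF g) (h0 : ∫ x, g x = 0) (k : ℕ) : ∀ ε, 0 < ε →
    ∃ u, TF u ∧ (∫ x, lpl^[k] u x = 0) ∧ NN p s (fun x => lpl^[k] u x - g x) < ε := by
  induction k with
  | zero =>
    intro ε hε
    refine ⟨g, hg, h0, ?_⟩
    have hp0 : 0 < p := by linarith
    simp [NN, Real.zero_rpow hp0.ne', Real.zero_rpow (inv_ne_zero hp0.ne'), hε]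
  | succ k ih =>
    intro ε hε
    obtain ⟨f, hf, hf0, hfe⟩ := ih (ε/2) (by positivity)
    obtain ⟨u, hu, hue⟩ := approx_step hn hp hs hs1 hf k hf0 (ε := ε/2) (by positivity)
    refine ⟨u, hu, ?_, ?_⟩
    · rw [Function.iterate_succ_apply']; exact integral_lpl (hu.lpl_iter k)
    · have := NN_tri (s := s) hp ((hu.lpl_iter (k+1)).sub (hf.lpl_iter k)).cc ((hf.lpl_iter k).sub hg).cc
        ((hu.lpl_iter (k+1)).sub hg).cc fun x => by
          exact abs_sub_le _ _ _
      linarith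



/-! ## Density: reduction to test functions, and the main theorem -/

lemma NN_add_le {n : ℕ} {p s : ℝ} (hp : 1 < p) {f g : EE n → ℝ}
    (hf : MemLp (fun x => wt s x * f x) (ENNReal.ofReal p))
    (hg : MemLp (fun x => wt s x * g x) (ENNReal.ofReal p)) :
    NN p s (fun x => f x + g x) ≤ NN p s f + NN p s g := by
  have hp1 : (1 : ENNReal) ≤ ENNReal.ofReal p := by
    rw [ENNReal.one_le_ofReal]; exact hp.le
  have e : (fun x => wt s x * (f x + g x)) = (fun x => wt s x * f x) + fun x => wt s x * g x := by
    funext x; simp only [Pi.add_apply]; ring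
  have hfg : MemLp (fun x => wt s x * (f x + g x)) (ENNReal.ofReal p) := by
    rw [e]; exact hf.add hg
  rw [NN_eq hp s hf, NN_eq hp s hg, NN_eq hp s hfg, ← ENNReal.toReal_add hf.2.ne hg.2.ne, e]
  exact ENNReal.toReal_mono (ENNReal.add_ne_top.2 ⟨hf.2.ne, hg.2.ne⟩) (eLpNorm_add_le hf.1 hg.1 hp1)

lemma abs_integral_le_NN {n : ℕ} {p s : ℝ} (hp : 1 < p) (hs : n < s + n / p) :
    ∃ C, 0 ≤ C ∧ ∀ v : EE n → ℝ, MemLp (fun x => wt s x * v x) (ENNReal.ofReal p) →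
      |∫ x, v x| ≤ C * NN p s v := by
  have hp0 : 0 < p := by linarith
  have hpq : p.HolderConjugate p.conjExponent := Real.HolderConjugate.conjExponent hp
  set q := p.conjExponent with hq
  have hq0 : 0 < q := hpq.symm.pos
  have hsq : (n:ℝ) < s * q := by
    have h1 : p⁻¹ + q⁻¹ = 1 := hpq.inv_add_inv_eq_one
    have h2 : (n:ℝ) * q⁻¹ < s := by
      have : q⁻¹ = 1 - p⁻¹ := by linarith
      rw [this, mul_sub, mul_one, ← div_eq_mul_inv]; linarith
    rw [← div_eq_mul_inv, div_lt_iff₀ hq0] at h2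
    exact h2
  have hw : MemLp (fun x : EE n => wt (-s) x) (ENNReal.ofReal q) := by
    rw [← integrable_norm_rpow_iff (continuous_wt (-s)).aestronglyMeasurable (by simpa using hq0) (by simp),
      ENNReal.toReal_ofReal hq0.le]
    have := integrable_wt (n := n) hsq
    refine this.congr (Eventually.of_forall fun x => ?_)
    beta_reduce
    rw [Real.norm_eq_abs, abs_of_pos (wt_pos _ x), wt_rpow, neg_mul]
  refine ⟨(∫ x : EE n, ‖wt (-s) x‖ ^ q) ^ (1/q), by positivity, fun v hv => ?_⟩
  have h1 := integral_mul_norm_le_Lp_mul_Lq hpq hv hw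
  have h2 : (∫ x, ‖wt s x * v x‖ ^ p) ^ (1/p) = NN p s v := by
    unfold NN
    simp only [norm_mul, Real.norm_eq_abs, abs_of_pos (wt_pos s _)]
  rw [h2] at h1
  have h3 : ∫ x, ‖wt s x * v x‖ * ‖wt (-s) x‖ = ∫ x, |v x| := by
    congr 1; funext x
    rw [norm_mul, Real.norm_eq_abs, Real.norm_eq_abs, Real.norm_eq_abs, abs_of_pos (wt_pos s x),
      abs_of_pos (wt_pos (-s) x)]
    have : wt s x * wt (-s) x = 1 := by rw [← wt_add, add_neg_cancel, wt_zero]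
    calc wt s x * |v x| * wt (-s) x = (wt s x * wt (-s) x) * |v x| := by ring
      _ = _ := by rw [this, one_mul]
  rw [h3] at h1
  have := abs_integral_le_integral_abs (f := v) (μ := volume)
  linarith

lemma part_dense {n : ℕ} (hn : 1 ≤ n) {p s : ℝ} (hp : 1 < p) (hs0 : n < s + n / p)
    (hs1 : s + n / p < n + 1) (k : ℕ) {g : EE n → ℝ} (hgm : Measurable g)
    (hgp : Integrable fun x => (wt s x * |g x|) ^ p) (hgi : Integrable g) (hg0 : ∫ x, g x = 0)
    {ε : ℝ} (hε : 0 < ε) : ∃ u, TF u ∧ NN p s (fun x => lpl^[k] u x - g x) < ε := by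
  have hp0 : 0 < p := by linarith
  have hp1 : (1 : ENNReal) ≤ ENNReal.ofReal p := by
    rw [ENNReal.one_le_ofReal]; exact hp.le
  have hs : 0 ≤ s := by
    have : (n:ℝ) / p ≤ n := div_le_self (Nat.cast_nonneg n) hp.le
    linarith
  have hgL : MemLp (fun x => wt s x * g x) (ENNReal.ofReal p) := by
    have hae : AEStronglyMeasurable (fun x => wt s x * g x) (volume : Measure (EE n)) :=
      (continuous_wt s).aestronglyMeasurable.mul hgm.aestronglyMeasurable
    rw [← integrable_norm_rpow_iff hae
      (by simpa using hp0) (by simp), ENNReal.toReal_ofReal hp0.le]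
    simpa only [norm_mul, Real.norm_eq_abs, abs_of_pos (wt_pos s _)] using hgp
  obtain ⟨C, hC0, hC⟩ := abs_integral_le_NN (n := n) hp hs0
  obtain ⟨-, κ, -, hκ, -, hc⟩ := exists_profile hn
  obtain ⟨b, hb, hb1⟩ : ∃ b : EE n → ℝ, TF b ∧ ∫ x, b x = 1 :=
    ⟨fun x => (∫ z, κ z)⁻¹ * κ x, hκ.const_mul _, by
      rw [integral_const_mul, inv_mul_cancel₀ hc.ne']⟩
  set N := NN p s b with hN
  have hN0 : 0 ≤ N := NN_nonneg _ _ _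
  obtain ⟨e, he0, he⟩ : ∃ e, 0 < e ∧ (1 + C * N) * e < ε / 2 := by
    refine ⟨ε / (4 * (1 + C * N)), by positivity, ?_⟩
    have : (1 + C * N) * (ε / (4 * (1 + C * N))) = ε / 4 := by field_simp
    linarith
  obtain ⟨φ, hφc, hφs, hφ⟩ := hgL.exist_eLpNorm_sub_le (by simp) hp1 he0
  have hφT : TF φ := ⟨hφs, hφc⟩
  have hg1 : TF (fun x => wt (-s) x * φ x) := hφT.mul_left (contDiff_wt (-s))
  set g1 : EE n → ℝ := fun x => wt (-s) x * φ x with hg1def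
  have hwg1 : ∀ x, wt s x * g1 x = φ x := by
    intro x
    have : wt s x * wt (-s) x = 1 := by rw [← wt_add, add_neg_cancel, wt_zero]
    rw [hg1def]; beta_reduce
    rw [← mul_assoc, this, one_mul]
  have hdm : MemLp (fun x => wt s x * (g1 x - g x)) (ENNReal.ofReal p) := by
    simp only [mul_sub]
    exact (hg1.cc.memLp s).sub hgL
  have hd : NN p s (fun x => g1 x - g x) ≤ e := by
    rw [NN_eq hp s hdm]
    refine ENNReal.toReal_le_of_le_ofReal he0.le ?_
    rw [eLpNorm_sub_comm] at hφ
    convert hφ using 2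
    funext x
    simp only [Pi.sub_apply, mul_sub, hwg1]
  have hI : |∫ x, g1 x| ≤ C * e := by
    have h1 := hC _ hdm
    rw [integral_sub hg1.cc.integrable hgi, hg0, sub_zero] at h1
    exact h1.trans (mul_le_mul_of_nonneg_left hd hC0)
  set J := ∫ x, g1 x with hJ
  have hJb : TF (fun x => J * b x) := hb.const_mul J
  have hg0T : TF (fun x => g1 x - J * b x) := hg1.sub hJb
  have hg00 : ∫ x, (g1 x - J * b x) = 0 := by
    rw [integral_sub hg1.cc.integrable hJb.cc.integrable, integral_const_mul, hb1, mul_one, ← hJ, sub_self]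
  obtain ⟨u, hu, -, hue⟩ := approx_smooth hn hp hs hs1 hg0T hg00 k (ε / 2) (by positivity)
  refine ⟨u, hu, ?_⟩
  have hU := hu.lpl_iter k
  have hJN : NN p s (fun x => J * b x) ≤ (C * e) * N :=
    NN_le_of_le hp (by positivity) hJb.cc hb.cc fun x => by
      rw [abs_mul]
      have := mul_le_mul_of_nonneg_right hI (mul_nonneg (wt_pos s x).le (abs_nonneg (b x)))
      linarith
  have t1 : NN p s (fun x => lpl^[k] u x - g1 x) ≤
      NN p s (fun x => lpl^[k] u x - (g1 x - J * b x)) + NN p s (fun x => J * b x) :=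
    NN_tri hp (hU.sub hg0T).cc hJb.cc (hU.sub hg1).cc fun x => by
      have e : lpl^[k] u x - g1 x = (lpl^[k] u x - (g1 x - J * b x)) - J * b x := by ring
      rw [e]; exact abs_sub _ _
  have t2 := NN_add_le hp ((hU.sub hg1).cc.memLp (p := p) s) hdm
  have e2 : (fun x => lpl^[k] u x - g1 x + (g1 x - g x)) = fun x => lpl^[k] u x - g x := by
    funext x; ring
  rw [e2] at t2
  linarith


/-- **McOwen-type isomorphism theorem.** For `1 < p < ∞` and
`δ ∈ (−2m/p, −2m/p + 1)`, the operator `(−Δ)^m : M^p_{2m,δ}(ℝ^{2m}) → Γ^p_δ(ℝ^{2m})` is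
an isomorphism. Since `M^p_{2m,δ}` is the completion of `C_c^∞`, this is expressed by:
two-sided norm equivalence `C⁻¹‖f‖_{M^p_{2m,δ}} ≤ ‖(−Δ)^m f‖_{L^p_{2m+δ}} ≤ C‖f‖_{M^p_{2m,δ}}`
on `C_c^∞`, together with density of `(−Δ)^m(C_c^∞)` in
`Γ^p_δ = {g ∈ L^p_{2m+δ} : ∫ g = 0}`. -/
theorem statement16 (m : ℕ) (hm : 1 ≤ m) (p : ℝ) (hp : 1 < p)
    (δ : ℝ) (hδ : δ ∈ Set.Ioo (-(2*m : ℝ)/p) (-(2*m : ℝ)/p + 1)) :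
    ∃ C : ℝ, 0 < C ∧
      (∀ f : Euc m → ℝ, ContDiff ℝ (⊤ : ℕ∞) f → HasCompactSupport f →
        Mnorm m (2*m) p δ f ≤ C * wLp m p (2*m + δ) (negLapPow m f) ∧
        wLp m p (2*m + δ) (negLapPow m f) ≤ C * Mnorm m (2*m) p δ f) ∧
      (∀ g : Euc m → ℝ, Measurable g →
        Integrable (fun x : Euc m => ((1 + ‖x‖^2) ^ ((2*m + δ)/2) * |g x|) ^ p) →
        Integrable g → (∫ x, g x) = 0 →
        ∀ ε : ℝ, 0 < ε → ∃ f : Euc m → ℝ, ContDiff ℝ (⊤ : ℕ∞) f ∧ HasCompactSupport f ∧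
          wLp m p (2*m + δ) (fun x => negLapPow m f x - g x) < ε) := by
  obtain ⟨C, hC, h1⟩ := part_norm m hm p hp δ hδ
  refine ⟨C, hC, h1, ?_⟩
  intro g hgm hgp hgi hg0 ε hε
  have hcast : ((2 * m : ℕ) : ℝ) = 2 * (m : ℝ) := by push_cast; ring
  have h2 := hδ.1
  have h3 := hδ.2
  rw [neg_div] at h2 h3
  obtain ⟨u, hu, hue⟩ := part_dense (n := 2 * m) (s := 2 * m + δ) (by omega) hp
    (by rw [hcast]; linarith) (by rw [hcast]; linarith) m hgm hgp hgi hg0 hε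
  have hu' : TF (fun x => (-1) ^ m * u x) := hu.const_mul _
  refine ⟨fun x => (-1) ^ m * u x, hu'.1, hu'.2, ?_⟩
  rw [negLapPow_eq hu' m, lpl_iter_const_mul hu]
  have hsq : ((-1 : ℝ) ^ m) * (-1) ^ m = 1 := by rw [← mul_pow]; simp
  simp only [← mul_assoc, hsq, one_mul]
  exact hue
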